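/- Let γ : ℝ × (-∞,0] → ℝ² be an ancient closed embedded smooth curve shortening flow (γ 1-periodic in u, γ(·,t) injective on [0,1) for each t) whose entropy equals a positive integer m. Then for every t ≤ 0, the total curvature satisfies ∫_{[0,1)} |κ(u,t)| |∂_u γ(u,t)| du ≤ (2m + 1)π. -/

import Mathlib

open Real MeasureTheory Set Filter
open scoped RealInnerProductSpace ENNReal

noncomputable section

/-- The Euclidean plane. -/
abbrev R2 := EuclideanSpace ℝ (Fin 2)

/-- The point of `ℝ²` with coordinates `(x, y)`. -/
def toR2 (x y : ℝ) : R2 := (WithLp.equiv 2 (Fin 2 → ℝ)).symm ![x, y]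

/-- Counterclockwise rotation of the plane by `π/2`. -/
def Jrot (v : R2) : R2 := toR2 (-(v 1)) (v 0)

/-- Arclength derivative `∂ₛ := |∂ᵤγ|⁻¹ ∂ᵤ` along the time-`t` curve of the flow `γ`,
applied to a function `f` of `(u, t)`. -/
def aderiv (γ : ℝ → ℝ → R2) {F : Type} [NormedAddCommGroup F] [NormedSpace ℝ F]
    (f : ℝ → ℝ → F) (u t : ℝ) : F :=
  ‖deriv (fun v => γ v t) u‖⁻¹ • deriv (fun v => f v t) u

/-- The unit tangent `T = ∂ᵤγ / |∂ᵤγ|`. -/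
def unitT (γ : ℝ → ℝ → R2) (u t : ℝ) : R2 := aderiv γ γ u t

/-- The unit normal `n = J T`. -/
def unitN (γ : ℝ → ℝ → R2) (u t : ℝ) : R2 := Jrot (unitT γ u t)

/-- The signed curvature `κ = ⟨∂ₛT, n⟩`. -/
def curv (γ : ℝ → ℝ → R2) (u t : ℝ) : ℝ := ⟪aderiv γ (unitT γ) u t, unitN γ u t⟫

/-- `γ : ℝ × I → ℝ²` is a smooth curve shortening flow in fixed-parametrization form:
smooth, regular (`∂ᵤγ ≠ 0`), and `∂ₜγ = ∂ₛ(∂ₛγ)` (time derivative taken within `I`). -/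
structure IsCSF (γ : ℝ → ℝ → R2) (I : Set ℝ) : Prop where
  smooth : ContDiffOn ℝ (⊤ : ℕ∞) (fun p : ℝ × ℝ => γ p.1 p.2) (univ ×ˢ I)
  regular : ∀ (u : ℝ), ∀ t ∈ I, deriv (fun v => γ v t) u ≠ 0
  flow : ∀ (u : ℝ), ∀ t ∈ I, derivWithin (fun s => γ u s) I t = aderiv γ (aderiv γ γ) u t

/-- The Gaussian weighted length `F_{x₀,l}` of the time-`t` curve (as an extended real). -/
def gaussLenE (γ : ℝ → ℝ → R2) (x₀ : R2) (l t : ℝ) : ℝ≥0∞ :=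
  (ENNReal.ofReal (Real.sqrt (4 * π * l)))⁻¹ *
    ∫⁻ u : ℝ, ENNReal.ofReal
      (Real.exp (-‖γ u t - x₀‖ ^ 2 / (4 * l)) * ‖deriv (fun v => γ v t) u‖)

/-- The total curvature of the time-`t` curve (as an extended real). -/
def totalCurvE (γ : ℝ → ℝ → R2) (t : ℝ) : ℝ≥0∞ :=
  ∫⁻ u : ℝ, ENNReal.ofReal (|curv γ u t| * ‖deriv (fun v => γ v t) u‖)

/-- The entropy of the flow: the supremum of the Gaussian weighted lengths over all
times `t ∈ I`, centers `x₀ ∈ ℝ²` and scales `l > 0`. -/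
def entropyE (γ : ℝ → ℝ → R2) (I : Set ℝ) : ℝ≥0∞ :=
  ⨆ t ∈ I, ⨆ x₀ : R2, ⨆ l ∈ Ioi (0:ℝ), gaussLenE γ x₀ l t

/-- The Gaussian weighted length of the time-`t` curve of a closed flow
(`1`-periodic parametrization, integral over one period `[0,1)`). -/
def gaussLenClosedE (γ : ℝ → ℝ → R2) (x₀ : R2) (l t : ℝ) : ℝ≥0∞ :=
  (ENNReal.ofReal (Real.sqrt (4 * π * l)))⁻¹ *
    ∫⁻ u in Ico (0:ℝ) 1, ENNReal.ofReal
      (Real.exp (-‖γ u t - x₀‖ ^ 2 / (4 * l)) * ‖deriv (fun v => γ v t) u‖)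

/-- The total curvature of the time-`t` curve of a closed flow (over one period `[0,1)`). -/
def totalCurvClosedE (γ : ℝ → ℝ → R2) (t : ℝ) : ℝ≥0∞ :=
  ∫⁻ u in Ico (0:ℝ) 1, ENNReal.ofReal (|curv γ u t| * ‖deriv (fun v => γ v t) u‖)

/-- The entropy of a closed flow on time interval `I`. -/
def entropyClosedE (γ : ℝ → ℝ → R2) (I : Set ℝ) : ℝ≥0∞ :=
  ⨆ t ∈ I, ⨆ x₀ : R2, ⨆ l ∈ Ioi (0:ℝ), gaussLenClosedE γ x₀ l t

section Part1

/-! Zigzags -/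

/-- The sign `(-1)^i`. -/
def sg (i : ℤ) : ℝ := if Even i then 1 else -1

lemma sg_succ (i : ℤ) : sg (i + 1) = - sg i := by
  unfold sg
  by_cases h : Even i
  · have : ¬ Even (i + 1) := by rw [Int.even_add_one]; simpa using h
    simp [h, this]
  · have : Even (i + 1) := by rw [Int.even_add_one]; exact h
    simp [h, this]

lemma sg_cases (i : ℤ) : sg i = 1 ∨ sg i = -1 := by
  unfold sg; split_ifs <;> simp

lemma sg_sq (i : ℤ) : sg i * sg i = 1 := by
  rcases sg_cases i with h | h <;> rw [h] <;> norm_num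

lemma sg_add_even (i : ℤ) (n : ℕ) (hn : Even n) : sg (i + n) = sg i := by
  unfold sg
  have hn' : Even (n : ℤ) := by exact_mod_cast hn
  have : Even (i + n) ↔ Even i := by
    rw [Int.even_add]; simp [hn']
  simp only [this]

/-- `v` is a zigzag of `f` relative to the levels `c`, with `n` vertices per period. -/
structure Zig (n : ℕ) (f : ℝ → ℝ) (c : ℤ → ℝ) (v : ℤ → ℝ) : Prop where
  mono : ∀ i, v i < v (i + 1)
  per : ∀ i, v (i + n) = v i + 1
  lev : ∀ i, 0 ≤ sg i * (f (v i) - c i)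

/-- Alternating periodic levels. -/
structure Alt (n : ℕ) (c : ℤ → ℝ) : Prop where
  per : ∀ i, c (i + n) = c i
  alt : ∀ i, 0 < sg i * (c i - c (i + 1))

/-- Equivariant choice. -/
lemma equi_choice (n : ℕ) (hn : 0 < n) (P : ℤ → ℝ → Prop)
    (hP : ∀ i, ∃ x, P i x) (hs : ∀ i x, P i x → P (i + n) (x + 1))
    (hs' : ∀ i x, P i x → P (i - n) (x - 1)) :
    ∃ v : ℤ → ℝ, (∀ i, P i (v i)) ∧ ∀ i, v (i + n) = v i + 1 := by
  choose g hg using hP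
  have hk : ∀ (k : ℕ) i x, P i x → P (i + n * k) (x + k) := by
    intro k
    induction k with
    | zero => intro i x h; simpa using h
    | succ k ih =>
      intro i x h
      have := hs _ _ (ih i x h)
      push_cast
      convert this using 1 <;> ring
  have hk' : ∀ (k : ℕ) i x, P i x → P (i - n * k) (x - k) := by
    intro k
    induction k with
    | zero => intro i x h; simpa using h
    | succ k ih =>
      intro i x h
      have := hs' _ _ (ih i x h)
      push_cast
      convert this using 1 <;> ring
  have hz : ∀ (k : ℤ) i x, P i x → P (i + n * k) (x + k) := by
    intro k i x h
    obtain ⟨j, rfl | rfl⟩ := k.eq_nat_or_neg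
    · simpa using hk j i x h
    · have := hk' j i x h
      push_cast
      convert this using 1 <;> ring
  refine ⟨fun i => g (i % n) + ((i / n : ℤ) : ℝ), ?_, ?_⟩
  · intro i
    have := hz (i / n) (i % n) _ (hg _)
    rwa [Int.emod_add_mul_ediv] at this
  · intro i
    have hn0 : (n : ℤ) ≠ 0 := by exact_mod_cast hn.ne'
    have hd : (i + (n : ℤ)) / n = i / n + 1 := by
      rw [Int.add_ediv_of_dvd_right (dvd_refl _), Int.ediv_self hn0]
    simp only [Int.add_emod_right, hd]
    push_cast; ring

lemma per_sub {f : ℝ → ℝ} (hf : ∀ u, f (u + 1) = f u) (u : ℝ) : f (u - 1) = f u := by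
  have := hf (u - 1); rw [sub_add_cancel] at this; exact this.symm

lemma perv_sub {n : ℕ} {v : ℤ → ℝ} (hv : ∀ i, v (i + n) = v i + 1) (i : ℤ) :
    v (i - n) = v i - 1 := by
  have := hv (i - n); rw [sub_add_cancel] at this; linarith

lemma perc_sub {n : ℕ} {c : ℤ → ℝ} (hv : ∀ i, c (i + n) = c i) (i : ℤ) :
    c (i - n) = c i := by
  have := hv (i - n); rw [sub_add_cancel] at this; linarith

lemma sg_sub_even (i : ℤ) (n : ℕ) (hn : Even n) : sg (i - n) = sg i := by
  have := sg_add_even (i - n) n hn; rw [sub_add_cancel] at this; exact this.symm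

/-- Separators between consecutive vertices. -/
lemma Zig.sep {n : ℕ} (hn : 0 < n) (_he : Even n) {f : ℝ → ℝ} (hf : Continuous f)
    (hper : ∀ u, f (u + 1) = f u) {c v : ℤ → ℝ} (hz : Zig n f c v) (hc : Alt n c) :
    ∃ z : ℤ → ℝ, (∀ i, (v i < z i ∧ z i < v (i + 1)) ∧ f (z i) = (c i + c (i + 1)) / 2) ∧
      ∀ i, z (i + n) = z i + 1 := by
  apply equi_choice n hn
    (fun i z => (v i < z ∧ z < v (i + 1)) ∧ f z = (c i + c (i + 1)) / 2)
  · intro i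
    have h1 := hz.lev i
    have h2 := hz.lev (i + 1)
    have h3 := hc.alt i
    rw [sg_succ] at h2
    have hco : ContinuousOn f (Icc (v i) (v (i + 1))) := hf.continuousOn
    rcases sg_cases i with h | h
    · rw [h] at h1 h2 h3
      have := intermediate_value_Ioo' (hz.mono i).le hco
      obtain ⟨z, hz1, hz2⟩ := this (show (c i + c (i + 1)) / 2 ∈ _ from ⟨by linarith, by linarith⟩)
      exact ⟨z, hz1, hz2⟩
    · rw [h] at h1 h2 h3
      have := intermediate_value_Ioo (hz.mono i).le hco
      obtain ⟨z, hz1, hz2⟩ := this (show (c i + c (i + 1)) / 2 ∈ _ from ⟨by linarith, by linarith⟩)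
      exact ⟨z, hz1, hz2⟩
  · rintro i x ⟨⟨h1, h2⟩, h3⟩
    have e : i + (n : ℤ) + 1 = (i + 1) + n := by ring
    rw [e, hz.per, hz.per, hc.per, hc.per, hper]
    exact ⟨⟨by linarith, by linarith⟩, h3⟩
  · rintro i x ⟨⟨h1, h2⟩, h3⟩
    have e : i - (n : ℤ) + 1 = (i + 1) - n := by ring
    rw [e, perv_sub hz.per, perv_sub hz.per, perc_sub hc.per, perc_sub hc.per, per_sub hper]
    exact ⟨⟨by linarith, by linarith⟩, h3⟩

/-- Critical points of a zigzag. -/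
lemma Zig.crit {n : ℕ} (hn : 0 < n) (he : Even n) {f : ℝ → ℝ} (hf : Continuous f)
    (hper : ∀ u, f (u + 1) = f u) {c v : ℤ → ℝ} (hz : Zig n f c v) (hc : Alt n c) :
    ∃ p : ℤ → ℝ, Zig n f c p ∧ ∀ i, deriv f (p i) = 0 := by
  obtain ⟨z, hz1, hz2⟩ := hz.sep hn he hf hper hc
  have key : ∃ p : ℤ → ℝ, (∀ i, (z (i - 1) < p i ∧ p i < z i) ∧ 0 ≤ sg i * (f (p i) - c i) ∧
      deriv f (p i) = 0) ∧ ∀ i, p (i + n) = p i + 1 := by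
    apply equi_choice n hn
      (fun i p => (z (i - 1) < p ∧ p < z i) ∧ 0 ≤ sg i * (f p - c i) ∧ deriv f p = 0)
    · intro i
      have a1 := hz1 (i - 1)
      have a2 := hz1 i
      rw [sub_add_cancel] at a1
      have hlt : z (i - 1) < z i := a1.1.2.trans a2.1.1
      have hco : ContinuousOn (fun u => sg i * f u) (Icc (z (i - 1)) (z i)) := by fun_prop
      obtain ⟨p, hp, hmax⟩ := isCompact_Icc.exists_isMaxOn ⟨z i, right_mem_Icc.2 hlt.le⟩ hco
      have hm : ∀ u ∈ Icc (z (i - 1)) (z i), sg i * f u ≤ sg i * f p := fun u hu => hmax hu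
      have b1 := hm (v i) ⟨a1.1.2.le, a2.1.1.le⟩
      have b2 := hz.lev i
      have b3 := hc.alt i
      have b4 := hc.alt (i - 1)
      have b5 := sg_succ (i - 1)
      rw [sub_add_cancel] at b4 b5
      have b6 : sg (i - 1) = - sg i := by linarith
      rw [b6] at b4
      have e1 : sg i * f (z i) = (sg i * c i + sg i * c (i + 1)) / 2 := by rw [a2.2]; ring
      have e2 : sg i * f (z (i - 1)) = (sg i * c (i - 1) + sg i * c i) / 2 := by rw [a1.2]; ring
      have ne1 : p ≠ z i := by
        rintro rfl; nlinarith
      have ne2 : p ≠ z (i - 1) := by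
        rintro rfl; nlinarith
      have hp1 : z (i - 1) < p := lt_of_le_of_ne hp.1 (Ne.symm ne2)
      have hp2 : p < z i := lt_of_le_of_ne hp.2 ne1
      refine ⟨p, ⟨hp1, hp2⟩, by nlinarith, ?_⟩
      have hloc : IsLocalMax (fun u => sg i * f u) p := hmax.isLocalMax (Icc_mem_nhds hp1 hp2)
      have hd := hloc.deriv_eq_zero
      rw [deriv_const_mul_field] at hd
      rcases sg_cases i with h | h <;> rw [h] at hd <;> simpa using hd
    · rintro i x ⟨⟨h1, h2⟩, h3, h4⟩
      have e : i + (n : ℤ) - 1 = (i - 1) + n := by ring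
      have hd : deriv f (x + 1) = deriv f x := by
        rw [← deriv_comp_add_const]; congr 1; funext u; exact hper u
      rw [e, hz2, hz2, hc.per, hper, sg_add_even _ _ he, hd]
      exact ⟨⟨by linarith, by linarith⟩, h3, h4⟩
    · rintro i x ⟨⟨h1, h2⟩, h3, h4⟩
      have e : i - (n : ℤ) - 1 = (i - 1) - n := by ring
      have hd : deriv f (x - 1) = deriv f x := by
        rw [← deriv_comp_sub_const]; congr 1; funext u; exact per_sub hper u
      rw [e, perv_sub hz2, perv_sub hz2, perc_sub hc.per, per_sub hper, sg_sub_even _ _ he, hd]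
      exact ⟨⟨by linarith, by linarith⟩, h3, h4⟩
  obtain ⟨p, hp1, hp2⟩ := key
  refine ⟨p, ⟨fun i => ?_, hp2, fun i => (hp1 i).2.1⟩, fun i => (hp1 i).2.2⟩
  have := (hp1 (i + 1)).1.1
  rw [add_sub_cancel_right] at this
  exact (hp1 i).1.2.trans this

/-- From alternating signs of the derivative to a zigzag. -/
lemma zig_of_deriv {n : ℕ} (hn : 0 < n) (he : Even n) {f : ℝ → ℝ} (hf : Differentiable ℝ f)
    (hper : ∀ u, f (u + 1) = f u) {p : ℤ → ℝ} (hp : ∀ i, p i < p (i + 1))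
    (hpp : ∀ i, p (i + n) = p i + 1) (hs : ∀ i, 0 < sg i * deriv f (p i)) :
    ∃ q : ℤ → ℝ, Zig n f (fun i => f (q i)) q ∧ Alt n (fun i => f (q i)) := by
  have key : ∃ q : ℤ → ℝ, (∀ i, (p i ≤ q i ∧ q i < p (i + 1)) ∧
      (∀ u ∈ Icc (p i) (p (i + 1)), sg i * f u ≤ sg i * f (q i)) ∧
      sg i * f (p (i + 1)) < sg i * f (q i)) ∧ ∀ i, q (i + n) = q i + 1 := by
    apply equi_choice n hn
      (fun i q => (p i ≤ q ∧ q < p (i + 1)) ∧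
      (∀ u ∈ Icc (p i) (p (i + 1)), sg i * f u ≤ sg i * f q) ∧
      sg i * f (p (i + 1)) < sg i * f q)
    · intro i
      have hco : ContinuousOn (fun u => sg i * f u) (Icc (p i) (p (i + 1))) :=
        (continuous_const.mul hf.continuous).continuousOn
      obtain ⟨q, hq, hmax⟩ := isCompact_Icc.exists_isMaxOn ⟨p i, left_mem_Icc.2 (hp i).le⟩ hco
      have hm : ∀ u ∈ Icc (p i) (p (i + 1)), sg i * f u ≤ sg i * f q := fun u hu => hmax hu
      have hstrict : ∃ u ∈ Icc (p i) (p (i + 1)), sg i * f (p (i + 1)) < sg i * f u := by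
        by_contra hcon
        push Not at hcon
        have hd : HasDerivAt (fun u => sg i * f u) (sg i * deriv f (p (i + 1))) (p (i + 1)) :=
          (hf _).hasDerivAt.const_mul _
        have h1 := hs (i + 1)
        rw [sg_succ] at h1
        have hneg : sg i * deriv f (p (i + 1)) < 0 := by linarith
        have hge : 0 ≤ sg i * deriv f (p (i + 1)) := by
          have hw := hd.hasDerivWithinAt (s := Iio (p (i + 1)))
          have ht := (hasDerivWithinAt_iff_tendsto_slope' (by simp)).1 hw
          have hev : ∀ᶠ u in nhdsWithin (p (i + 1)) (Iio (p (i + 1))),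
              0 ≤ slope (fun u => sg i * f u) (p (i + 1)) u := by
            filter_upwards [Ioo_mem_nhdsLT (hp i)] with u hu
            rw [slope_def_field]
            have := hcon u ⟨hu.1.le, hu.2.le⟩
            exact div_nonneg_of_nonpos (by linarith) (by linarith [hu.2])
          exact ge_of_tendsto ht hev
        linarith
      obtain ⟨u0, hu0, hu0'⟩ := hstrict
      have hlt : sg i * f (p (i + 1)) < sg i * f q := lt_of_lt_of_le hu0' (hm u0 hu0)
      refine ⟨q, ⟨hq.1, lt_of_le_of_ne hq.2 ?_⟩, hm, hlt⟩
      rintro rfl; exact lt_irrefl _ hlt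
    · rintro i x ⟨⟨h1, h2⟩, h3, h4⟩
      have e : i + (n : ℤ) + 1 = (i + 1) + n := by ring
      rw [e, hpp, hpp, hper, hper, sg_add_even _ _ he]
      refine ⟨⟨by linarith, by linarith⟩, ?_, h4⟩
      intro u hu
      have := h3 (u - 1) ⟨by linarith [hu.1], by linarith [hu.2]⟩
      rwa [per_sub hper] at this
    · rintro i x ⟨⟨h1, h2⟩, h3, h4⟩
      have e : i - (n : ℤ) + 1 = (i + 1) - n := by ring
      rw [e, perv_sub hpp, perv_sub hpp, per_sub hper, per_sub hper, sg_sub_even _ _ he]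
      refine ⟨⟨by linarith, by linarith⟩, ?_, h4⟩
      intro u hu
      have := h3 (u + 1) ⟨by linarith [hu.1], by linarith [hu.2]⟩
      rwa [hper] at this
  obtain ⟨q, hq1, hq2⟩ := key
  refine ⟨q, ⟨fun i => (hq1 i).1.2.trans_le (hq1 (i + 1)).1.1, hq2, fun i => by simp⟩,
    fun i => by simp only [hq2, hper], fun i => ?_⟩
  have h1 := (hq1 i).2.2
  have h2 := (hq1 (i + 1)).2.1 (p (i + 1)) ⟨le_rfl, (hp (i + 1)).le⟩
  rw [sg_succ] at h2
  nlinarith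

end Part1

section Part2

/-! Maximum principle and transport of zigzags -/

/-- Abstract parabolic property. -/
def Cal (f : ℝ → ℝ → ℝ) : Prop :=
  ∀ u t, t < 0 → ∃ d, HasDerivAt (fun s => f u s) d t ∧
    (IsLocalMax (fun v => f v t) u → d ≤ 0) ∧ (IsLocalMin (fun v => f v t) u → 0 ≤ d)

lemma Cal.neg {f : ℝ → ℝ → ℝ} (h : Cal f) : Cal (fun u t => - f u t) := by
  intro u t ht
  obtain ⟨d, h1, h2, h3⟩ := h u t ht
  refine ⟨-d, h1.neg, fun hm => ?_, fun hm => ?_⟩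
  · have := h3 (by simpa using hm.neg); linarith
  · have := h2 (by simpa using hm.neg); linarith

lemma Cal.sgmul {f : ℝ → ℝ → ℝ} (h : Cal f) (i : ℤ) : Cal (fun u t => sg i * f u t) := by
  rcases sg_cases i with e | e
  · simpa [e] using h
  · simpa [e] using h.neg

lemma max_principle_aux {f : ℝ → ℝ → ℝ} (hf : Cal f)
    (hc : ContinuousOn (fun p : ℝ × ℝ => f p.1 p.2) (univ ×ˢ Iic 0))
    {z1 z2 t1 t2 c : ℝ} (ht : t1 < t2) (ht0 : t2 < 0)
    (hl : ∀ t ∈ Icc t1 t2, f z1 t ≤ c) (hr : ∀ t ∈ Icc t1 t2, f z2 t ≤ c)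
    (hb : ∀ u ∈ Icc z1 z2, f u t1 ≤ c) : ∀ u ∈ Icc z1 z2, f u t2 ≤ c := by
  intro u hu
  by_contra hcon
  push Not at hcon
  set ε := (f u t2 - c) / (2 * (t2 - t1)) with hε
  have hpos : 0 < t2 - t1 := by linarith
  have hεpos : 0 < ε := by apply div_pos <;> linarith
  have hε2 : ε * (t2 - t1) = (f u t2 - c) / 2 := by rw [hε]; field_simp
  have hcont : ContinuousOn (fun p : ℝ × ℝ => f p.1 p.2 - ε * (p.2 - t1))
      (Icc z1 z2 ×ˢ Icc t1 t2) := by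
    apply ContinuousOn.sub
    · apply hc.mono
      intro p hp
      exact ⟨mem_univ _, by have := hp.2.2; simp only [mem_Iic]; linarith⟩
    · fun_prop
  obtain ⟨⟨u0, t0⟩, h0, hmax⟩ := (isCompact_Icc.prod isCompact_Icc).exists_isMaxOn
    ⟨(u, t2), ⟨hu, right_mem_Icc.2 ht.le⟩⟩ hcont
  have hm : ∀ u' ∈ Icc z1 z2, ∀ t' ∈ Icc t1 t2,
      f u' t' - ε * (t' - t1) ≤ f u0 t0 - ε * (t0 - t1) :=
    fun u' hu' t' ht' => hmax (show (u', t') ∈ Icc z1 z2 ×ˢ Icc t1 t2 from ⟨hu', ht'⟩)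
  have hu0 : u0 ∈ Icc z1 z2 := h0.1
  have ht0' : t0 ∈ Icc t1 t2 := h0.2
  have hv := hm u hu t2 (right_mem_Icc.2 ht.le)
  have hnn : 0 ≤ ε * (t0 - t1) := mul_nonneg hεpos.le (by linarith [ht0'.1])
  have hbig : c < f u0 t0 := by linarith
  have n1 : u0 ≠ z1 := by rintro rfl; linarith [hl t0 ht0']
  have n2 : u0 ≠ z2 := by rintro rfl; linarith [hr t0 ht0']
  have n3 : t0 ≠ t1 := by rintro rfl; linarith [hb u0 hu0]
  have hu1 : z1 < u0 := lt_of_le_of_ne hu0.1 (Ne.symm n1)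
  have hu2 : u0 < z2 := lt_of_le_of_ne hu0.2 n2
  have ht1 : t1 < t0 := lt_of_le_of_ne ht0'.1 (Ne.symm n3)
  obtain ⟨d, hd, hd1, -⟩ := hf u0 t0 (lt_of_le_of_lt ht0'.2 ht0)
  have hloc : IsLocalMax (fun v => f v t0) u0 := by
    filter_upwards [Icc_mem_nhds hu1 hu2] with v hv
    have := hm v hv t0 ht0'
    linarith
  have hd0 := hd1 hloc
  have hw := hd.hasDerivWithinAt (s := Iio t0)
  have htd := (hasDerivWithinAt_iff_tendsto_slope' (by simp)).1 hw
  have hev : ∀ᶠ t in nhdsWithin t0 (Iio t0), ε ≤ slope (fun s => f u0 s) t0 t := by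
    filter_upwards [Ioo_mem_nhdsLT ht1] with t htt
    rw [slope_def_field, le_div_iff_of_neg (by linarith [htt.2])]
    have := hm u0 hu0 t ⟨htt.1.le, by linarith [htt.2, ht0'.2]⟩
    linarith
  have := ge_of_tendsto htd hev
  linarith

lemma max_principle {f : ℝ → ℝ → ℝ} (hf : Cal f)
    (hc : ContinuousOn (fun p : ℝ × ℝ => f p.1 p.2) (univ ×ˢ Iic 0))
    {z1 z2 t1 t2 c : ℝ} (ht : t1 < t2) (ht0 : t2 ≤ 0)
    (hl : ∀ t ∈ Icc t1 t2, f z1 t ≤ c) (hr : ∀ t ∈ Icc t1 t2, f z2 t ≤ c)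
    (hb : ∀ u ∈ Icc z1 z2, f u t1 ≤ c) : ∀ u ∈ Icc z1 z2, f u t2 ≤ c := by
  intro u hu
  have hcu : ContinuousWithinAt (fun t => f u t) (Iio t2) t2 := by
    have h1 : ContinuousWithinAt (fun p : ℝ × ℝ => f p.1 p.2) (univ ×ˢ Iic 0) (u, t2) :=
      hc _ ⟨mem_univ _, ht0⟩
    exact h1.comp (f := fun t => (u, t)) (t := univ ×ˢ Iic 0)
      (by fun_prop) (fun t h => ⟨mem_univ _, by
        have : t < t2 := h
        simp only [mem_Iic]; linarith⟩)
  refine le_of_tendsto hcu ?_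
  filter_upwards [Ioo_mem_nhdsLT ht] with t htt
  exact max_principle_aux hf hc htt.1 (lt_of_lt_of_le htt.2 ht0)
    (fun s hs => hl s ⟨hs.1, by linarith [hs.2, htt.2]⟩)
    (fun s hs => hr s ⟨hs.1, by linarith [hs.2, htt.2]⟩) hb u hu

/-- The minimal gap of alternating levels. -/
lemma Alt.gap {n : ℕ} (hn : 0 < n) (he : Even n) {c : ℤ → ℝ} (hc : Alt n c) :
    ∃ g > 0, ∀ i, g ≤ sg i * (c i - c (i + 1)) := by
  have hne : (Finset.range n).Nonempty := ⟨0, Finset.mem_range.2 hn⟩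
  obtain ⟨k, -, hk⟩ := (Finset.range n).exists_min_image
    (fun k : ℕ => sg k * (c k - c ((k : ℤ) + 1))) hne
  refine ⟨_, hc.alt k, fun i => ?_⟩
  have hq : ∀ i, sg (i + n) * (c (i + n) - c (i + n + 1)) = sg i * (c i - c (i + 1)) := by
    intro i
    have e : i + (n : ℤ) + 1 = (i + 1) + n := by ring
    rw [e, hc.per, hc.per, sg_add_even _ _ he]
  have hper : Function.Periodic (fun i : ℤ => sg i * (c i - c (i + 1))) (n : ℤ) := hq
  have hnz : (0 : ℤ) < n := by exact_mod_cast hn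
  have h1 : sg (i % n) * (c (i % n) - c (i % n + 1)) = sg i * (c i - c (i + 1)) := by
    have := hper.sub_zsmul_eq (x := i) (i / n)
    simp only [smul_eq_mul] at this
    have e : i - i / n * n = i % n := by
      have := Int.emod_add_mul_ediv i n; linarith
    rw [e] at this
    exact this
  rw [← h1]
  have h2 := Int.emod_nonneg i hnz.ne'
  have h3 := Int.emod_lt_of_pos i hnz
  have := hk (i % n).toNat (Finset.mem_range.2 (by omega))
  rwa [Int.toNat_of_nonneg h2] at this

lemma transport {n : ℕ} (hn : 0 < n) (he : Even n) {f : ℝ → ℝ → ℝ} (hf : Cal f)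
    (hc : ContinuousOn (fun p : ℝ × ℝ => f p.1 p.2) (univ ×ˢ Iic 0))
    (hper : ∀ t ≤ 0, ∀ u, f (u + 1) t = f u t) {c v : ℤ → ℝ} (hA : Alt n c) {s t : ℝ}
    (hst : s < t) (ht : t ≤ 0) (hz : Zig n (fun u => f u t) c v) :
    ∃ v', Zig n (fun u => f u s) c v' := by
  obtain ⟨g, hg, hgap⟩ := hA.gap hn he
  have hslice : ∀ τ ≤ 0, Continuous (fun u => f u τ) := by
    intro τ hτ
    rw [← continuousOn_univ]
    exact hc.comp (f := fun u => (u, τ)) (by fun_prop) (fun u _ => ⟨mem_univ _, hτ⟩)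
  have huc : UniformContinuousOn (fun p : ℝ × ℝ => f p.1 p.2) (Icc 0 1 ×ˢ Icc s t) := by
    apply (isCompact_Icc.prod isCompact_Icc).uniformContinuousOn_of_continuous
    apply hc.mono
    intro p hp
    exact ⟨mem_univ _, by have := hp.2.2; simp only [mem_Iic]; linarith⟩
  rw [Metric.uniformContinuousOn_iff] at huc
  obtain ⟨δ, hδ, hδ'⟩ := huc (g / 4) (by linarith)
  have hosc : ∀ u, ∀ τ ∈ Icc s t, ∀ τ' ∈ Icc s t, |τ - τ'| < δ → |f u τ - f u τ'| < g / 4 := by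
    intro u τ hτ τ' hτ' hd
    have h1 : ∀ σ ≤ 0, f (Int.fract u) σ = f u σ := by
      intro σ hσ
      have : Function.Periodic (fun u => f u σ) 1 := hper σ hσ
      have := this.sub_zsmul_eq (x := u) ⌊u⌋
      simp only [smul_eq_mul, mul_one, zsmul_eq_mul] at this
      exact this
    rw [← h1 τ (by linarith [hτ.2]), ← h1 τ' (by linarith [hτ'.2])]
    have hm : Int.fract u ∈ Icc (0 : ℝ) 1 := ⟨Int.fract_nonneg u, (Int.fract_lt_one u).le⟩
    have := hδ' (Int.fract u, τ) ⟨hm, hτ⟩ (Int.fract u, τ') ⟨hm, hτ'⟩ (by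
      rw [Prod.dist_eq]; simp [Real.dist_eq, hd, hδ])
    rwa [Real.dist_eq] at this
  -- one step
  have step : ∀ τ ∈ Icc s t, ∀ τ' ∈ Icc s t, τ' < τ → τ - τ' < δ →
      (∃ v, Zig n (fun u => f u τ) c v) → ∃ v', Zig n (fun u => f u τ') c v' := by
    rintro τ hτ τ' hτ' hlt hd ⟨v, hz⟩
    have hτ0 : τ ≤ 0 := by linarith [hτ.2]
    have hτ0' : τ' ≤ 0 := by linarith [hτ'.2]
    obtain ⟨z, hz1, hz2⟩ := hz.sep hn he (hslice τ hτ0) (hper τ hτ0) hA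
    have hside : ∀ i, ∀ σ ∈ Icc τ' τ, sg i * f (z i) σ ≤ sg i * c i - g / 4 ∧
        sg i * c (i + 1) + g / 4 ≤ sg i * f (z i) σ := by
      intro i σ hσ
      have h1 := hosc (z i) σ ⟨by linarith [hσ.1, hτ'.1], by linarith [hσ.2, hτ.2]⟩ τ hτ (by
        rw [abs_lt]; constructor <;> linarith [hσ.1, hσ.2])
      rw [(hz1 i).2, abs_lt] at h1
      have h2 := hgap i
      rcases sg_cases i with e | e <;> rw [e] at h2 ⊢ <;> constructor <;> linarith [h1.1, h1.2]
    have key : ∃ p : ℤ → ℝ, (∀ i, (z (i - 1) < p i ∧ p i < z i) ∧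
        0 ≤ sg i * (f (p i) τ' - c i)) ∧ ∀ i, p (i + n) = p i + 1 := by
      apply equi_choice n hn
        (fun i p => (z (i - 1) < p ∧ p < z i) ∧ 0 ≤ sg i * (f p τ' - c i))
      · intro i
        have a1 := hz1 (i - 1)
        have a2 := hz1 i
        rw [sub_add_cancel] at a1
        have hzz : z (i - 1) < z i := a1.1.2.trans a2.1.1
        have hs1 : ∀ σ ∈ Icc τ' τ, sg i * f (z (i - 1)) σ ≤ sg i * c i - g / 4 := by
          intro σ hσ
          have := (hside (i - 1) σ hσ).2
          have b5 := sg_succ (i - 1)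
          rw [sub_add_cancel] at b5 this
          have b6 : sg (i - 1) = - sg i := by linarith
          rw [b6] at this
          linarith
        have hs2 : ∀ σ ∈ Icc τ' τ, sg i * f (z i) σ ≤ sg i * c i - g / 4 :=
          fun σ hσ => (hside i σ hσ).1
        have hco : ContinuousOn (fun u => sg i * f u τ') (Icc (z (i - 1)) (z i)) :=
          (continuous_const.mul (hslice τ' hτ0')).continuousOn
        obtain ⟨p, hp, hmax⟩ := isCompact_Icc.exists_isMaxOn ⟨z i, right_mem_Icc.2 hzz.le⟩ hco
        have hm : ∀ u ∈ Icc (z (i - 1)) (z i), sg i * f u τ' ≤ sg i * f p τ' :=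
          fun u hu => hmax hu
        have hge : sg i * c i ≤ sg i * f p τ' := by
          by_contra hcon
          push Not at hcon
          have hcont : ContinuousOn (fun p : ℝ × ℝ => sg i * f p.1 p.2) (univ ×ˢ Iic 0) :=
            continuousOn_const.mul hc
          have := max_principle (hf.sgmul i) hcont (c := max (sg i * f p τ') (sg i * c i - g / 4))
            hlt hτ0 (fun σ hσ => (hs1 σ hσ).trans (le_max_right _ _))
            (fun σ hσ => (hs2 σ hσ).trans (le_max_right _ _))
            (fun u hu => (hm u hu).trans (le_max_left _ _)) (v i) ⟨a1.1.2.le, a2.1.1.le⟩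
          have h3 := hz.lev i
          rcases le_max_iff.1 this with h | h <;> nlinarith
        have e1 := hs1 τ' (left_mem_Icc.2 hlt.le)
        have e2 := hs2 τ' (left_mem_Icc.2 hlt.le)
        have ne1 : p ≠ z i := by rintro rfl; linarith
        have ne2 : p ≠ z (i - 1) := by rintro rfl; linarith
        exact ⟨p, ⟨lt_of_le_of_ne hp.1 (Ne.symm ne2), lt_of_le_of_ne hp.2 ne1⟩, by linarith⟩
      · rintro i x ⟨⟨h1, h2⟩, h3⟩
        have e : i + (n : ℤ) - 1 = (i - 1) + n := by ring
        rw [e, hz2, hz2, hA.per, hper τ' hτ0', sg_add_even _ _ he]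
        exact ⟨⟨by linarith, by linarith⟩, h3⟩
      · rintro i x ⟨⟨h1, h2⟩, h3⟩
        have e : i - (n : ℤ) - 1 = (i - 1) - n := by ring
        rw [e, perv_sub hz2, perv_sub hz2, perc_sub hA.per, per_sub (f := fun u => f u τ') (hper τ' hτ0'),
          sg_sub_even _ _ he]
        exact ⟨⟨by linarith, by linarith⟩, h3⟩
    obtain ⟨p, hp1, hp2⟩ := key
    refine ⟨p, ⟨fun i => ?_, hp2, fun i => (hp1 i).2⟩⟩
    have := (hp1 (i + 1)).1.1
    rw [add_sub_cancel_right] at this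
    exact (hp1 i).1.2.trans this
  have ind : ∀ k : ℕ, ∀ τ ∈ Icc s t, t - τ ≤ k * (δ / 2) → ∃ v, Zig n (fun u => f u τ) c v := by
    intro k
    induction k with
    | zero =>
      intro τ hτ h
      have : τ = t := by
        have := hτ.2; simp at h; linarith
      subst this; exact ⟨v, hz⟩
    | succ k ih =>
      intro τ hτ h
      push_cast at h
      by_cases hh : t - τ ≤ δ / 2
      · rcases eq_or_lt_of_le hτ.2 with e | e
        · subst e; exact ⟨v, hz⟩
        · exact step t (right_mem_Icc.2 hst.le) τ hτ e (by linarith) ⟨v, hz⟩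
      · push Not at hh
        have hm : τ + δ / 2 ∈ Icc s t := ⟨by linarith [hτ.1], by linarith⟩
        exact step _ hm τ hτ (by linarith) (by linarith) (ih _ hm (by linarith))
  obtain ⟨k, hk⟩ := exists_nat_gt ((t - s) / (δ / 2))
  rw [div_lt_iff₀ (by linarith)] at hk
  exact ind k s (left_mem_Icc.2 hst.le) hk.le

end Part2

section Part3

/-! Angle lifts and crossings -/

lemma angle_lift {X Y X1 Y1 : ℝ → ℝ} (hX : ∀ u, HasDerivAt X (X1 u) u)
    (hY : ∀ u, HasDerivAt Y (Y1 u) u) (cX : Continuous X1) (cY : Continuous Y1)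
    (hpos : ∀ u, 0 < X u ^ 2 + Y u ^ 2) :
    ∃ α : ℝ → ℝ, (∀ u, HasDerivAt α ((X u * Y1 u - Y u * X1 u) / (X u ^ 2 + Y u ^ 2)) u) ∧
      (∀ u, X u = √(X u ^ 2 + Y u ^ 2) * cos (α u)) ∧
      (∀ u, Y u = √(X u ^ 2 + Y u ^ 2) * sin (α u)) := by
  have cX0 : Continuous X := continuous_iff_continuousAt.2 fun u => (hX u).continuousAt
  have cY0 : Continuous Y := continuous_iff_continuousAt.2 fun u => (hY u).continuousAt
  set h : ℝ → ℝ := fun u => (X u * Y1 u - Y u * X1 u) / (X u ^ 2 + Y u ^ 2) with hh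
  have ch : Continuous h := by
    apply Continuous.div (by fun_prop) (by fun_prop)
    intro u; exact (hpos u).ne'
  set z : ℂ := ⟨X 0, Y 0⟩ with hz
  have hzn : ‖z‖ = √(X 0 ^ 2 + Y 0 ^ 2) := by
    rw [Complex.norm_def, Complex.normSq_apply]; simp [hz, sq]
  have hz1 : X 0 = √(X 0 ^ 2 + Y 0 ^ 2) * cos z.arg := by
    rw [← hzn, Complex.norm_mul_cos_arg]
  have hz2 : Y 0 = √(X 0 ^ 2 + Y 0 ^ 2) * sin z.arg := by
    rw [← hzn, Complex.norm_mul_sin_arg]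
  set α : ℝ → ℝ := fun u => z.arg + ∫ x in (0:ℝ)..u, h x with hα
  have dα : ∀ u, HasDerivAt α (h u) u := by
    intro u
    have := intervalIntegral.integral_hasDerivAt_right (ch.intervalIntegrable 0 u)
      (ch.stronglyMeasurableAtFilter _ _) ch.continuousAt
    exact this.const_add _
  have cα : Continuous α := continuous_iff_continuousAt.2 fun u => (dα u).continuousAt
  have α0 : α 0 = z.arg := by simp [hα]
  set A : ℝ → ℝ := fun u => X u * cos (α u) + Y u * sin (α u) with hA
  set B : ℝ → ℝ := fun u => -X u * sin (α u) + Y u * cos (α u) with hB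
  have hAB : ∀ u, A u ^ 2 + B u ^ 2 = X u ^ 2 + Y u ^ 2 := by
    intro u
    have := sin_sq_add_cos_sq (α u)
    simp only [hA, hB]
    linear_combination (X u ^ 2 + Y u ^ 2) * this
  have dB : ∀ u, HasDerivAt (fun u => B u ^ 2 / (X u ^ 2 + Y u ^ 2)) 0 u := by
    intro u
    have h1 : HasDerivAt B ((X u * X1 u + Y u * Y1 u) / (X u ^ 2 + Y u ^ 2) * B u) u := by
      have := ((hX u).neg.mul (dα u).sin).add ((hY u).mul (dα u).cos)
      refine this.congr_deriv ?_
      have hp := (hpos u).ne'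
      simp only [hB, hh, Pi.neg_apply]
      field_simp
      ring
    have h2 : HasDerivAt (fun u => X u ^ 2 + Y u ^ 2) (2 * (X u * X1 u + Y u * Y1 u)) u := by
      refine (((hX u).pow 2).add ((hY u).pow 2)).congr_deriv ?_
      push_cast; ring
    refine ((h1.pow 2).div h2 (hpos u).ne').congr_deriv ?_
    have hp := (hpos u).ne'
    simp only [Pi.pow_apply]
    field_simp
    push_cast
    ring
  have B0 : B 0 = 0 := by
    simp only [hB]
    rw [α0]
    linear_combination -sin z.arg * hz1 + cos z.arg * hz2
  have Bz : ∀ u, B u = 0 := by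
    intro u
    have := is_const_of_deriv_eq_zero (f := fun u => B u ^ 2 / (X u ^ 2 + Y u ^ 2))
      (fun u => (dB u).differentiableAt) (fun u => (dB u).deriv) u 0
    simp only [B0] at this
    have hp := (hpos u).ne'
    rw [div_eq_iff hp] at this
    simp at this
    exact this
  have A0 : 0 < A 0 := by
    have h1 : A 0 = √(X 0 ^ 2 + Y 0 ^ 2) := by
      simp only [hA]
      rw [α0]
      linear_combination cos z.arg * hz1 + sin z.arg * hz2 + √(X 0 ^ 2 + Y 0 ^ 2) * sin_sq_add_cos_sq z.arg
    rw [h1]; exact Real.sqrt_pos.2 (hpos 0)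
  have Ane : ∀ u, A u ≠ 0 := by
    intro u hu
    have := hAB u
    rw [hu, Bz u] at this
    have := hpos u
    nlinarith
  have cA : Continuous A := by fun_prop
  have Apos : ∀ u, 0 < A u := by
    intro u
    by_contra hu
    push Not at hu
    obtain ⟨w, hw⟩ := mem_range_of_exists_le_of_exists_ge cA ⟨u, hu⟩ ⟨0, A0.le⟩
    exact Ane w hw
  have Asq : ∀ u, A u = √(X u ^ 2 + Y u ^ 2) := by
    intro u
    rw [← hAB u, Bz u]
    simp [Real.sqrt_sq (Apos u).le]
  refine ⟨α, dα, fun u => ?_, fun u => ?_⟩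
  · rw [← Asq u]
    have h1 := Bz u
    have := sin_sq_add_cos_sq (α u)
    simp only [hA, hB] at *
    linear_combination -X u * this - sin (α u) * h1
  · rw [← Asq u]
    have h1 := Bz u
    have := sin_sq_add_cos_sq (α u)
    simp only [hA, hB] at *
    linear_combination -Y u * this + cos (α u) * h1

lemma chain_extract (s : ℕ → ℝ) (hs : ∀ i, s i ≠ 0) (N : ℕ) :
    ∃ j : ℕ → ℕ, (∀ i < ((Finset.range N).filter fun i => s i * s (i + 1) < 0).card,
        j i < j (i + 1) ∧ s (j i) * s (j (i + 1)) < 0) ∧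
      j ((Finset.range N).filter fun i => s i * s (i + 1) < 0).card ≤ N ∧
      0 < s (j ((Finset.range N).filter fun i => s i * s (i + 1) < 0).card) * s N := by
  induction N with
  | zero =>
    refine ⟨fun _ => 0, ?_, ?_, ?_⟩
    · simp
    · simp
    · simpa using mul_self_pos.2 (hs 0)
  | succ N ih =>
    obtain ⟨j, h1, h2, h3⟩ := ih
    rw [Finset.range_add_one, Finset.filter_insert]
    set k := ((Finset.range N).filter fun i => s i * s (i + 1) < 0).card
    split_ifs with hc
    · rw [Finset.card_insert_of_notMem (by simp)]
      change ∃ j : ℕ → ℕ, (∀ i < k + 1, j i < j (i + 1) ∧ s (j i) * s (j (i + 1)) < 0) ∧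
        j (k + 1) ≤ N + 1 ∧ 0 < s (j (k + 1)) * s (N + 1)
      refine ⟨fun i => if i ≤ k then j i else N + 1, ?_, ?_, ?_⟩
      · intro i hi
        rcases Nat.lt_succ_iff_lt_or_eq.1 hi with h | h
        · simp only [h.le, if_true, Nat.succ_le_of_lt h]
          exact h1 i h
        · subst h
          simp only [le_refl, if_true, Nat.not_succ_le_self, if_false]
          refine ⟨by omega, ?_⟩
          by_contra hcon
          push Not at hcon
          have : 0 < s N ^ 2 := by have := hs N; positivity
          have h5 : 0 < (s N * s (N+1)) ^ 2 := by
            have := hs N; have := hs (N+1); positivity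
          nlinarith [mul_nonneg h3.le hcon, mul_pos h3 (neg_pos.2 hc), hs (N+1), mul_self_pos.2 (hs (j k)), mul_nonneg hcon (mul_pos h3 (neg_pos.2 hc)).le, mul_self_pos.2 (hs (N+1)), mul_pos (mul_self_pos.2 (hs (j k))) (mul_pos (mul_self_pos.2 (hs (N+1))) (mul_self_pos.2 (hs N)))]
      · simp
      · simpa using mul_self_pos.2 (hs (N+1))
    · change ∃ j : ℕ → ℕ, (∀ i < k, j i < j (i + 1) ∧ s (j i) * s (j (i + 1)) < 0) ∧
        j k ≤ N + 1 ∧ 0 < s (j k) * s (N + 1)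
      refine ⟨j, h1, by omega, ?_⟩
      push Not at hc
      have hc' : 0 < s N * s (N+1) := lt_of_le_of_ne hc (mul_ne_zero (hs _) (hs _)).symm
      have h4 := mul_pos h3 hc'
      have h5 := mul_self_pos.2 (hs N)
      by_contra hcon
      push Not at hcon
      nlinarith [mul_nonneg (neg_nonneg.2 hcon) h5.le]

lemma per_extend (n : ℕ) (hn : 0 < n) (q : ℕ → ℝ) (h1 : ∀ i, i + 1 < n → q i < q (i + 1))
    (h2 : q (n - 1) < q 0 + 1) :
    ∃ p : ℤ → ℝ, (∀ i, p i < p (i + 1)) ∧ (∀ i, p (i + n) = p i + 1) ∧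
      ∀ i, ∃ k : ℕ, ∃ l : ℤ, k < n ∧ i = k + l * n ∧ p i = q k + l := by
  have hn' : (0:ℤ) < n := by exact_mod_cast hn
  set p : ℤ → ℝ := fun i => q (i % n).toNat + ((i / n : ℤ) : ℝ) with hp
  have key : ∀ (k : ℕ) (l : ℤ), k < n → p (k + l * n) = q k + l := by
    intro k l hk
    have e1 : ((k:ℤ) + l * n) % n = k := by
      rw [Int.add_mul_emod_self_right]
      exact Int.emod_eq_of_lt (by omega) (by exact_mod_cast hk)
    have e2 : ((k:ℤ) + l * n) / n = l := by
      rw [Int.add_mul_ediv_right _ _ hn'.ne', Int.ediv_eq_zero_of_lt (by omega) (by exact_mod_cast hk)]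
      simp
    simp only [hp, e1, e2, Int.toNat_natCast]
  have rep : ∀ i : ℤ, ∃ k : ℕ, ∃ l : ℤ, k < n ∧ i = k + l * n ∧ p i = q k + l := by
    intro i
    have a := Int.emod_nonneg i hn'.ne'
    have b := Int.emod_lt_of_pos i hn'
    have c := Int.emod_add_mul_ediv i n
    refine ⟨(i % n).toNat, i / n, by omega, ?_, rfl⟩
    rw [Int.toNat_of_nonneg a]; linarith [mul_comm (n:ℤ) (i/n)]
  refine ⟨p, ?_, ?_, rep⟩
  · intro i
    obtain ⟨k, l, hk, rfl, e⟩ := rep i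
    rw [e]
    by_cases h : k + 1 < n
    · have := key (k+1) l h
      push_cast at this
      rw [show (k:ℤ) + l * n + 1 = k + 1 + l * n by ring, this]
      linarith [h1 k h]
    · have hk' : k = n - 1 := by omega
      have := key 0 (l+1) hn
      have e2 : (k:ℤ) + l * n + 1 = ((0:ℕ):ℤ) + (l+1) * n := by
        have : (k:ℤ) + 1 = n := by omega
        push_cast; linear_combination this
      rw [e2, this, hk']
      push_cast
      linarith
  · intro i
    obtain ⟨k, l, hk, rfl, e⟩ := rep i
    have := key k (l+1) hk
    rw [e, show (k:ℤ) + l * n + n = k + (l+1) * n by ring, this]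
    push_cast; ring

lemma riemann_var {θ θ1 : ℝ → ℝ} (hθ : ∀ u, HasDerivAt θ (θ1 u) u) (hc : Continuous θ1)
    {K : ℝ} (hK : K < ∫ u in (0:ℝ)..1, |θ1 u|) :
    ∃ N : ℕ, 0 < N ∧ (∀ i < N, |θ ((i + 1 : ℕ) / (N:ℝ)) - θ (i / (N:ℝ))| < π) ∧
      K - 2 < ∑ i ∈ Finset.range N, |θ ((i + 1 : ℕ) / (N:ℝ)) - θ (i / (N:ℝ))| := by
  have cθ : Continuous θ := continuous_iff_continuousAt.2 fun u => (hθ u).continuousAt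
  have u1 := isCompact_Icc (a := (0:ℝ)) (b := 1) |>.uniformContinuousOn_of_continuous hc.continuousOn
  have u2 := isCompact_Icc (a := (0:ℝ)) (b := 1) |>.uniformContinuousOn_of_continuous cθ.continuousOn
  rw [Metric.uniformContinuousOn_iff] at u1 u2
  obtain ⟨d1, hd1, H1⟩ := u1 1 one_pos
  obtain ⟨d2, hd2, H2⟩ := u2 π pi_pos
  obtain ⟨N, hN⟩ := exists_nat_gt (max (1/d1) (1/d2))
  have hN1 := (le_max_left _ _).trans_lt hN
  have hN2 := (le_max_right _ _).trans_lt hN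
  have hN0 : (0:ℝ) < N := lt_trans (by positivity) hN1
  have hN1' : 1 / (N:ℝ) < d1 := by rw [div_lt_comm₀ hN0 hd1]; exact hN1
  have hN2' : 1 / (N:ℝ) < d2 := by rw [div_lt_comm₀ hN0 hd2]; exact hN2
  have hmem : ∀ i ≤ N, (i:ℝ)/N ∈ Icc (0:ℝ) 1 := by
    intro i hi
    refine ⟨by positivity, ?_⟩
    rw [div_le_one hN0]; exact_mod_cast hi
  have hsub : ∀ i : ℕ, ((i + 1 : ℕ) / (N:ℝ)) = i / N + 1 / N := by
    intro i; push_cast; ring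
  refine ⟨N, by exact_mod_cast hN0, ?_, ?_⟩
  · intro i hi
    apply H2 _ (hmem _ hi) _ (hmem _ hi.le)
    rw [hsub, Real.dist_eq, add_sub_cancel_left, abs_of_pos (by positivity)]
    exact hN2'
  · have hsum : ∑ i ∈ Finset.range N, ∫ u in ((i:ℝ)/N)..((i+1:ℕ)/(N:ℝ)), |θ1 u| = ∫ u in (0:ℝ)..1, |θ1 u| := by
      have := intervalIntegral.sum_integral_adjacent_intervals (f := fun u => |θ1 u|) (μ := volume)
        (a := fun i : ℕ => (i:ℝ)/N) (n := N) (fun k _ => (hc.abs.intervalIntegrable _ _))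
      rw [this]
      simp [hN0.ne']
    have hterm : ∀ i ∈ Finset.range N, ∫ u in ((i:ℝ)/N)..((i+1:ℕ)/(N:ℝ)), |θ1 u| ≤
        |θ ((i + 1 : ℕ) / (N:ℝ)) - θ (i / (N:ℝ))| + 2 / N := by
      intro i hi
      rw [Finset.mem_range] at hi
      have ftc : ∫ u in ((i:ℝ)/N)..((i+1:ℕ)/(N:ℝ)), θ1 u = θ ((i + 1 : ℕ) / (N:ℝ)) - θ (i / (N:ℝ)) :=
        intervalIntegral.integral_eq_sub_of_hasDerivAt (fun u _ => hθ u) (hc.intervalIntegrable _ _)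
      set a := (i:ℝ)/N
      have hab : ((i + 1 : ℕ) / (N:ℝ)) = a + 1 / N := hsub i
      have ha := hmem i hi.le
      have hb := hmem (i+1) hi
      rw [hab] at ftc hb ⊢
      have hle : a ≤ a + 1/N := by have : (0:ℝ) ≤ 1/N := by positivity
                                   linarith
      have near : ∀ u ∈ Icc a (a+1/N), |θ1 u - θ1 a| ≤ 1 := by
        intro u hu
        have := H1 u ⟨ha.1.trans hu.1, hu.2.trans hb.2⟩ a ha (by
          rw [Real.dist_eq, abs_of_nonneg (by linarith [hu.1])]; linarith [hu.2])
        exact this.le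
      have b1 : ∫ u in a..(a+1/N), |θ1 u| ≤ ∫ u in a..(a+1/N), (|θ1 a| + 1) := by
        apply intervalIntegral.integral_mono_on hle (hc.abs.intervalIntegrable _ _) (by simp)
        intro u hu
        have := near u hu
        have := abs_sub_abs_le_abs_sub (θ1 u) (θ1 a)
        linarith
      rw [intervalIntegral.integral_const] at b1
      have b2 : |∫ u in a..(a+1/N), (θ1 u - θ1 a)| ≤ 1 * |a + 1/N - a| := by
        rw [← Real.norm_eq_abs (∫ u in a..(a+1/N), (θ1 u - θ1 a))]
        apply intervalIntegral.norm_integral_le_of_norm_le_const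
        intro u hu
        rw [uIoc_of_le hle] at hu
        exact near u ⟨hu.1.le, hu.2⟩
      rw [intervalIntegral.integral_sub (hc.intervalIntegrable _ _) (by simp), ftc,
        intervalIntegral.integral_const, add_sub_cancel_left, abs_of_pos (by positivity : (0:ℝ) < 1/N)] at b2
      rw [add_sub_cancel_left] at b1
      simp only [smul_eq_mul] at b1 b2
      have b3 : |1/(N:ℝ) * θ1 a| = 1/N * |θ1 a| := by rw [abs_mul, abs_of_pos (by positivity : (0:ℝ) < 1/N)]
      have b4 := abs_sub_abs_le_abs_sub (1/(N:ℝ) * θ1 a) (θ (a+1/N) - θ a)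
      rw [abs_sub_comm (1/(N:ℝ) * θ1 a), b3] at b4
      have : 2/(N:ℝ) = 2 * (1/N) := by ring
      rw [this]
      linarith
    have := Finset.sum_le_sum hterm
    rw [hsum, Finset.sum_add_distrib, Finset.sum_const, Finset.card_range] at this
    have e : N • (2/(N:ℝ)) = 2 := by rw [nsmul_eq_mul]; field_simp
    rw [e] at this
    linarith

lemma cross_measure {a b : ℝ} (h : |b - a| < π) :
    |b - a| ≤ ∫ φ in (0:ℝ)..π, indicator {φ | cos (a - φ) * cos (b - φ) < 0} (fun _ => (1:ℝ)) φ := by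
  wlog hab : a ≤ b generalizing a b
  · have := this (a := b) (b := a) (by rwa [abs_sub_comm]) (by linarith)
    rw [abs_sub_comm] at this
    simpa only [mul_comm (cos (b - _))] using this
  rw [abs_of_nonneg (by linarith)] at h ⊢
  set S : Set ℝ := {φ | cos (a - φ) * cos (b - φ) < 0} with hS
  set g : ℝ → ℝ := indicator S (fun _ => (1:ℝ)) with hg
  have mS : MeasurableSet S := by
    apply (isOpen_lt (by fun_prop) (by fun_prop)).measurableSet
  have hg1 : ∀ x y, IntervalIntegrable g volume x y := by
    intro x y
    have : IntervalIntegrable (fun _ : ℝ => (1:ℝ)) volume x y := by simp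
    rw [intervalIntegrable_iff] at this ⊢
    exact this.indicator mS
  have hp : Function.Periodic g π := by
    intro φ
    have hiff : φ + π ∈ S ↔ φ ∈ S := by
      change cos (a - (φ + π)) * cos (b - (φ + π)) < 0 ↔ cos (a - φ) * cos (b - φ) < 0
      rw [← sub_sub, ← sub_sub, cos_sub_pi, cos_sub_pi, neg_mul_neg]
    by_cases hφ : φ ∈ S
    · simp [hg, hφ, hiff.2 hφ]
    · simp [hg, hφ, mt hiff.1 hφ]
  have e := hp.intervalIntegral_add_eq 0 (a + π/2)
  rw [zero_add] at e
  rw [e, ← intervalIntegral.integral_add_adjacent_intervals (hg1 _ (b + π/2)) (hg1 _ _)]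
  have e1 : ∫ x in (a + π/2)..(b + π/2), g x = ∫ x in (a + π/2)..(b + π/2), (1:ℝ) := by
    apply intervalIntegral.integral_congr_ae
    have : ∀ᵐ x : ℝ, x ≠ b + π/2 := by
      simp [ae_iff, measure_singleton]
    filter_upwards [this] with x hx hx'
    rw [uIoc_of_le (by linarith)] at hx'
    have hlt := lt_of_le_of_ne hx'.2 hx
    have : x ∈ S := by
      have c1 : cos (a - x) < 0 := by
        rw [← cos_neg]
        exact cos_neg_of_pi_div_two_lt_of_lt (by linarith [hx'.1]) (by linarith)
      have c2 : 0 < cos (b - x) := cos_pos_of_mem_Ioo ⟨by linarith, by linarith [hx'.1]⟩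
      exact mul_neg_of_neg_of_pos c1 c2
    simp [hg, this]
  have e2 : 0 ≤ ∫ x in (b + π/2)..(a + π/2 + π), g x := by
    apply intervalIntegral.integral_nonneg (by linarith)
    intro u _
    exact indicator_nonneg (fun _ _ => zero_le_one) u
  rw [e1, intervalIntegral.integral_const, smul_eq_mul]
  linarith

lemma crossings {θ θ1 : ℝ → ℝ} (hθ : ∀ u, HasDerivAt θ (θ1 u) u) (hc : Continuous θ1)
    (hper : ∀ u φ, cos (θ (u + 1) - φ) = cos (θ u - φ)) (m : ℕ)
    (hK : (2 * (m:ℝ) + 1) * π < ∫ u in (0:ℝ)..1, |θ1 u|) :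
    ∃ φ0 μ : ℝ, ∃ p : ℤ → ℝ, 0 < μ ∧ (∀ i, p i < p (i + 1)) ∧
      (∀ i, p (i + (2 * m + 2 : ℕ)) = p i + 1) ∧
      ∀ φ, |φ - φ0| < μ → ∀ i, 0 < sg i * cos (θ (p i) - φ) := by
  obtain ⟨N, hN, hd, hsum⟩ := riemann_var hθ hc hK
  have hNr : (0:ℝ) < N := by exact_mod_cast hN
  set a : ℕ → ℝ := fun i => θ (i / (N:ℝ)) with ha
  have cross : ∃ φ, (∀ i : ℕ, cos (a i - φ) ≠ 0) ∧
      2 * m + 1 ≤ ((Finset.range N).filter fun i => cos (a i - φ) * cos (a (i+1) - φ) < 0).card := by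
    by_contra hcon
    push Not at hcon
    have hae : ∀ᵐ φ : ℝ, ∀ i : ℕ, cos (a i - φ) ≠ 0 := by
      rw [ae_all_iff]
      intro i
      have : {φ : ℝ | cos (a i - φ) = 0} ⊆ range (fun k : ℤ => a i - (2 * k + 1) * π / 2) := by
        intro φ hφ
        obtain ⟨k, hk⟩ := Real.cos_eq_zero_iff.1 hφ
        exact ⟨k, by simp only; linarith⟩
      have h0 : volume {φ : ℝ | cos (a i - φ) = 0} = 0 :=
        measure_mono_null this ((countable_range _).measure_zero _)
      rw [ae_iff]; simpa using h0
    have gi : ∀ i, IntervalIntegrable (fun φ => indicator {φ | cos (a i - φ) * cos (a (i+1) - φ) < 0} (fun _ => (1:ℝ)) φ) volume 0 π := by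
      intro i
      have : IntervalIntegrable (fun _ : ℝ => (1:ℝ)) volume 0 π := by simp
      rw [intervalIntegrable_iff] at this ⊢
      exact this.indicator (isOpen_lt (by fun_prop) (by fun_prop)).measurableSet
    have h1 : ∑ i ∈ Finset.range N, |a (i+1) - a i| ≤
        ∫ φ in (0:ℝ)..π, ∑ i ∈ Finset.range N, indicator {φ | cos (a i - φ) * cos (a (i+1) - φ) < 0} (fun _ => (1:ℝ)) φ := by
      rw [intervalIntegral.integral_finsetSum (fun i _ => gi i)]
      apply Finset.sum_le_sum
      intro i hi
      exact cross_measure (hd i (Finset.mem_range.1 hi))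
    have h2 : ∫ φ in (0:ℝ)..π, ∑ i ∈ Finset.range N, indicator {φ | cos (a i - φ) * cos (a (i+1) - φ) < 0} (fun _ => (1:ℝ)) φ ≤ ∫ φ in (0:ℝ)..π, (2 * m : ℝ) := by
      apply intervalIntegral.integral_mono_ae pi_pos.le
      · have := IntervalIntegrable.sum (Finset.range N) (fun i _ => gi i)
        exact this.congr (fun φ _ => by simp)
      · simp
      · filter_upwards [hae] with φ hφ
        have := hcon φ hφ
        have h3 : ∑ i ∈ Finset.range N, indicator {φ | cos (a i - φ) * cos (a (i+1) - φ) < 0} (fun _ => (1:ℝ)) φ = (((Finset.range N).filter fun i => cos (a i - φ) * cos (a (i+1) - φ) < 0).card : ℝ) := by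
          rw [Finset.card_filter]
          push_cast
          apply Finset.sum_congr rfl
          intro i _
          simp [indicator]
        rw [h3]
        have : ((Finset.range N).filter fun i => cos (a i - φ) * cos (a (i+1) - φ) < 0).card ≤ 2 * m := by omega
        exact_mod_cast this
    rw [intervalIntegral.integral_const, smul_eq_mul] at h2
    have h4 := h1.trans h2
    have : (2 * (m:ℝ) + 1) * π - 2 < ∑ i ∈ Finset.range N, |a (i+1) - a i| := hsum
    nlinarith [pi_gt_three]
  obtain ⟨φ, hφ1, hφ2⟩ := cross
  obtain ⟨j, hj1, hj2, -⟩ := chain_extract (fun i => cos (a i - φ)) hφ1 N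
  -- normalise the sign
  have : ∃ φ0, ∀ i : ℕ, i < 2 * m + 2 → 0 < sg i * cos (a (j i) - φ0) := by
    have base : ∃ φ0, 0 < cos (a (j 0) - φ0) ∧ ∀ x y, cos (x - φ0) * cos (y - φ0) = cos (x - φ) * cos (y - φ) := by
      rcases lt_or_gt_of_ne (hφ1 (j 0)) with h | h
      · refine ⟨φ + π, ?_, ?_⟩
        · rw [← sub_sub, cos_sub_pi]; linarith
        · intro x y; rw [← sub_sub, ← sub_sub, cos_sub_pi, cos_sub_pi]; ring
      · exact ⟨φ, h, fun _ _ => rfl⟩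
    obtain ⟨φ0, b1, b2⟩ := base
    refine ⟨φ0, fun i => ?_⟩
    induction i with
    | zero => intro _; simpa [sg] using b1
    | succ i ih =>
      intro hi
      have h1 := ih (by omega)
      have h2 := (hj1 i (by omega)).2
      rw [← b2] at h2
      push_cast
      rw [sg_succ]
      by_contra hcon
      push Not at hcon
      nlinarith [sg_sq i, mul_nonneg h1.le (neg_nonneg.2 hcon)]
  obtain ⟨φ0, hφ0⟩ := this
  have jle : ∀ i, i ≤ 2 * m + 1 → j i ≤ N := by
    have mono : ∀ i k, i + k ≤ ((Finset.range N).filter fun i => cos (a i - φ) * cos (a (i+1) - φ) < 0).card → j i ≤ j (i + k) := by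
      intro i k
      induction k with
      | zero => simp
      | succ k ih =>
        intro h
        have := (hj1 (i+k) (by omega)).1
        have := ih (by omega)
        rw [← add_assoc]; omega
    intro i hi
    obtain ⟨k, hk⟩ := Nat.exists_eq_add_of_le (hi.trans hφ2)
    have := mono i k hk.ge
    rw [← hk] at this
    exact this.trans hj2
  obtain ⟨p, hp1, hp2, hp3⟩ := per_extend (2 * m + 2) (by omega) (fun i => (j i : ℝ) / N)
    (by
      intro i hi
      have := (hj1 i (by omega)).1
      gcongr)
    (by
      have e : 2 * m + 2 - 1 = 2 * m + 1 := by omega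
      rw [e]
      have h1 : (j (2 * m + 1) : ℝ) / N ≤ 1 := by
        rw [div_le_one hNr]; exact_mod_cast jle _ le_rfl
      have h0 : 0 ≤ (j 0 : ℝ) / N := by positivity
      rcases (show (j (2 * m + 1) : ℝ) / N ≤ (j 0 : ℝ) / N + 1 by linarith).lt_or_eq with h | h
      · exact h
      · exfalso
        have s1 := hφ0 0 (by omega)
        have s2 := hφ0 (2 * m + 1) (by omega)
        simp only [ha] at s1 s2
        rw [h, hper] at s2
        have e1 : sg ((2 * m + 1 : ℕ) : ℤ) = -1 := by
          unfold sg; rw [if_neg]; simp [parity_simps]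
        have e2 : sg ((0 : ℕ) : ℤ) = 1 := by simp [sg]
        rw [e1] at s2; rw [e2] at s1
        linarith)
  have hperk : ∀ (k : ℕ) u ψ, cos (θ (u + k) - ψ) = cos (θ u - ψ) := by
    intro k
    induction k with
    | zero => simp
    | succ k ih => intro u ψ; push_cast; rw [← add_assoc, hper, ih]
  have hperz : ∀ (l : ℤ) u ψ, cos (θ (u + l) - ψ) = cos (θ u - ψ) := by
    intro l u ψ
    obtain ⟨k, rfl | rfl⟩ := l.eq_nat_or_neg
    · exact hperk k u ψ
    · rw [← hperk k]; push_cast; rw [neg_add_cancel_right]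
  have hev : ∀ᶠ ψ in nhds φ0, ∀ i ∈ Finset.range (2 * m + 2), 0 < sg i * cos (a (j i) - ψ) := by
    rw [Finset.eventually_all]
    intro i hi
    have : Continuous fun ψ => sg i * cos (a (j i) - ψ) := by fun_prop
    exact this.continuousAt.eventually (lt_mem_nhds (hφ0 i (Finset.mem_range.1 hi)))
  obtain ⟨μ, hμ, H⟩ := Metric.eventually_nhds_iff.1 hev
  refine ⟨φ0, μ, p, hμ, hp1, hp2, ?_⟩
  intro ψ hψ i
  obtain ⟨k, l, hk, rfl, e⟩ := hp3 i
  rw [e, hperz]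
  have := H (by rwa [Real.dist_eq]) k (Finset.mem_range.2 hk)
  have e3 : sg ((k:ℤ) + l * (2 * m + 2 : ℕ)) = sg k := by
    unfold sg
    have : Even ((k:ℤ) + l * (2 * m + 2 : ℕ)) ↔ Even (k:ℤ) := by
      simp [parity_simps]
    simp only [this]
  rw [e3]
  exact this

end Part3

section Part4

/-! Slices -/

/-- A closed embedded regular `C²` planar curve with its first two derivatives. -/
structure Slice (X Y X1 Y1 X2 Y2 : ℝ → ℝ) : Prop where
  hX : ∀ u, HasDerivAt X (X1 u) u
  hY : ∀ u, HasDerivAt Y (Y1 u) u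
  hX1 : ∀ u, HasDerivAt X1 (X2 u) u
  hY1 : ∀ u, HasDerivAt Y1 (Y2 u) u
  cX2 : Continuous X2
  cY2 : Continuous Y2
  reg : ∀ u, 0 < X1 u ^ 2 + Y1 u ^ 2
  perX : ∀ u, X (u + 1) = X u
  perY : ∀ u, Y (u + 1) = Y u
  inj : InjOn (fun u => (X u, Y u)) (Ico 0 1)

lemma deriv_per {f f1 : ℝ → ℝ} (hf : ∀ u, HasDerivAt f (f1 u) u) (hp : ∀ u, f (u + 1) = f u) :
    ∀ u, f1 (u + 1) = f1 u := by
  intro u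
  have h1 := (hf (u + 1)).comp_add_const u 1
  have h2 : (fun x => f (x + 1)) = f := funext hp
  rw [h2] at h1
  exact h1.unique (hf u)

lemma per_int {f : ℝ → ℝ} (hp : ∀ u, f (u + 1) = f u) (l : ℤ) (u : ℝ) : f (u + l) = f u := by
  have := (show Function.Periodic f 1 from hp).int_mul l u
  simpa using this

namespace Slice
variable {X Y X1 Y1 X2 Y2 : ℝ → ℝ}

lemma cX (S : Slice X Y X1 Y1 X2 Y2) : Continuous X :=
  continuous_iff_continuousAt.2 fun u => (S.hX u).continuousAt
lemma cY (S : Slice X Y X1 Y1 X2 Y2) : Continuous Y :=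
  continuous_iff_continuousAt.2 fun u => (S.hY u).continuousAt
lemma cX1 (S : Slice X Y X1 Y1 X2 Y2) : Continuous X1 :=
  continuous_iff_continuousAt.2 fun u => (S.hX1 u).continuousAt
lemma cY1 (S : Slice X Y X1 Y1 X2 Y2) : Continuous Y1 :=
  continuous_iff_continuousAt.2 fun u => (S.hY1 u).continuousAt
lemma perX1 (S : Slice X Y X1 Y1 X2 Y2) : ∀ u, X1 (u + 1) = X1 u := deriv_per S.hX S.perX
lemma perY1 (S : Slice X Y X1 Y1 X2 Y2) : ∀ u, Y1 (u + 1) = Y1 u := deriv_per S.hY S.perY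
lemma perX2 (S : Slice X Y X1 Y1 X2 Y2) : ∀ u, X2 (u + 1) = X2 u := deriv_per S.hX1 S.perX1
lemma perY2 (S : Slice X Y X1 Y1 X2 Y2) : ∀ u, Y2 (u + 1) = Y2 u := deriv_per S.hY1 S.perY1

lemma no_double (S : Slice X Y X1 Y1 X2 Y2) {u v : ℝ} (h1 : u < v) (h2 : v < u + 1)
    (hx : X u = X v) (hy : Y u = Y v) : False := by
  have e : ∀ w, X (Int.fract w) = X w ∧ Y (Int.fract w) = Y w := by
    intro w
    have h3 := per_int S.perX ⌊w⌋ (Int.fract w)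
    have h4 := per_int S.perY ⌊w⌋ (Int.fract w)
    rw [Int.fract_add_floor] at h3 h4
    exact ⟨h3.symm, h4.symm⟩
  have := S.inj (x₁ := Int.fract u) (x₂ := Int.fract v) ⟨Int.fract_nonneg _, Int.fract_lt_one _⟩
    ⟨Int.fract_nonneg _, Int.fract_lt_one _⟩ (by
      simp only [(e u).1, (e u).2, (e v).1, (e v).2, hx, hy])
  rw [Int.fract_eq_fract] at this
  obtain ⟨z, hz⟩ := this
  have h5 : -1 < (z:ℝ) := by linarith
  have h6 : (z:ℝ) < 0 := by linarith
  have h5' : -1 < z := by exact_mod_cast h5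
  have h6' : z < 0 := by exact_mod_cast h6
  omega

lemma reflect (S : Slice X Y X1 Y1 X2 Y2) :
    Slice X (fun u => -Y u) X1 (fun u => -Y1 u) X2 (fun u => -Y2 u) where
  hX := S.hX
  hY := fun u => (S.hY u).neg
  hX1 := S.hX1
  hY1 := fun u => (S.hY1 u).neg
  cX2 := S.cX2
  cY2 := S.cY2.neg
  reg := fun u => by simpa using S.reg u
  perX := S.perX
  perY := fun u => by simp [S.perY]
  inj := fun u hu v hv h => S.inj hu hv (by simpa using h)

end Slice

/-- A lift whose angle functions are periodic increases by a fixed multiple of `2π`. -/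
lemma lift_period {θ θ1 : ℝ → ℝ} (hθ : ∀ u, HasDerivAt θ (θ1 u) u) (h1 : ∀ u, θ1 (u + 1) = θ1 u)
    (hc : cos (θ 1) = cos (θ 0)) (hs : sin (θ 1) = sin (θ 0)) :
    ∃ k : ℤ, ∀ u, θ (u + 1) = θ u + 2 * π * k := by
  have hconst : ∀ u, θ (u + 1) - θ u = θ 1 - θ 0 := by
    intro u
    have hd : ∀ u, HasDerivAt (fun u => θ (u + 1) - θ u) 0 u := by
      intro u
      have := ((hθ (u + 1)).comp_add_const u 1).sub (hθ u)
      rw [h1, sub_self] at this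
      exact this
    have := is_const_of_deriv_eq_zero (fun u => (hd u).differentiableAt) (fun u => (hd u).deriv) u 0
    simpa using this
  have : cos (θ 1 - θ 0) = 1 := by
    rw [cos_sub, hc, hs]; nlinarith [sin_sq_add_cos_sq (θ 0)]
  obtain ⟨k, hk⟩ := (Real.cos_eq_one_iff _).1 this
  exact ⟨k, fun u => by have := hconst u; linarith⟩

/-- A continuous function with `sin > 0` cannot drift by a nonzero multiple of `2π`. -/
lemma sin_pos_drift {D : ℝ → ℝ} (hD : Continuous D) (hs : ∀ u, 0 < sin (D u)) {l : ℤ}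
    (h : D 1 = D 0 + 2 * π * l) : l = 0 := by
  rcases lt_trichotomy l 0 with hl | hl | hl
  · exfalso
    have : (l:ℝ) ≤ -1 := by exact_mod_cast (by omega : l ≤ -1)
    obtain ⟨w, hw⟩ := mem_range_of_exists_le_of_exists_ge hD (c := D 0 - π)
      ⟨1, by nlinarith [pi_pos]⟩ ⟨0, by linarith [pi_pos]⟩
    have h1 := hs w
    rw [hw, sin_sub_pi] at h1
    linarith [hs 0]
  · exact hl
  · exfalso
    have : 1 ≤ (l:ℝ) := by exact_mod_cast (by omega : 1 ≤ l)
    obtain ⟨w, hw⟩ := mem_range_of_exists_le_of_exists_ge hD (c := D 0 + π)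
      ⟨0, by linarith [pi_pos]⟩ ⟨1, by nlinarith [pi_pos]⟩
    have h1 := hs w
    rw [hw, sin_add_pi] at h1
    linarith [hs 0]

/-- A star-shaped embedded curve winds once. -/
lemma Slice.wind_one {X Y X1 Y1 X2 Y2 : ℝ → ℝ} (S : Slice X Y X1 Y1 X2 Y2) {ψ ψ1 : ℝ → ℝ}
    (hψ : ∀ u, HasDerivAt ψ (ψ1 u) u) (hpos : ∀ u, 0 < ψ1 u)
    (hx : ∀ u, X u = √(X u ^ 2 + Y u ^ 2) * cos (ψ u))
    (hy : ∀ u, Y u = √(X u ^ 2 + Y u ^ 2) * sin (ψ u)) {k : ℤ}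
    (hk : ∀ u, ψ (u + 1) = ψ u + 2 * π * k) : k = 1 := by
  have cψ : Continuous ψ := continuous_iff_continuousAt.2 fun u => (hψ u).continuousAt
  have mψ : StrictMono ψ := strictMono_of_deriv_pos fun u => by rw [(hψ u).deriv]; exact hpos u
  have kpos : 0 < k := by
    have h1 := mψ (show (0:ℝ) < 0 + 1 by norm_num)
    rw [hk] at h1
    have h2 : 0 < 2 * π * (k:ℝ) := by linarith
    have h3 : 0 < (k:ℝ) := by
      by_contra h; push Not at h; nlinarith [pi_pos]
    exact_mod_cast h3
  by_contra hne
  have hk2 : (2:ℝ) ≤ k := by exact_mod_cast (by omega : (2:ℤ) ≤ k)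
  have stepN : ∀ (j : ℕ) u, ψ (u + j) = ψ u + 2 * π * k * j := by
    intro j
    induction j with
    | zero => simp
    | succ j ih => intro u; push_cast; rw [← add_assoc, hk, ih]; ring
  have h2k : 1 ≤ 2 * π * (k:ℝ) := by nlinarith [pi_gt_three]
  have surj : Function.Surjective ψ := by
    intro y
    apply mem_range_of_exists_le_of_exists_ge cψ
    · obtain ⟨j, hj⟩ := exists_nat_gt (ψ 0 - y)
      refine ⟨-(j:ℝ), ?_⟩
      have := stepN j (-(j:ℝ))
      rw [neg_add_cancel] at this
      have h5 : (j:ℝ) ≤ 2 * π * k * j := le_mul_of_one_le_left (by positivity) h2k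
      linarith
    · obtain ⟨j, hj⟩ := exists_nat_gt (y - ψ 0)
      refine ⟨0 + (j:ℝ), ?_⟩
      have := stepN j 0
      have h5 : (j:ℝ) ≤ 2 * π * k * j := le_mul_of_one_le_left (by positivity) h2k
      linarith
  set e := mψ.orderIsoOfSurjective ψ surj with he
  set σ : ℝ → ℝ := fun u => e.symm (ψ u + 2 * π) with hσ
  have cσ : Continuous σ := e.symm.continuous.comp (cψ.add continuous_const)
  have hσ1 : ∀ u, ψ (σ u) = ψ u + 2 * π := by
    intro u
    exact e.apply_symm_apply (ψ u + 2 * π)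
  have σlt : ∀ u, u < σ u := by
    intro u; rw [← mψ.lt_iff_lt, hσ1]; linarith [pi_pos]
  have ltσ : ∀ u, σ u < u + 1 := by
    intro u; rw [← mψ.lt_iff_lt, hσ1, hk]; nlinarith [pi_pos]
  set q : ℝ → ℝ := fun u => X u ^ 2 + Y u ^ 2 with hq
  have cq : Continuous q := by have := S.cX; have := S.cY; fun_prop
  have pq : Function.Periodic q 1 := by intro u; simp [hq, S.perX, S.perY]
  obtain ⟨M, -, hM⟩ := (isCompact_Icc (a := (0:ℝ)) (b := 1)).exists_isMaxOn ⟨0, by simp⟩ cq.continuousOn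
  obtain ⟨m, -, hm⟩ := (isCompact_Icc (a := (0:ℝ)) (b := 1)).exists_isMinOn ⟨0, by simp⟩ cq.continuousOn
  have ext : ∀ w, ∃ v ∈ Icc (0:ℝ) 1, q w = q v := by
    intro w
    obtain ⟨v, hv, h⟩ := pq.exists_mem_Ico₀ one_pos w
    exact ⟨v, ⟨hv.1, hv.2.le⟩, h⟩
  obtain ⟨w, hw⟩ := mem_range_of_exists_le_of_exists_ge (f := fun u => q (σ u) - q u)
    ((cq.comp cσ).sub cq) (c := 0)
    ⟨M, by
      obtain ⟨v, hv, h⟩ := ext (σ M)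
      have := hM hv
      simp only [mem_ofPred_eq] at this
      rw [h]; linarith⟩
    ⟨m, by
      obtain ⟨v, hv, h⟩ := ext (σ m)
      have := hm hv
      simp only [mem_ofPred_eq] at this
      rw [h]; linarith⟩
  have hqe : X (σ w) ^ 2 + Y (σ w) ^ 2 = X w ^ 2 + Y w ^ 2 := by
    have : q (σ w) - q w = 0 := hw
    simp only [hq] at this; linarith
  refine S.no_double (σlt w) (ltσ w) ?_ ?_
  · rw [hx w, hx (σ w), hqe, hσ1, cos_add_two_pi]
  · rw [hy w, hy (σ w), hqe, hσ1, sin_add_two_pi]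

lemma next_zero {θ θ1 : ℝ → ℝ} (hθ : ∀ u, HasDerivAt θ (θ1 u) u) {φ : ℝ}
    (h : ∀ u, cos (θ u - φ) = 0 → 0 < θ1 u) {a b : ℝ} (hab : a < b)
    (ha : cos (θ a - φ) = 0) (hb : cos (θ b - φ) = 0) : θ a + π ≤ θ b := by
  have cθ : Continuous θ := continuous_iff_continuousAt.2 fun u => (hθ u).continuousAt
  have key : ∀ ⦃x⦄, x ∈ Icc a b → θ a ≤ θ x := by
    apply image_le_of_deriv_right_lt_deriv_boundary (f := fun _ => θ a) (f' := fun _ => 0)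
      continuousOn_const (fun x _ => (hasDerivAt_const x (θ a)).hasDerivWithinAt) le_rfl hθ
    intro x _ hx
    apply h
    rw [← hx]; exact ha
  have hne : θ a ≠ θ b := by
    intro he
    -- then b is a min of θ on [a,b], so θ' b ≤ 0
    have hd := h b hb
    have h1 : ∀ᶠ x in nhdsWithin b (Iio b), θ x < θ b := by
      have := (hasDerivAt_iff_tendsto_slope_left_right.1 (hθ b)).1
      have := this.eventually (lt_mem_nhds hd)
      filter_upwards [this, self_mem_nhdsWithin] with x hx hx'
      rw [slope_def_field] at hx
      by_contra hcon
      push Not at hcon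
      have : (θ x - θ b) / (x - b) ≤ 0 :=
        div_nonpos_of_nonneg_of_nonpos (by linarith) (by linarith [show x < b from hx'])
      linarith
    have h2 : ∀ᶠ x in nhdsWithin b (Iio b), x ∈ Ioo a b := Ioo_mem_nhdsLT hab
    obtain ⟨x, hx1, hx2⟩ := (h1.and h2).exists
    have := key ⟨hx2.1.le, hx2.2.le⟩
    linarith
  have hlt : θ a < θ b := lt_of_le_of_ne (key (right_mem_Icc.2 hab.le)) hne
  obtain ⟨k, hk⟩ := Real.cos_eq_zero_iff.1 ha
  obtain ⟨l, hl⟩ := Real.cos_eq_zero_iff.1 hb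
  have hd : θ b - θ a = (l - k) * π := by linarith
  have h3 : 0 < ((l:ℝ) - k) := by
    by_contra hcon; push Not at hcon; nlinarith [pi_pos]
  have h4 : k < l := by
    have : (k:ℝ) < l := by linarith
    exact_mod_cast this
  have h5 : (k:ℝ) + 1 ≤ l := by exact_mod_cast h4
  nlinarith [pi_pos]

lemma fold_measure {θ θ1 g : ℝ → ℝ} (hθ : ∀ u, HasDerivAt θ (θ1 u) u) (hc : Continuous θ1)
    (hg : Continuous g) (hg0 : ∀ u, 0 ≤ g u) (hgb : ∀ u, θ1 u ≤ 0 → |θ1 u| ≤ g u) {φ0 μ : ℝ}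
    (hμ : 0 < μ) (hμ2 : 2 * μ ≤ π)
    (H : ∀ φ, |φ - φ0| < μ → ∃ u ∈ Icc (0:ℝ) 1, θ1 u ≤ 0 ∧ cos (θ u - φ) = 0) :
    2 * μ ≤ ∫ u in (0:ℝ)..1, g u := by
  have cθ : Continuous θ := continuous_iff_continuousAt.2 fun u => (hθ u).continuousAt
  set S : ℤ → Set ℝ := fun k => {u | u ∈ Icc (0:ℝ) 1 ∧ θ1 u ≤ 0 ∧
    θ u - (2 * k + 1) * π / 2 ∈ Ioo (φ0 - μ) (φ0 + μ)} with hS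
  have mS : ∀ k, MeasurableSet (S k) := by
    intro k
    have h1 : MeasurableSet {u : ℝ | θ1 u ≤ 0} := (isClosed_le hc continuous_const).measurableSet
    have h2 : MeasurableSet {u : ℝ | θ u - (2 * k + 1) * π / 2 ∈ Ioo (φ0 - μ) (φ0 + μ)} :=
      (isOpen_Ioo.preimage (by fun_prop : Continuous fun u => θ u - (2 * (k:ℝ) + 1) * π / 2)).measurableSet
    exact measurableSet_Icc.inter (h1.inter h2)
  have dS : Pairwise (Function.onFun Disjoint S) := by
    intro k l hkl
    rw [Function.onFun, Set.disjoint_left]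
    rintro u ⟨-, -, h1⟩ ⟨-, -, h2⟩
    apply hkl
    have a1 : ((k:ℝ) - l) * π < 2 * μ := by linarith [h1.1, h2.2, h1.2, h2.1]
    have a2 : -(2 * μ) < ((k:ℝ) - l) * π := by linarith [h1.1, h2.2, h1.2, h2.1]
    have b1 : (k:ℝ) - l < 1 := by by_contra h; push Not at h; nlinarith [pi_pos]
    have b2 : -1 < (k:ℝ) - l := by by_contra h; push Not at h; nlinarith [pi_pos]
    have c1 : k - l < 1 := by exact_mod_cast b1
    have c2 : -1 < k - l := by exact_mod_cast b2
    omega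
  have cover : Ioo (φ0 - μ) (φ0 + μ) ⊆ ⋃ k : ℤ, (fun x => x + (-((2 * (k:ℝ) + 1) * π / 2))) '' (θ '' S k) := by
    intro φ hφ
    obtain ⟨u, hu, hu1, hu2⟩ := H φ (by rw [abs_lt]; constructor <;> linarith [hφ.1, hφ.2])
    obtain ⟨k, hk⟩ := Real.cos_eq_zero_iff.1 hu2
    have e : θ u - (2 * k + 1) * π / 2 = φ := by linarith
    rw [mem_iUnion]
    exact ⟨k, θ u, ⟨u, ⟨hu, hu1, by rw [e]; exact hφ⟩, rfl⟩, by simp only; linarith⟩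
  have m1 : ∀ k : ℤ, volume ((fun x => x + (-((2 * (k:ℝ) + 1) * π / 2))) '' (θ '' S k)) ≤
      ∫⁻ u in S k, ENNReal.ofReal (g u) := by
    intro k
    rw [image_add_right, measure_preimage_add_right]
    have := addHaar_image_le_lintegral_abs_det_fderiv volume (mS k) (f := θ)
      (f' := fun u => ContinuousLinearMap.toSpanSingleton ℝ (θ1 u))
      (fun u _ => (hθ u).hasFDerivAt.hasFDerivWithinAt)
    refine this.trans ?_
    apply setLIntegral_mono' (mS k)
    intro u hu
    rw [ContinuousLinearMap.det_toSpanSingleton]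
    exact ENNReal.ofReal_le_ofReal (hgb u hu.2.1)
  have tot : ENNReal.ofReal (2 * μ) ≤ ENNReal.ofReal (∫ u in (0:ℝ)..1, g u) := by
    calc ENNReal.ofReal (2 * μ) = volume (Ioo (φ0 - μ) (φ0 + μ)) := by
          rw [Real.volume_Ioo]; congr 1; ring
      _ ≤ ∑' k, volume ((fun x => x + (-((2 * ((k:ℤ):ℝ) + 1) * π / 2))) '' (θ '' S k)) :=
          (measure_mono cover).trans (measure_iUnion_le _)
      _ ≤ ∑' k, ∫⁻ u in S k, ENNReal.ofReal (g u) := ENNReal.tsum_le_tsum m1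
      _ = ∫⁻ u in ⋃ k, S k, ENNReal.ofReal (g u) := (lintegral_iUnion mS dS _).symm
      _ ≤ ∫⁻ u in Icc (0:ℝ) 1, ENNReal.ofReal (g u) :=
          lintegral_mono_set (iUnion_subset fun k u hu => hu.1)
      _ = ENNReal.ofReal (∫ u in (0:ℝ)..1, g u) := by
          rw [intervalIntegral.integral_of_le zero_le_one, ← integral_Icc_eq_integral_Ioc,
            ofReal_integral_eq_lintegral_ofReal (hg.integrableOn_Icc) (Eventually.of_forall hg0)]
  rwa [ENNReal.ofReal_le_ofReal_iff] at tot
  exact intervalIntegral.integral_nonneg zero_le_one fun u _ => hg0 u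

lemma caseB {X Y X1 Y1 X2 Y2 : ℝ → ℝ} (S : Slice X Y X1 Y1 X2 Y2) {n : ℕ} (hn : 4 ≤ n)
    (hb : ∀ u, 0 < X u * Y1 u - Y u * X1 u) {g : ℝ → ℝ} (hg : Continuous g) (hg0 : ∀ u, 0 ≤ g u)
    (hgb : ∀ u, X1 u * Y2 u - Y1 u * X2 u ≤ 0 →
      |(X1 u * Y2 u - Y1 u * X2 u) / (X1 u ^ 2 + Y1 u ^ 2)| ≤ g u) {φ0 μ : ℝ}
    (hμ : 0 < μ) (hμ2 : 2 * μ ≤ π) (h_int : ∫ u in (0:ℝ)..1, g u < 2 * μ)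
    (H : ∀ φ, |φ - φ0| < μ → ∃ p : ℤ → ℝ, (∀ i, p i < p (i + 1)) ∧ (∀ i, p (i + n) = p i + 1) ∧
      ∀ i, cos φ * X1 (p i) + sin φ * Y1 (p i) = 0) : False := by
  have cX := S.cX
  have cY := S.cY
  have cX1 := S.cX1
  have cY1 := S.cY1
  have cX2 := S.cX2
  have cY2 := S.cY2
  have rpos : ∀ u, 0 < X u ^ 2 + Y u ^ 2 := by
    intro u
    by_contra h
    push Not at h
    have h1 : X u = 0 := by nlinarith [sq_nonneg (X u), sq_nonneg (Y u)]
    have h2 : Y u = 0 := by nlinarith [sq_nonneg (X u), sq_nonneg (Y u)]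
    have := hb u
    rw [h1, h2] at this; simp at this
  obtain ⟨ψ, hψ, ψc, ψs⟩ := angle_lift S.hX S.hY cX1 cY1 rpos
  obtain ⟨θ, hθ, θc, θs⟩ := angle_lift S.hX1 S.hY1 cX2 cY2 S.reg
  set θ1 : ℝ → ℝ := fun u => (X1 u * Y2 u - Y1 u * X2 u) / (X1 u ^ 2 + Y1 u ^ 2) with hθ1
  have cθ1 : Continuous θ1 := by
    apply Continuous.div (by fun_prop) (by fun_prop)
    intro u; exact (S.reg u).ne'
  have cθ : Continuous θ := continuous_iff_continuousAt.2 fun u => (hθ u).continuousAt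
  have cψ : Continuous ψ := continuous_iff_continuousAt.2 fun u => (hψ u).continuousAt
  have sr : ∀ u, 0 < √(X u ^ 2 + Y u ^ 2) := fun u => Real.sqrt_pos.2 (rpos u)
  have sl : ∀ u, 0 < √(X1 u ^ 2 + Y1 u ^ 2) := fun u => Real.sqrt_pos.2 (S.reg u)
  have X01 : X 1 = X 0 := by simpa using S.perX 0
  have Y01 : Y 1 = Y 0 := by simpa using S.perY 0
  have X101 : X1 1 = X1 0 := by simpa using S.perX1 0
  have Y101 : Y1 1 = Y1 0 := by simpa using S.perY1 0
  obtain ⟨k, hk⟩ := lift_period hψ (fun u => by rw [S.perX, S.perY, S.perX1, S.perY1])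
    (by
      have h1 := ψc 1
      rw [X01, Y01] at h1
      exact (mul_left_cancel₀ (sr 0).ne' ((ψc 0).symm.trans h1)).symm)
    (by
      have h1 := ψs 1
      rw [X01, Y01] at h1
      exact (mul_left_cancel₀ (sr 0).ne' ((ψs 0).symm.trans h1)).symm)
  have hk1 : k = 1 := S.wind_one hψ (fun u => div_pos (hb u) (rpos u)) ψc ψs hk
  obtain ⟨l, hl⟩ := lift_period hθ (fun u => by
      rw [S.perX1, S.perY1, S.perX2, S.perY2])
    (by
      have h1 := θc 1
      rw [X101, Y101] at h1
      exact (mul_left_cancel₀ (sl 0).ne' ((θc 0).symm.trans h1)).symm)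
    (by
      have h1 := θs 1
      rw [X101, Y101] at h1
      exact (mul_left_cancel₀ (sl 0).ne' ((θs 0).symm.trans h1)).symm)
  have hl1 : l = 1 := by
    have : l - 1 = 0 := by
      apply sin_pos_drift (D := fun u => θ u - ψ u) (cθ.sub cψ)
      · intro u
        have h1 := hb u
        have h2 : √(X u ^ 2 + Y u ^ 2) * √(X1 u ^ 2 + Y1 u ^ 2) * sin (θ u - ψ u) > 0 := by
          rw [sin_sub]
          calc _ = (√(X u ^ 2 + Y u ^ 2) * cos (ψ u)) * (√(X1 u ^ 2 + Y1 u ^ 2) * sin (θ u))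
                - (√(X u ^ 2 + Y u ^ 2) * sin (ψ u)) * (√(X1 u ^ 2 + Y1 u ^ 2) * cos (θ u)) := by ring
            _ = X u * Y1 u - Y u * X1 u := by rw [← ψc u, ← ψs u, ← θc u, ← θs u]
            _ > 0 := h1
        exact pos_of_mul_pos_right h2 (mul_pos (sr u) (sl u)).le
      · have a := hl 0
        have b := hk 0
        rw [zero_add] at a b
        rw [hk1] at b
        push_cast at b ⊢
        linarith
    omega
  have key : ∀ φ, |φ - φ0| < μ → ∃ u ∈ Icc (0:ℝ) 1, θ1 u ≤ 0 ∧ cos (θ u - φ) = 0 := by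
    intro φ hφ
    by_contra hcon
    push Not at hcon
    obtain ⟨p, hp1, hp2, hp3⟩ := H φ hφ
    have hz : ∀ u, cos (θ u - φ) = (cos φ * X1 u + sin φ * Y1 u) / √(X1 u ^ 2 + Y1 u ^ 2) := by
      intro u
      rw [eq_div_iff (sl u).ne', cos_sub]
      linear_combination -cos φ * θc u - sin φ * θs u
    have all : ∀ u, cos (θ u - φ) = 0 → 0 < θ1 u := by
      intro u hu
      by_contra hle
      push Not at hle
      have h3 := per_int (f := θ1) (fun u => by simp only [hθ1]; rw [S.perX1, S.perY1, S.perX2, S.perY2]) ⌊u⌋ (Int.fract u)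
      have h4 := per_int (f := fun u => cos (θ u - φ)) (fun u => by
        simp only [hz]; rw [S.perX1, S.perY1]) ⌊u⌋ (Int.fract u)
      simp only [Int.fract_add_floor] at h3 h4
      refine hcon (Int.fract u) ⟨Int.fract_nonneg _, (Int.fract_lt_one _).le⟩ (by rw [← h3]; exact hle) ?_
      rw [← h4]; exact hu
    have cz : ∀ i, cos (θ (p i) - φ) = 0 := by
      intro i; rw [hz, hp3, zero_div]
    have st : ∀ j : ℕ, θ (p 0) + j * π ≤ θ (p j) := by
      intro j
      induction j with
      | zero => simp
      | succ j ih =>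
        have := next_zero hθ all (hp1 j) (cz _) (cz _)
        push_cast at this ⊢
        linarith
    have s1 := st n
    have s2 := hp2 0
    rw [zero_add] at s2
    rw [s2, hl, hl1] at s1
    have : (4:ℝ) ≤ n := by exact_mod_cast hn
    push_cast at s1
    nlinarith [pi_pos]
  have := fold_measure hθ cθ1 hg hg0 (fun u hu => hgb u (by
    by_contra hcon
    push Not at hcon
    have := div_pos hcon (S.reg u)
    linarith)) hμ hμ2 key
  linarith

end Part4

section Part5

/-! The slice theorem -/

/-- Speed. -/
def sL (X1 Y1 : ℝ → ℝ) (u : ℝ) : ℝ := √(X1 u ^ 2 + Y1 u ^ 2)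

/-- Support function `⟨x, n⟩`. -/
def sB (X Y X1 Y1 : ℝ → ℝ) (u : ℝ) : ℝ := (Y u * X1 u - X u * Y1 u) / sL X1 Y1 u

/-- Shrinker defect `κ + ⟨x, n⟩ / 2`. -/
def sE (X Y X1 Y1 X2 Y2 : ℝ → ℝ) (u : ℝ) : ℝ :=
  (X1 u * Y2 u - Y1 u * X2 u) / sL X1 Y1 u ^ 3 + sB X Y X1 Y1 u / 2

/-- Squared radius. -/
def sq2 (X Y : ℝ → ℝ) (u : ℝ) : ℝ := X u ^ 2 + Y u ^ 2

lemma abs_sub_le_integral {F F' g : ℝ → ℝ} (hF : ∀ u, HasDerivAt F (F' u) u) (cF : Continuous F')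
    (cg : Continuous g) (h : ∀ u, |F' u| ≤ g u) {a b : ℝ} (hab : a ≤ b) :
    |F b - F a| ≤ ∫ u in a..b, g u := by
  rw [← intervalIntegral.integral_eq_sub_of_hasDerivAt (fun u _ => hF u) (cF.intervalIntegrable _ _)]
  refine (intervalIntegral.abs_integral_le_integral_abs hab).trans ?_
  exact intervalIntegral.integral_mono_on hab (cF.abs.intervalIntegrable _ _)
    (cg.intervalIntegrable _ _) fun u _ => h u

lemma per_integral {f : ℝ → ℝ} (hp : ∀ u, f (u + 1) = f u) (a : ℝ) :
    ∫ u in a..(a+1), f u = ∫ u in (0:ℝ)..1, f u := by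
  have := (show Function.Periodic f 1 from hp).intervalIntegral_add_eq a 0
  simpa using this

namespace Slice
variable {X Y X1 Y1 X2 Y2 : ℝ → ℝ}

lemma Lpos (S : Slice X Y X1 Y1 X2 Y2) (u : ℝ) : 0 < sL X1 Y1 u := Real.sqrt_pos.2 (S.reg u)

lemma Lsq (S : Slice X Y X1 Y1 X2 Y2) (u : ℝ) : sL X1 Y1 u ^ 2 = X1 u ^ 2 + Y1 u ^ 2 :=
  Real.sq_sqrt (S.reg u).le

lemma cL (S : Slice X Y X1 Y1 X2 Y2) : Continuous (sL X1 Y1) := by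
  have := S.cX1; have := S.cY1
  unfold sL; fun_prop

lemma cB (S : Slice X Y X1 Y1 X2 Y2) : Continuous (sB X Y X1 Y1) := by
  have := S.cX1; have := S.cY1; have := S.cX; have := S.cY; have := S.cL
  unfold sB
  exact Continuous.div (by fun_prop) (by fun_prop) fun u => (S.Lpos u).ne'

lemma cE (S : Slice X Y X1 Y1 X2 Y2) : Continuous (sE X Y X1 Y1 X2 Y2) := by
  have := S.cX1; have := S.cY1; have := S.cX2; have := S.cY2; have := S.cL; have := S.cB
  unfold sE
  exact (Continuous.div (by fun_prop) (by fun_prop) fun u => (pow_pos (S.Lpos u) 3).ne').add (by fun_prop)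

lemma cq (S : Slice X Y X1 Y1 X2 Y2) : Continuous (sq2 X Y) := by
  have := S.cX; have := S.cY
  unfold sq2; fun_prop

lemma perL (S : Slice X Y X1 Y1 X2 Y2) (u : ℝ) : sL X1 Y1 (u+1) = sL X1 Y1 u := by
  simp only [sL, S.perX1, S.perY1]
lemma perB (S : Slice X Y X1 Y1 X2 Y2) (u : ℝ) : sB X Y X1 Y1 (u+1) = sB X Y X1 Y1 u := by
  simp only [sB, S.perX1, S.perY1, S.perX, S.perY, S.perL]
lemma perE (S : Slice X Y X1 Y1 X2 Y2) (u : ℝ) : sE X Y X1 Y1 X2 Y2 (u+1) = sE X Y X1 Y1 X2 Y2 u := by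
  simp only [sE, S.perX1, S.perY1, S.perX2, S.perY2, S.perL, S.perB]
lemma perq (S : Slice X Y X1 Y1 X2 Y2) (u : ℝ) : sq2 X Y (u+1) = sq2 X Y u := by
  simp only [sq2, S.perX, S.perY]

lemma dL (S : Slice X Y X1 Y1 X2 Y2) (u : ℝ) :
    HasDerivAt (sL X1 Y1) ((X1 u * X2 u + Y1 u * Y2 u) / sL X1 Y1 u) u := by
  have h := (((S.hX1 u).pow 2).add ((S.hY1 u).pow 2)).sqrt (S.reg u).ne'
  refine h.congr_deriv ?_
  have := (S.Lpos u).ne'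
  simp only [sL, Pi.add_apply, Pi.pow_apply] at this ⊢
  field_simp
  push_cast; ring

lemma dq (S : Slice X Y X1 Y1 X2 Y2) (u : ℝ) :
    HasDerivAt (sq2 X Y) (2 * (X u * X1 u + Y u * Y1 u)) u := by
  refine (((S.hX u).pow 2).add ((S.hY u).pow 2)).congr_deriv ?_
  push_cast; ring

lemma dB (S : Slice X Y X1 Y1 X2 Y2) (u : ℝ) :
    HasDerivAt (sB X Y X1 Y1) (-((X1 u * Y2 u - Y1 u * X2 u) / sL X1 Y1 u ^ 3) *
      (X u * X1 u + Y u * Y1 u)) u := by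
  have h := (((S.hY u).mul (S.hX1 u)).sub ((S.hX u).mul (S.hY1 u))).div (S.dL u) (S.Lpos u).ne'
  refine h.congr_deriv ?_
  have h1 := (S.Lpos u).ne'
  have h2 := S.Lsq u
  simp only [Pi.sub_apply, Pi.mul_apply]
  field_simp
  rw [h2]
  ring

lemma dQ (S : Slice X Y X1 Y1 X2 Y2) (u : ℝ) :
    HasDerivAt (fun u => sB X Y X1 Y1 u * exp (-sq2 X Y u / 4))
      (-(sE X Y X1 Y1 X2 Y2 u * ((X u * X1 u + Y u * Y1 u) / sL X1 Y1 u)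
        * exp (-sq2 X Y u / 4) * sL X1 Y1 u)) u := by
  have h := (S.dB u).mul (((S.dq u).neg.div_const 4).exp)
  refine h.congr_deriv ?_
  have h1 := (S.Lpos u).ne'
  simp only [sE, Pi.neg_apply]
  field_simp
  ring

lemma ab_sq (S : Slice X Y X1 Y1 X2 Y2) (u : ℝ) :
    ((X u * X1 u + Y u * Y1 u) / sL X1 Y1 u) ^ 2 + sB X Y X1 Y1 u ^ 2 = sq2 X Y u := by
  have h1 := (S.Lpos u).ne'
  have h2 := S.Lsq u
  unfold sB sq2
  rw [div_pow, div_pow, ← add_div, div_eq_iff (pow_ne_zero 2 h1), h2]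
  ring

lemma q_nonneg (u : ℝ) : 0 ≤ sq2 X Y u := by unfold sq2; positivity

lemma Q_osc (S : Slice X Y X1 Y1 X2 Y2) {η M : ℝ} (hη : 0 < η)
    (h1 : ∫ u in (0:ℝ)..1, sE X Y X1 Y1 X2 Y2 u ^ 2 * exp (-sq2 X Y u / 4) * sL X1 Y1 u ≤ η ^ 2)
    (h2 : ∫ u in (0:ℝ)..1, exp (-sq2 X Y u / 8) * sL X1 Y1 u ≤ M) (u v : ℝ) :
    |sB X Y X1 Y1 v * exp (-sq2 X Y v / 4) - sB X Y X1 Y1 u * exp (-sq2 X Y u / 4)|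
      ≤ η * (1 + 8 * M) / 2 := by
  have cE := S.cE; have cL := S.cL; have cq := S.cq
  set Q : ℝ → ℝ := fun u => sB X Y X1 Y1 u * exp (-sq2 X Y u / 4) with hQ
  have pQ : Function.Periodic Q 1 := by intro u; simp only [hQ, S.perB, S.perq]
  obtain ⟨v', hv', e⟩ := pQ.exists_mem_Ico one_pos v u
  change |Q v - Q u| ≤ _
  rw [e]
  set g : ℝ → ℝ := fun u => (1 / (2 * η)) * (sE X Y X1 Y1 X2 Y2 u ^ 2 * exp (-sq2 X Y u / 4) * sL X1 Y1 u)
    + 4 * η * (exp (-sq2 X Y u / 8) * sL X1 Y1 u) with hg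
  have cg : Continuous g := by fun_prop
  have pg : ∀ u, g (u+1) = g u := by intro u; simp only [hg, S.perE, S.perq, S.perL]
  have g0 : ∀ u, 0 ≤ g u := by
    intro u
    have := S.Lpos u
    simp only [hg]; positivity
  have cD : Continuous fun u => -(sE X Y X1 Y1 X2 Y2 u * ((X u * X1 u + Y u * Y1 u) / sL X1 Y1 u)
        * exp (-sq2 X Y u / 4) * sL X1 Y1 u) := by
    have c1 : Continuous fun u => (X u * X1 u + Y u * Y1 u) / sL X1 Y1 u := by
      have := S.cX1; have := S.cY1; have := S.cX; have := S.cY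
      exact Continuous.div (by fun_prop) (by fun_prop) fun u => (S.Lpos u).ne'
    fun_prop
  have hb := abs_sub_le_integral S.dQ cD cg (a := u) (b := v') (by
    intro u
    set a := (X u * X1 u + Y u * Y1 u) / sL X1 Y1 u with ha
    set e := sE X Y X1 Y1 X2 Y2 u
    set q := sq2 X Y u with hq
    have hL := S.Lpos u
    have haq : a ^ 2 ≤ q := by have := S.ab_sq u; nlinarith [sq_nonneg (sB X Y X1 Y1 u)]
    have hexp : q * exp (-q / 4) ≤ 8 * exp (-q / 8) := by
      have e1 : exp (-q/4) = exp (-q/8) * exp (-q/8) := by rw [← exp_add]; ring_nf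
      have e2 : q / 8 ≤ exp (q/8) := by linarith [add_one_le_exp (q/8)]
      have e3 : exp (q/8) * exp (-q/8) = 1 := by rw [← exp_add]; ring_nf; simp
      have e4 := exp_pos (-q/8)
      rw [e1]
      nlinarith [mul_le_mul_of_nonneg_right e2 (mul_pos e4 e4).le]
    rw [abs_neg, abs_mul, abs_mul, abs_of_pos hL, abs_of_pos (exp_pos _), abs_mul]
    have am : |e| * |a| ≤ 1 / (2 * η) * e ^ 2 + η / 2 * a ^ 2 := by
      rw [← sq_abs e, ← sq_abs a]
      have : 1 / (2 * η) * |e| ^ 2 + η / 2 * |a| ^ 2 - |e| * |a| = (|e| - η * |a|) ^ 2 / (2 * η) := by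
        field_simp; ring
      have h5 : 0 ≤ (|e| - η * |a|) ^ 2 / (2 * η) := by positivity
      linarith
    have hx := exp_pos (-q/4)
    calc |e| * |a| * exp (-q/4) * sL X1 Y1 u
        ≤ (1 / (2 * η) * e ^ 2 + η / 2 * a ^ 2) * exp (-q/4) * sL X1 Y1 u := by gcongr
      _ = 1 / (2 * η) * (e ^ 2 * exp (-q/4) * sL X1 Y1 u) + η / 2 * (a ^ 2 * exp (-q/4)) * sL X1 Y1 u := by ring
      _ ≤ 1 / (2 * η) * (e ^ 2 * exp (-q/4) * sL X1 Y1 u) + η / 2 * (q * exp (-q/4)) * sL X1 Y1 u := by gcongr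
      _ ≤ 1 / (2 * η) * (e ^ 2 * exp (-q/4) * sL X1 Y1 u) + η / 2 * (8 * exp (-q/8)) * sL X1 Y1 u := by gcongr
      _ = g u := by simp only [hg]; ring) hv'.1
  refine hb.trans ?_
  have h3 : ∫ x in u..v', g x ≤ ∫ x in u..(u+1), g x := by
    apply intervalIntegral.integral_mono_interval le_rfl hv'.1 hv'.2.le
    · exact Eventually.of_forall g0
    · exact cg.intervalIntegrable _ _
  rw [per_integral pg] at h3
  refine h3.trans ?_
  simp only [hg]
  rw [intervalIntegral.integral_add (Continuous.intervalIntegrable (by fun_prop) _ _)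
    (Continuous.intervalIntegrable (by fun_prop) _ _), intervalIntegral.integral_const_mul,
    intervalIntegral.integral_const_mul]
  have h4 : 1 / (2 * η) * ∫ u in (0:ℝ)..1, sE X Y X1 Y1 X2 Y2 u ^ 2 * exp (-sq2 X Y u / 4) * sL X1 Y1 u
     ≤ 1 / (2 * η) * η ^ 2 := by gcongr
  have h5 : 4 * η * ∫ u in (0:ℝ)..1, exp (-sq2 X Y u / 8) * sL X1 Y1 u ≤ 4 * η * M := by gcongr
  have h6 : 1 / (2 * η) * η ^ 2 = η / 2 := by field_simp
  linarith

end Slice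

/-- Half Gaussian. -/
def Psi (a : ℝ) : ℝ := ∫ x in (0:ℝ)..a, exp (-(x ^ 2) / 4)

lemma dPsi (a : ℝ) : HasDerivAt Psi (exp (-(a ^ 2) / 4)) a := by
  have c : Continuous fun x : ℝ => exp (-(x ^ 2) / 4) := by fun_prop
  exact intervalIntegral.integral_hasDerivAt_right (c.intervalIntegrable 0 a)
      (c.stronglyMeasurableAtFilter _ _) c.continuousAt

lemma Psi_mono : StrictMono Psi :=
  strictMono_of_deriv_pos fun u => by rw [(dPsi u).deriv]; positivity

lemma Psi_tendsto : Tendsto Psi atTop (nhds (√π)) := by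
  have h := intervalIntegral_tendsto_integral_Ioi (f := fun x : ℝ => exp (-(1/4) * x ^ 2)) (μ := volume) 0
    (integrable_exp_neg_mul_sq (by norm_num : (0:ℝ) < 1/4)).integrableOn tendsto_id
  rw [integral_gaussian_Ioi] at h
  have e : √(π / (1/4)) / 2 = √π := by
    rw [show π / (1/4) = π * 2 ^ 2 by ring, Real.sqrt_mul pi_pos.le, Real.sqrt_sq (by norm_num)]
    ring
  rw [e] at h
  refine h.congr fun a => ?_
  unfold Psi
  congr 1
  ext x
  congr 1; ring

lemma choose_radii (m : ℕ) : ∃ ρ R : ℝ, 0 < ρ ∧ ρ ≤ 1 ∧ 0 < R ∧ 3 ≤ R ^ 2 ∧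
    √(4 * π) * m < ((2 * m + 2 : ℕ) : ℝ) * (Psi R - Psi (√2 * ρ)) := by
  have sp : 0 < √π := Real.sqrt_pos.2 pi_pos
  have e4 : √(4 * π) = 2 * √π := by
    rw [show (4:ℝ) * π = 2 ^ 2 * π by ring, Real.sqrt_mul (by positivity), Real.sqrt_sq (by norm_num)]
  set ε := √π / (2 * m + 2) / 4 with hε
  have hm : (0:ℝ) < 2 * m + 2 := by positivity
  have εpos : 0 < ε := by positivity
  have h1 : ∀ᶠ R in atTop, √π - ε < Psi R := Psi_tendsto.eventually (lt_mem_nhds (by linarith))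
  obtain ⟨R, hR1, hR2⟩ := (h1.and (eventually_ge_atTop 2)).exists
  have P0 : Psi 0 = 0 := by simp [Psi]
  have ct : Continuous fun ρ : ℝ => Psi (√2 * ρ) := by
    have : Continuous Psi := continuous_iff_continuousAt.2 fun u => (dPsi u).continuousAt
    fun_prop
  have h2 : ∀ᶠ ρ in nhds (0:ℝ), Psi (√2 * ρ) < ε := by
    apply ct.continuousAt.eventually (gt_mem_nhds _)
    simp [P0, εpos]
  have h3 : ∀ᶠ ρ in nhdsWithin (0:ℝ) (Ioi 0), ρ ∈ Ioo (0:ℝ) 1 := Ioo_mem_nhdsGT one_pos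
  obtain ⟨ρ, hρ1, hρ2⟩ := ((h2.filter_mono nhdsWithin_le_nhds).and h3).exists
  refine ⟨ρ, R, hρ2.1, hρ2.2.le, by linarith, by nlinarith, ?_⟩
  rw [e4]
  push_cast
  have h5 : (2 * (m:ℝ) + 2) * ε = √π / 4 := by rw [hε]; field_simp
  have : √π - 2 * ε < Psi R - Psi (√2 * ρ) := by linarith
  have h6 := mul_lt_mul_of_pos_left this hm
  nlinarith

lemma Slice.caseA {X Y X1 Y1 X2 Y2 : ℝ → ℝ} (S : Slice X Y X1 Y1 X2 Y2) {n : ℕ} (hn : 0 < n)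
    (he : Even n) {ρ R δ : ℝ} (hρ : 0 < ρ) (hρ1 : ρ ≤ 1) (hR : 0 < R) (hR3 : 3 ≤ R ^ 2)
    (hδ : δ < ρ * exp (-(R ^ 2) / 4))
    (hQ : ∀ u, |sB X Y X1 Y1 u * exp (-sq2 X Y u / 4)| ≤ δ) {c v : ℤ → ℝ} (hA : Alt n c)
    (hc : ∀ i, 1 < c i ∧ c i < 3) (hz : Zig n (sq2 X Y) c v) :
    (n:ℝ) * (Psi R - Psi (√2 * ρ)) ≤ ∫ u in (0:ℝ)..1, exp (-sq2 X Y u / 4) * sL X1 Y1 u := by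
  have cq := S.cq
  have cL := S.cL
  obtain ⟨p, hp, hcrit⟩ := hz.crit hn he S.cq S.perq hA
  have noc : ∀ u, deriv (sq2 X Y) u = 0 → ρ ^ 2 ≤ sq2 X Y u → sq2 X Y u ≤ R ^ 2 → False := by
    intro u hu h1 h2
    rw [(S.dq u).deriv] at hu
    have hab := S.ab_sq u
    have h0 : X u * X1 u + Y u * Y1 u = 0 := by linarith
    rw [h0, zero_div] at hab
    have hb : ρ ≤ |sB X Y X1 Y1 u| := by
      apply le_of_sq_le_sq _ (abs_nonneg _)
      rw [sq_abs]; linarith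
    have := hQ u
    rw [abs_mul, abs_of_pos (exp_pos _)] at this
    have h3 : exp (-(R^2)/4) ≤ exp (-sq2 X Y u / 4) := by
      apply exp_le_exp.2; linarith
    have := mul_le_mul hb h3 (exp_pos _).le (abs_nonneg _)
    linarith
  have hi : ∀ i, (sg i = 1 → R ^ 2 < sq2 X Y (p i)) ∧ (sg i = -1 → sq2 X Y (p i) < ρ ^ 2) := by
    intro i
    have h1 := hp.lev i
    have h2 := hc i
    constructor
    · intro h
      rw [h] at h1
      by_contra hcon; push Not at hcon
      exact noc _ (hcrit i) (by nlinarith) hcon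
    · intro h
      rw [h] at h1
      by_contra hcon; push Not at hcon
      exact noc _ (hcrit i) hcon (by linarith)
  set r : ℝ → ℝ := fun u => √(sq2 X Y u + ρ ^ 2) with hr
  have rpos : ∀ u, 0 < sq2 X Y u + ρ ^ 2 := by
    intro u; have := Slice.q_nonneg (X := X) (Y := Y) u; positivity
  have srpos : ∀ u, 0 < r u := fun u => Real.sqrt_pos.2 (rpos u)
  have rsq : ∀ u, r u ^ 2 = sq2 X Y u + ρ ^ 2 := fun u => Real.sq_sqrt (rpos u).le
  have dr : ∀ u, HasDerivAt r ((X u * X1 u + Y u * Y1 u) / r u) u := by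
    intro u
    refine (((S.dq u).add_const (ρ^2)).sqrt (rpos u).ne').congr_deriv ?_
    have := srpos u
    simp only [hr] at this ⊢
    field_simp
  have cr : Continuous r := by fun_prop
  have dF : ∀ u, HasDerivAt (fun u => Psi (r u)) (exp (-(r u ^ 2) / 4) * ((X u * X1 u + Y u * Y1 u) / r u)) u :=
    fun u => (dPsi (r u)).comp u (dr u)
  have cF : Continuous fun u => exp (-(r u ^ 2) / 4) * ((X u * X1 u + Y u * Y1 u) / r u) := by
    have := S.cX1; have := S.cY1; have := S.cX; have := S.cY
    apply Continuous.mul (by fun_prop)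
    exact Continuous.div (by fun_prop) cr fun u => (srpos u).ne'
  have cg : Continuous fun u => exp (-sq2 X Y u / 4) * sL X1 Y1 u := by fun_prop
  have bd : ∀ u, |exp (-(r u ^ 2) / 4) * ((X u * X1 u + Y u * Y1 u) / r u)| ≤ exp (-sq2 X Y u / 4) * sL X1 Y1 u := by
    intro u
    rw [abs_mul, abs_of_pos (exp_pos _)]
    have h1 : exp (-(r u ^ 2) / 4) ≤ exp (-sq2 X Y u / 4) := by
      apply exp_le_exp.2; rw [rsq]; nlinarith [sq_nonneg ρ]
    have h2 : |(X u * X1 u + Y u * Y1 u) / r u| ≤ sL X1 Y1 u := by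
      rw [abs_div, abs_of_pos (srpos u), div_le_iff₀ (srpos u)]
      apply abs_le_of_sq_le_sq _ (mul_pos (S.Lpos u) (srpos u)).le
      rw [mul_pow, rsq, S.Lsq]
      have : sq2 X Y u = X u ^ 2 + Y u ^ 2 := rfl
      rw [this]
      nlinarith [sq_nonneg (X u * Y1 u - Y u * X1 u), mul_nonneg (S.reg u).le (sq_nonneg ρ)]
    exact mul_le_mul h1 h2 (abs_nonneg _) (exp_pos _).le
  have hiR : ∀ i, sg i = 1 → Psi R ≤ Psi (r (p i)) := by
    intro i h
    apply Psi_mono.monotone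
    apply le_of_sq_le_sq _ (srpos _).le
    rw [rsq]; nlinarith [(hi i).1 h, sq_nonneg ρ]
  have hilo : ∀ i, sg i = -1 → Psi (r (p i)) ≤ Psi (√2 * ρ) := by
    intro i h
    apply Psi_mono.monotone
    apply le_of_sq_le_sq _ (by positivity)
    rw [rsq, mul_pow, Real.sq_sqrt (by norm_num)]; nlinarith [(hi i).2 h]
  have seg : ∀ i : ℤ, Psi R - Psi (√2 * ρ) ≤ ∫ u in (p i)..(p (i+1)), exp (-sq2 X Y u / 4) * sL X1 Y1 u := by
    intro i
    refine le_trans ?_ (abs_sub_le_integral dF cF cg bd (hp.mono i).le)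
    have hs := sg_succ i
    rcases sg_cases i with h | h
    · have a := hiR i h
      have b := hilo (i+1) (by rw [hs, h])
      rw [abs_sub_comm]
      exact le_trans (by linarith) (le_abs_self _)
    · have a := hilo i h
      have b := hiR (i+1) (by rw [hs, h]; norm_num)
      exact le_trans (by linarith) (le_abs_self _)
  have tot := intervalIntegral.sum_integral_adjacent_intervals (f := fun u => exp (-sq2 X Y u / 4) * sL X1 Y1 u)
    (μ := volume) (a := fun i : ℕ => p i) (n := n) (fun k _ => cg.intervalIntegrable _ _)
  have hpn : p (n:ℕ) = p 0 + 1 := by simpa using hp.per 0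
  simp only [hpn, Nat.cast_zero] at tot
  rw [per_integral (fun u => by simp only [S.perq, S.perL])] at tot
  rw [← tot]
  have := Finset.card_nsmul_le_sum (Finset.range n) (fun i : ℕ => ∫ u in (p i)..(p ((i+1:ℕ):ℤ)), exp (-sq2 X Y u / 4) * sL X1 Y1 u)
    (Psi R - Psi (√2 * ρ)) (fun i _ => by push_cast; exact seg i)
  rw [Finset.card_range, nsmul_eq_mul] at this
  exact this

end Part5

section Part6

lemma Slice.caseB_neg {X Y X1 Y1 X2 Y2 : ℝ → ℝ} (S : Slice X Y X1 Y1 X2 Y2) {n : ℕ} (hn : 4 ≤ n)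
    (hb : ∀ u, sB X Y X1 Y1 u < 0) {ε η M μ φ0 : ℝ} (hε : 0 < ε)
    (hexp : ∀ u, ε ≤ exp (-sq2 X Y u / 8)) (hη : 0 < η) (hμ : 0 < μ) (hμ2 : 2 * μ ≤ π)
    (hC : η * ((1 / ε ^ 2 + M / ε) / 2) < 2 * μ)
    (h1 : ∫ u in (0:ℝ)..1, sE X Y X1 Y1 X2 Y2 u ^ 2 * exp (-sq2 X Y u / 4) * sL X1 Y1 u ≤ η ^ 2)
    (h2 : ∫ u in (0:ℝ)..1, exp (-sq2 X Y u / 8) * sL X1 Y1 u ≤ M)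
    (H : ∀ φ, |φ - φ0| < μ → ∃ p : ℤ → ℝ, (∀ i, p i < p (i + 1)) ∧ (∀ i, p (i + n) = p i + 1) ∧
      ∀ i, cos φ * X1 (p i) + sin φ * Y1 (p i) = 0) : False := by
  have cE := S.cE; have cL := S.cL; have cq := S.cq
  refine caseB S hn ?_ (g := fun u => |sE X Y X1 Y1 X2 Y2 u| * sL X1 Y1 u) (by fun_prop) ?_ ?_ hμ hμ2 ?_ H
  · intro u
    have := hb u
    unfold sB at this
    by_contra hcon
    push Not at hcon
    have h3 : 0 ≤ (Y u * X1 u - X u * Y1 u) / sL X1 Y1 u := div_nonneg (by linarith) (S.Lpos u).le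
    linarith
  · intro u; have := S.Lpos u; positivity
  · intro u hu
    have hL := S.Lpos u
    rw [← S.Lsq u]
    have e : (X1 u * Y2 u - Y1 u * X2 u) / sL X1 Y1 u ^ 2
        = (X1 u * Y2 u - Y1 u * X2 u) / sL X1 Y1 u ^ 3 * sL X1 Y1 u := by field_simp
    rw [e, abs_mul, abs_of_pos hL]
    apply mul_le_mul_of_nonneg_right _ hL.le
    have h3 : (X1 u * Y2 u - Y1 u * X2 u) / sL X1 Y1 u ^ 3 ≤ 0 :=
      div_nonpos_of_nonpos_of_nonneg hu (by positivity)
    have h4 := hb u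
    have h5 : sE X Y X1 Y1 X2 Y2 u ≤ (X1 u * Y2 u - Y1 u * X2 u) / sL X1 Y1 u ^ 3 := by
      unfold sE; linarith
    rw [abs_of_nonpos h3, abs_of_nonpos (h5.trans h3)]
    linarith
  · refine lt_of_le_of_lt ?_ hC
    have hM : ∫ u in (0:ℝ)..1, |sE X Y X1 Y1 X2 Y2 u| * sL X1 Y1 u ≤
        ∫ u in (0:ℝ)..1, (1 / (2 * η * ε ^ 2) * (sE X Y X1 Y1 X2 Y2 u ^ 2 * exp (-sq2 X Y u / 4) * sL X1 Y1 u)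
          + η / (2 * ε) * (exp (-sq2 X Y u / 8) * sL X1 Y1 u)) := by
      apply intervalIntegral.integral_mono_on zero_le_one (Continuous.intervalIntegrable (by fun_prop) _ _)
        (Continuous.intervalIntegrable (by fun_prop) _ _)
      intro u _
      have hL := S.Lpos u
      set e := sE X Y X1 Y1 X2 Y2 u
      set x := exp (-sq2 X Y u / 8) with hx
      have hx4 : exp (-sq2 X Y u / 4) = x ^ 2 := by
        rw [hx, sq, ← exp_add]; ring_nf
      rw [hx4]
      have hxe : ε ≤ x := hexp u
      have am : |e| ≤ 1 / (2 * η) * e ^ 2 + η / 2 := by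
        rw [← sq_abs e]
        have : 1 / (2 * η) * |e| ^ 2 + η / 2 - |e| = (|e| - η) ^ 2 / (2 * η) := by
          field_simp; ring
        have h5 : 0 ≤ (|e| - η) ^ 2 / (2 * η) := by positivity
        linarith
      have r1 : 1 ≤ x ^ 2 / ε ^ 2 := by
        rw [le_div_iff₀ (by positivity)]; nlinarith
      have r2 : 1 ≤ x / ε := by
        rw [le_div_iff₀ (by positivity)]; linarith
      calc |e| * sL X1 Y1 u ≤ (1 / (2 * η) * e ^ 2 * 1 + η / 2 * 1) * sL X1 Y1 u := by
            rw [mul_one, mul_one]; gcongr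
        _ ≤ (1 / (2 * η) * e ^ 2 * (x ^ 2 / ε ^ 2) + η / 2 * (x / ε)) * sL X1 Y1 u := by gcongr
        _ = _ := by field_simp
    refine hM.trans ?_
    rw [intervalIntegral.integral_add (Continuous.intervalIntegrable (by fun_prop) _ _)
      (Continuous.intervalIntegrable (by fun_prop) _ _), intervalIntegral.integral_const_mul,
      intervalIntegral.integral_const_mul]
    have h4 : 1 / (2 * η * ε ^ 2) * ∫ u in (0:ℝ)..1, sE X Y X1 Y1 X2 Y2 u ^ 2 * exp (-sq2 X Y u / 4) * sL X1 Y1 u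
       ≤ 1 / (2 * η * ε ^ 2) * η ^ 2 := by gcongr
    have h5 : η / (2 * ε) * ∫ u in (0:ℝ)..1, exp (-sq2 X Y u / 8) * sL X1 Y1 u ≤ η / (2 * ε) * M := by gcongr
    have h6 : η * ((1 / ε ^ 2 + M / ε) / 2) = 1 / (2 * η * ε ^ 2) * η ^ 2 + η / (2 * ε) * M := by
      field_simp
    linarith

theorem slice_thm (m : ℕ) (hm : 0 < m) {μ : ℝ} (hμ : 0 < μ) (hμ2 : 2 * μ ≤ π) :
    ∃ η > 0, ∀ (X Y X1 Y1 X2 Y2 : ℝ → ℝ) (_ : Slice X Y X1 Y1 X2 Y2)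
      (_ : ∫ u in (0:ℝ)..1, sE X Y X1 Y1 X2 Y2 u ^ 2 * exp (-sq2 X Y u / 4) * sL X1 Y1 u ≤ η ^ 2)
      (_ : ∫ u in (0:ℝ)..1, exp (-sq2 X Y u / 8) * sL X1 Y1 u ≤ √(8 * π) * m)
      (_ : ∫ u in (0:ℝ)..1, exp (-sq2 X Y u / 4) * sL X1 Y1 u ≤ √(4 * π) * m)
      (c v : ℤ → ℝ) (_ : Alt (2 * m + 2) c) (_ : ∀ i, 1 < c i ∧ c i < 3)
      (_ : Zig (2 * m + 2) (sq2 X Y) c v) (φ0 : ℝ)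
      (_ : ∀ φ, |φ - φ0| < μ → ∃ p : ℤ → ℝ, (∀ i, p i < p (i + 1)) ∧
        (∀ i, p (i + (2 * m + 2 : ℕ)) = p i + 1) ∧
        ∀ i, cos φ * X1 (p i) + sin φ * Y1 (p i) = 0), False := by
  obtain ⟨ρ, R, hρ, hρ1, hR, hR3, hbig⟩ := choose_radii m
  set δ := ρ * exp (-(R ^ 2) / 4) / 2 with hδ
  have δpos : 0 < δ := by positivity
  set M := √(8 * π) * m with hM
  have M0 : 0 ≤ M := by positivity
  set ε := δ / 4 with hε
  have εpos : 0 < ε := by positivity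
  set C := (1 / ε ^ 2 + M / ε) / 2 with hC
  have Cpos : 0 < C := by positivity
  set η := min (δ / (1 + 8 * M)) (μ / C) with hη
  have ηpos : 0 < η := by positivity
  have η1 : η * (1 + 8 * M) ≤ δ := by
    rw [← le_div_iff₀ (by positivity)]; exact min_le_left _ _
  have η2 : η * C < 2 * μ := by
    have : η * C ≤ μ := by rw [← le_div_iff₀ (by positivity)]; exact min_le_right _ _
    linarith
  refine ⟨η, ηpos, ?_⟩
  intro X Y X1 Y1 X2 Y2 S h1 h2 h3 c v hA hc hz φ0 H
  by_cases hQ : ∀ u, |sB X Y X1 Y1 u * exp (-sq2 X Y u / 4)| ≤ δ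
  · have := S.caseA (n := 2 * m + 2) (by omega) (by simp [parity_simps]) hρ hρ1 hR hR3 (by
      rw [hδ]; have : 0 < ρ * exp (-(R ^ 2) / 4) := by positivity
      linarith) hQ hA hc hz
    linarith
  · push Not at hQ
    obtain ⟨u0, hu0⟩ := hQ
    have hall : ∀ u, δ / 2 < |sB X Y X1 Y1 u * exp (-sq2 X Y u / 4)| := by
      intro u
      have := S.Q_osc ηpos h1 h2 u u0
      have h4 := abs_sub_abs_le_abs_sub (sB X Y X1 Y1 u0 * exp (-sq2 X Y u0 / 4)) (sB X Y X1 Y1 u * exp (-sq2 X Y u / 4))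
      linarith
    have hexp : ∀ u, ε ≤ exp (-sq2 X Y u / 8) := by
      intro u
      have h4 := hall u
      rw [abs_mul, abs_of_pos (exp_pos _)] at h4
      set x := exp (-sq2 X Y u / 8) with hx
      have hx0 : 0 < x := exp_pos _
      have hx4 : exp (-sq2 X Y u / 4) = x ^ 2 := by
        rw [hx, sq, ← exp_add]; ring_nf
      rw [hx4] at h4
      have hb2 : |sB X Y X1 Y1 u| ^ 2 ≤ sq2 X Y u := by
        rw [sq_abs]; nlinarith [S.ab_sq u, sq_nonneg ((X u * X1 u + Y u * Y1 u) / sL X1 Y1 u)]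
      have e2 : sq2 X Y u / 4 ≤ exp (sq2 X Y u / 4) := by linarith [add_one_le_exp (sq2 X Y u / 4)]
      have e3 : exp (sq2 X Y u / 4) * x ^ 2 = 1 := by
        rw [← hx4, ← exp_add]; ring_nf; simp
      have e5 : (|sB X Y X1 Y1 u| * x) ^ 2 ≤ 2 ^ 2 := by
        rw [mul_pow]
        nlinarith [sq_nonneg x, mul_le_mul_of_nonneg_right hb2 (sq_nonneg x), mul_le_mul_of_nonneg_right e2 (sq_nonneg x)]
      have e6 : |sB X Y X1 Y1 u| * x ≤ 2 := le_of_sq_le_sq e5 (by norm_num)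
      rw [hε]
      nlinarith [mul_le_mul_of_nonneg_right e6 hx0.le]
    have bne : ∀ u, sB X Y X1 Y1 u ≠ 0 := by
      intro u hu
      have := hall u
      rw [hu] at this
      simp at this; linarith
    by_cases hneg : ∀ u, sB X Y X1 Y1 u < 0
    · exact S.caseB_neg (n := 2 * m + 2) (by omega) hneg εpos hexp ηpos hμ hμ2 η2 h1 h2 H
    · push Not at hneg
      obtain ⟨w, hw⟩ := hneg
      have hposb : ∀ u, 0 < sB X Y X1 Y1 u := by
        intro u
        by_contra hcon; push Not at hcon
        obtain ⟨z, hz⟩ := mem_range_of_exists_le_of_exists_ge S.cB ⟨u, hcon⟩ ⟨w, hw⟩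
        exact bne z hz
      have rL : ∀ u, sL X1 (fun u => -Y1 u) u = sL X1 Y1 u := by intro u; simp [sL]
      have rB : ∀ u, sB X (fun u => -Y u) X1 (fun u => -Y1 u) u = - sB X Y X1 Y1 u := by
        intro u; simp only [sB, rL]; ring
      have rE : ∀ u, sE X (fun u => -Y u) X1 (fun u => -Y1 u) X2 (fun u => -Y2 u) u = - sE X Y X1 Y1 X2 Y2 u := by
        intro u; simp only [sE, rL, rB]; ring
      have rq : ∀ u, sq2 X (fun u => -Y u) u = sq2 X Y u := by intro u; simp [sq2]
      refine S.reflect.caseB_neg (n := 2 * m + 2) (φ0 := -φ0) (M := M) (by omega) ?_ εpos ?_ ηpos hμ hμ2 η2 ?_ ?_ ?_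
      · intro u; rw [rB]; linarith [hposb u]
      · intro u; rw [rq]; exact hexp u
      · simp only [rE, rq, rL, neg_sq]; exact h1
      · simp only [rq, rL]; exact h2
      · intro φ hφ
        obtain ⟨p, a1, a2, a3⟩ := H (-φ) (by rw [← abs_neg]; convert hφ using 2; ring)
        refine ⟨p, a1, a2, fun i => ?_⟩
        have := a3 i
        rw [cos_neg, sin_neg] at this
        linarith

end Part6

section Part7

/-- Space derivative. -/
def d1 (F : ℝ → ℝ → ℝ) (u t : ℝ) : ℝ := deriv (fun v => F v t) u

/-- Time derivative. -/
def dt (F : ℝ → ℝ → ℝ) (u t : ℝ) : ℝ := deriv (fun s => F u s) t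

/-- Joint smoothness for negative times. -/
def Sm (F : ℝ → ℝ → ℝ) : Prop :=
  ContDiffOn ℝ (⊤ : ℕ∞) (fun p : ℝ × ℝ => F p.1 p.2) (univ ×ˢ Iio 0)

lemma isOpenU : IsOpen ((univ : Set ℝ) ×ˢ Iio (0:ℝ)) := isOpen_univ.prod isOpen_Iio

lemma memU {t : ℝ} (ht : t < 0) (u : ℝ) : ((u, t) : ℝ × ℝ) ∈ (univ : Set ℝ) ×ˢ Iio (0:ℝ) :=
  ⟨mem_univ _, ht⟩

lemma Sm.diffAt {F : ℝ → ℝ → ℝ} (h : Sm F) {t : ℝ} (ht : t < 0) (u : ℝ) :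
    DifferentiableAt ℝ (fun p : ℝ × ℝ => F p.1 p.2) (u, t) :=
  (h.contDiffAt (isOpenU.mem_nhds (memU ht u))).differentiableAt (by simp)

lemma Sm.hu' {F : ℝ → ℝ → ℝ} (h : Sm F) {t : ℝ} (ht : t < 0) (u : ℝ) :
    HasDerivAt (fun v => F v t) (fderiv ℝ (fun p : ℝ × ℝ => F p.1 p.2) (u, t) (1, 0)) u := by
  have h1 := (h.diffAt ht u).hasFDerivAt
  have h2 : HasDerivAt (fun v : ℝ => ((v, t) : ℝ × ℝ)) (1, 0) u :=
    (hasDerivAt_id u).prodMk (hasDerivAt_const u t)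
  exact h1.comp_hasDerivAt u h2

lemma Sm.ht' {F : ℝ → ℝ → ℝ} (h : Sm F) {t : ℝ} (ht : t < 0) (u : ℝ) :
    HasDerivAt (fun s => F u s) (fderiv ℝ (fun p : ℝ × ℝ => F p.1 p.2) (u, t) (0, 1)) t := by
  have h1 := (h.diffAt ht u).hasFDerivAt
  have h2 : HasDerivAt (fun s : ℝ => ((u, s) : ℝ × ℝ)) (0, 1) t :=
    (hasDerivAt_const t u).prodMk (hasDerivAt_id t)
  exact h1.comp_hasDerivAt t h2

lemma Sm.hu {F : ℝ → ℝ → ℝ} (h : Sm F) {t : ℝ} (ht : t < 0) (u : ℝ) :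
    HasDerivAt (fun v => F v t) (d1 F u t) u := (h.hu' ht u).differentiableAt.hasDerivAt

lemma Sm.ht {F : ℝ → ℝ → ℝ} (h : Sm F) {t : ℝ} (ht : t < 0) (u : ℝ) :
    HasDerivAt (fun s => F u s) (dt F u t) t := (h.ht' ht u).differentiableAt.hasDerivAt

lemma Sm.d1_eq {F : ℝ → ℝ → ℝ} (h : Sm F) {t : ℝ} (ht : t < 0) (u : ℝ) :
    d1 F u t = fderiv ℝ (fun p : ℝ × ℝ => F p.1 p.2) (u, t) (1, 0) := (h.hu' ht u).deriv

lemma Sm.dt_eq {F : ℝ → ℝ → ℝ} (h : Sm F) {t : ℝ} (ht : t < 0) (u : ℝ) :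
    dt F u t = fderiv ℝ (fun p : ℝ × ℝ => F p.1 p.2) (u, t) (0, 1) := (h.ht' ht u).deriv

lemma Sm.fd {F : ℝ → ℝ → ℝ} (h : Sm F) :
    ContDiffOn ℝ (⊤ : ℕ∞) (fderiv ℝ (fun p : ℝ × ℝ => F p.1 p.2)) (univ ×ˢ Iio 0) :=
  h.fderiv_of_isOpen isOpenU (by simp)

lemma Sm.d1 {F : ℝ → ℝ → ℝ} (h : Sm F) : Sm (d1 F) := by
  refine (h.fd.clm_apply (contDiffOn_const (c := ((1, 0) : ℝ × ℝ)))).congr ?_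
  rintro ⟨u, t⟩ ⟨-, ht⟩
  exact h.d1_eq ht u

lemma Sm.dt {F : ℝ → ℝ → ℝ} (h : Sm F) : Sm (dt F) := by
  refine (h.fd.clm_apply (contDiffOn_const (c := ((0, 1) : ℝ × ℝ)))).congr ?_
  rintro ⟨u, t⟩ ⟨-, ht⟩
  exact h.dt_eq ht u

lemma Sm.comm {F : ℝ → ℝ → ℝ} (h : Sm F) {t : ℝ} (ht : t < 0) (u : ℝ) :
    _root_.dt (_root_.d1 F) u t = _root_.d1 (_root_.dt F) u t := by
  have hU := isOpenU.mem_nhds (memU ht u)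
  have hsym : IsSymmSndFDerivAt ℝ (fun p : ℝ × ℝ => F p.1 p.2) (u, t) :=
    (h.contDiffAt hU).isSymmSndFDerivAt (by simpa using WithTop.coe_le_coe.2 (le_top : (2:ℕ∞) ≤ ⊤))
  have hd : DifferentiableAt ℝ (fderiv ℝ (fun p : ℝ × ℝ => F p.1 p.2)) (u, t) :=
    (h.fd.contDiffAt hU).differentiableAt (by simp)
  have e1 : (fun p : ℝ × ℝ => _root_.d1 F p.1 p.2) =ᶠ[nhds (u, t)]
      fun p => fderiv ℝ (fun p : ℝ × ℝ => F p.1 p.2) p (1, 0) := by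
    filter_upwards [hU] with p hp
    exact h.d1_eq hp.2 p.1
  have e2 : (fun p : ℝ × ℝ => _root_.dt F p.1 p.2) =ᶠ[nhds (u, t)]
      fun p => fderiv ℝ (fun p : ℝ × ℝ => F p.1 p.2) p (0, 1) := by
    filter_upwards [hU] with p hp
    exact h.dt_eq hp.2 p.1
  have key : ∀ a b : ℝ × ℝ,
      fderiv ℝ (fun p => fderiv ℝ (fun p : ℝ × ℝ => F p.1 p.2) p a) (u, t) b
        = fderiv ℝ (fderiv ℝ (fun p : ℝ × ℝ => F p.1 p.2)) (u, t) b a := by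
    intro a b
    rw [fderiv_clm_apply hd (differentiableAt_const a)]
    simp
  rw [h.d1.dt_eq ht, h.dt.d1_eq ht, e1.fderiv_eq, e2.fderiv_eq, key, key]
  exact hsym.eq _ _

lemma Sm.cont {F : ℝ → ℝ → ℝ} (h : Sm F) {t : ℝ} (ht : t < 0) : Continuous (fun u => F u t) :=
  continuous_iff_continuousAt.2 fun u => (h.hu ht u).continuousAt

/-- Differentiation under the integral sign. -/
lemma Sm.hasDerivAt_integral {F : ℝ → ℝ → ℝ} (h : Sm F) {t : ℝ} (ht : t < 0) :
    HasDerivAt (fun s => ∫ u in (0:ℝ)..1, F u s) (∫ u in (0:ℝ)..1, _root_.dt F u t) t := by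
  obtain ⟨C, hC⟩ : ∃ C, ∀ p ∈ Icc (0:ℝ) 1 ×ˢ Icc (2 * t) (t / 2), ‖_root_.dt F p.1 p.2‖ ≤ C := by
    refine (isCompact_Icc.prod isCompact_Icc).exists_bound_of_continuousOn
      (f := fun p : ℝ × ℝ => _root_.dt F p.1 p.2) ?_
    refine h.dt.continuousOn.mono ?_
    rintro ⟨u, s⟩ ⟨-, hs⟩
    exact memU (by have := hs.2; dsimp at this; linarith) u
  have hnb : Ioo (2 * t) (t / 2) ∈ nhds t := Ioo_mem_nhds (by linarith) (by linarith)
  refine (intervalIntegral.hasDerivAt_integral_of_dominated_loc_of_deriv_le (μ := volume)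
    (F := fun s u => F u s) (F' := fun s u => _root_.dt F u s) (bound := fun _ => C) hnb
    ?_ ?_ ?_ ?_ ?_ ?_).2
  · filter_upwards [Iio_mem_nhds ht] with s hs
    exact (h.cont hs).aestronglyMeasurable
  · exact (h.cont ht).intervalIntegrable _ _
  · exact (h.dt.cont ht).aestronglyMeasurable
  · refine ae_of_all _ fun u hu s hs => hC (u, s) ⟨?_, hs.1.le, hs.2.le⟩
    rw [uIoc_of_le zero_le_one] at hu
    exact ⟨hu.1.le, hu.2⟩
  · simp
  · refine ae_of_all _ fun u hu s hs => h.ht (by have := hs.2; linarith) u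

/-- Curve shortening flow in coordinates. -/
structure PFlow (X Y : ℝ → ℝ → ℝ) : Prop where
  sX : ContDiffOn ℝ (⊤ : ℕ∞) (fun p : ℝ × ℝ => X p.1 p.2) (univ ×ˢ Iic 0)
  sY : ContDiffOn ℝ (⊤ : ℕ∞) (fun p : ℝ × ℝ => Y p.1 p.2) (univ ×ˢ Iic 0)
  reg : ∀ u t, t ≤ 0 → 0 < d1 X u t ^ 2 + d1 Y u t ^ 2
  eqX : ∀ u t, t < 0 → dt X u t = (d1 X u t ^ 2 + d1 Y u t ^ 2)⁻¹ * d1 (d1 X) u t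
    - (d1 X u t * d1 (d1 X) u t + d1 Y u t * d1 (d1 Y) u t)
      * ((d1 X u t ^ 2 + d1 Y u t ^ 2)⁻¹) ^ 2 * d1 X u t
  eqY : ∀ u t, t < 0 → dt Y u t = (d1 X u t ^ 2 + d1 Y u t ^ 2)⁻¹ * d1 (d1 Y) u t
    - (d1 X u t * d1 (d1 X) u t + d1 Y u t * d1 (d1 Y) u t)
      * ((d1 X u t ^ 2 + d1 Y u t ^ 2)⁻¹) ^ 2 * d1 Y u t
  perX : ∀ u t, X (u + 1) t = X u t
  perY : ∀ u t, Y (u + 1) t = Y u t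
  inj : ∀ t ≤ 0, InjOn (fun u => (X u t, Y u t)) (Ico 0 1)

lemma slice_contDiff {X : ℝ → ℝ → ℝ}
    (h : ContDiffOn ℝ (⊤ : ℕ∞) (fun p : ℝ × ℝ => X p.1 p.2) (univ ×ˢ Iic 0)) {t : ℝ} (ht : t ≤ 0) :
    ContDiff ℝ (⊤ : ℕ∞) (fun u => X u t) := by
  rw [← contDiffOn_univ]
  refine h.comp (t := univ ×ˢ Iic 0) (g := fun p : ℝ × ℝ => X p.1 p.2)
    (f := fun u : ℝ => ((u, t) : ℝ × ℝ)) ?_ ?_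
  · exact (contDiff_id.prodMk contDiff_const).contDiffOn
  · intro u _
    exact ⟨mem_univ _, ht⟩

lemma slice_d {X : ℝ → ℝ → ℝ} {t : ℝ} (h : ContDiff ℝ (⊤ : ℕ∞) (fun u => X u t)) :
    (∀ u, HasDerivAt (fun v => X v t) (d1 X u t) u) ∧ ContDiff ℝ (⊤ : ℕ∞) (fun u => d1 X u t) := by
  refine ⟨fun u => (h.differentiable (by simp) u).hasDerivAt, ?_⟩
  exact (contDiff_infty_iff_deriv.1 h).2

lemma PFlow.slice {X Y : ℝ → ℝ → ℝ} (F : PFlow X Y) {t : ℝ} (ht : t ≤ 0) :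
    Slice (fun u => X u t) (fun u => Y u t) (fun u => d1 X u t) (fun u => d1 Y u t)
      (fun u => d1 (d1 X) u t) (fun u => d1 (d1 Y) u t) := by
  have hX := slice_d (slice_contDiff F.sX ht)
  have hY := slice_d (slice_contDiff F.sY ht)
  have hX1 := slice_d hX.2
  have hY1 := slice_d hY.2
  exact ⟨hX.1, hY.1, hX1.1, hY1.1, hX1.2.continuous, hY1.2.continuous, fun u => F.reg u t ht,
    fun u => F.perX u t, fun u => F.perY u t, F.inj t ht⟩

lemma PFlow.smX {X Y : ℝ → ℝ → ℝ} (F : PFlow X Y) : Sm X :=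
  F.sX.mono (prod_mono_right Iio_subset_Iic_self)

lemma PFlow.smY {X Y : ℝ → ℝ → ℝ} (F : PFlow X Y) : Sm Y :=
  F.sY.mono (prod_mono_right Iio_subset_Iic_self)

lemma Slice.scale {X Y X1 Y1 X2 Y2 : ℝ → ℝ} (S : Slice X Y X1 Y1 X2 Y2) (x0 y0 : ℝ) {σ : ℝ}
    (hσ : 0 < σ) : Slice (fun u => (X u - x0) / σ) (fun u => (Y u - y0) / σ)
      (fun u => X1 u / σ) (fun u => Y1 u / σ) (fun u => X2 u / σ) (fun u => Y2 u / σ) := by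
  refine ⟨fun u => ((S.hX u).sub_const x0).div_const σ, fun u => ((S.hY u).sub_const y0).div_const σ,
    fun u => (S.hX1 u).div_const σ, fun u => (S.hY1 u).div_const σ, S.cX2.div_const σ,
    S.cY2.div_const σ, ?_, ?_, ?_, ?_⟩
  · intro u
    have := S.reg u
    have e : (X1 u / σ) ^ 2 + (Y1 u / σ) ^ 2 = (X1 u ^ 2 + Y1 u ^ 2) / σ ^ 2 := by ring
    rw [e]; positivity
  · intro u; simp only [S.perX]
  · intro u; simp only [S.perY]
  · intro a ha b hb hab
    simp only [Prod.mk.injEq] at hab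
    rw [div_left_inj' hσ.ne', div_left_inj' hσ.ne'] at hab
    refine S.inj ha hb ?_
    simp only [Prod.mk.injEq]
    exact ⟨by linarith [hab.1], by linarith [hab.2]⟩

/-- Second derivative test, necessary conditions. -/
lemma max_second {f f1 : ℝ → ℝ} {f2 u : ℝ} (hf : ∀ v, HasDerivAt f (f1 v) v)
    (hf1 : HasDerivAt f1 f2 u) (hm : IsLocalMax f u) : f1 u = 0 ∧ f2 ≤ 0 := by
  have h1 : f1 u = 0 := by rw [← (hf u).deriv]; exact hm.deriv_eq_zero
  refine ⟨h1, ?_⟩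
  by_contra hpos
  push Not at hpos
  have hdf : deriv f = f1 := funext fun v => (hf v).deriv
  -- strictly increasing first derivative near u
  have hs : ∀ᶠ v in nhdsWithin u (Ioi u), 0 < f1 v := by
    have := hasDerivAt_iff_tendsto_slope.1 hf1
    have h3 := this.eventually (lt_mem_nhds hpos)
    have h4 : nhdsWithin u (Ioi u) ≤ nhdsWithin u {u}ᶜ :=
      nhdsWithin_mono _ fun v hv => by simpa using ne_of_gt hv
    filter_upwards [h4 h3, self_mem_nhdsWithin] with v hv hv2
    rw [slope_def_field, h1, sub_zero] at hv
    have : 0 < v - u := sub_pos.2 hv2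
    exact (div_pos_iff_of_pos_right this).1 hv
  obtain ⟨b, hb, hb2⟩ := mem_nhdsGT_iff_exists_Ioo_subset.1 hs
  have hmono : StrictMonoOn f (Ico u b) := by
    refine strictMonoOn_of_deriv_pos (convex_Ico u b)
      (fun v _ => (hf v).continuousAt.continuousWithinAt) ?_
    intro v hv
    rw [interior_Ico] at hv
    rw [hdf]; exact hb2 hv
  have hev : ∀ᶠ v in nhdsWithin u (Ioi u), f v ≤ f u := hm.filter_mono nhdsWithin_le_nhds
  obtain ⟨v, hv1, hv2⟩ := (hev.and (Ioo_mem_nhdsGT hb)).exists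
  have := hmono ⟨le_rfl, hb⟩ ⟨hv2.1.le, hv2.2⟩ hv2.1
  linarith

lemma cal_of {f f1 f2 ft A B : ℝ → ℝ → ℝ}
    (h1 : ∀ u t, t < 0 → HasDerivAt (fun v => f v t) (f1 u t) u)
    (h2 : ∀ u t, t < 0 → HasDerivAt (fun v => f1 v t) (f2 u t) u)
    (h3 : ∀ u t, t < 0 → HasDerivAt (fun s => f u s) (ft u t) t)
    (hA : ∀ u t, t < 0 → 0 ≤ A u t)
    (he : ∀ u t, t < 0 → ft u t = A u t * f2 u t + B u t * f1 u t) : Cal f := by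
  intro u t ht
  refine ⟨ft u t, h3 u t ht, ?_, ?_⟩
  · intro hm
    obtain ⟨e1, e2⟩ := max_second (fun v => h1 v t ht) (h2 u t ht) hm
    rw [he u t ht, e1, mul_zero, add_zero]
    exact mul_nonpos_of_nonneg_of_nonpos (hA u t ht) e2
  · intro hm
    obtain ⟨e1, e2⟩ := max_second (f := fun v => - f v t) (f1 := fun v => - f1 v t)
      (fun v => (h1 v t ht).neg) (h2 u t ht).neg hm.neg
    have e1' : f1 u t = 0 := by linarith
    rw [he u t ht, e1', mul_zero, add_zero]
    exact mul_nonneg (hA u t ht) (by linarith)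

lemma PFlow.cal_linear {X Y : ℝ → ℝ → ℝ} (F : PFlow X Y) (a b : ℝ) :
    Cal (fun u t => a * X u t + b * Y u t) := by
  refine cal_of (f1 := fun u t => a * d1 X u t + b * d1 Y u t)
    (f2 := fun u t => a * d1 (d1 X) u t + b * d1 (d1 Y) u t)
    (ft := fun u t => a * dt X u t + b * dt Y u t)
    (A := fun u t => (d1 X u t ^ 2 + d1 Y u t ^ 2)⁻¹)
    (B := fun u t => - ((d1 X u t * d1 (d1 X) u t + d1 Y u t * d1 (d1 Y) u t)
      * ((d1 X u t ^ 2 + d1 Y u t ^ 2)⁻¹) ^ 2)) ?_ ?_ ?_ ?_ ?_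
  · intro u t ht
    exact ((F.smX.hu ht u).const_mul a).add ((F.smY.hu ht u).const_mul b)
  · intro u t ht
    exact ((F.smX.d1.hu ht u).const_mul a).add ((F.smY.d1.hu ht u).const_mul b)
  · intro u t ht
    exact ((F.smX.ht ht u).const_mul a).add ((F.smY.ht ht u).const_mul b)
  · intro u t ht
    have := F.reg u t ht.le
    positivity
  · intro u t ht
    try dsimp only
    rw [F.eqX u t ht, F.eqY u t ht]
    ring

lemma PFlow.cal_quad {X Y : ℝ → ℝ → ℝ} (F : PFlow X Y) (a b : ℝ) :
    Cal (fun u t => (X u t - a) ^ 2 + (Y u t - b) ^ 2 + 2 * t) := by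
  refine cal_of (f1 := fun u t => 2 * (X u t - a) * d1 X u t + 2 * (Y u t - b) * d1 Y u t)
    (f2 := fun u t => 2 * (d1 X u t * d1 X u t + (X u t - a) * d1 (d1 X) u t)
      + 2 * (d1 Y u t * d1 Y u t + (Y u t - b) * d1 (d1 Y) u t))
    (ft := fun u t => 2 * (X u t - a) * dt X u t + 2 * (Y u t - b) * dt Y u t + 2)
    (A := fun u t => (d1 X u t ^ 2 + d1 Y u t ^ 2)⁻¹)
    (B := fun u t => - ((d1 X u t * d1 (d1 X) u t + d1 Y u t * d1 (d1 Y) u t)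
      * ((d1 X u t ^ 2 + d1 Y u t ^ 2)⁻¹) ^ 2)) ?_ ?_ ?_ ?_ ?_
  · intro u t ht
    have h := ((((F.smX.hu ht u).sub_const a).pow 2).add (((F.smY.hu ht u).sub_const b).pow 2)).add_const
      (2 * t)
    refine h.congr_deriv ?_
    simp; try ring
  · intro u t ht
    have h := ((((F.smX.hu ht u).sub_const a).const_mul 2).mul (F.smX.d1.hu ht u)).add
      ((((F.smY.hu ht u).sub_const b).const_mul 2).mul (F.smY.d1.hu ht u))
    refine h.congr_deriv ?_
    ring
  · intro u t ht
    have h := ((((F.smX.ht ht u).sub_const a).pow 2).add (((F.smY.ht ht u).sub_const b).pow 2)).add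
      ((hasDerivAt_id t).const_mul 2)
    refine h.congr_deriv ?_
    simp; try ring
  · intro u t ht
    have := F.reg u t ht.le
    positivity
  · intro u t ht
    try dsimp only
    rw [F.eqX u t ht, F.eqY u t ht]
    have := (F.reg u t ht.le).ne'
    have e : (d1 X u t ^ 2 + d1 Y u t ^ 2)⁻¹ * (d1 X u t ^ 2 + d1 Y u t ^ 2) = 1 :=
      inv_mul_cancel₀ this
    linear_combination (-2) * e

lemma PFlow.cont_quad {X Y : ℝ → ℝ → ℝ} (F : PFlow X Y) (a b : ℝ) :
    ContinuousOn (fun p : ℝ × ℝ => (X p.1 p.2 - a) ^ 2 + (Y p.1 p.2 - b) ^ 2 + 2 * p.2)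
      (univ ×ˢ Iic 0) := by
  have h1 := F.sX.continuousOn
  have h2 := F.sY.continuousOn
  exact (((h1.sub continuousOn_const).pow 2).add ((h2.sub continuousOn_const).pow 2)).add
    (continuous_snd.const_mul 2).continuousOn

lemma PFlow.cont_linear {X Y : ℝ → ℝ → ℝ} (F : PFlow X Y) (a b : ℝ) :
    ContinuousOn (fun p : ℝ × ℝ => a * X p.1 p.2 + b * Y p.1 p.2) (univ ×ˢ Iic 0) :=
  (continuousOn_const.mul F.sX.continuousOn).add (continuousOn_const.mul F.sY.continuousOn)

end Part7

section Part8

lemma huisken_alg {x y p r p2 r2 L μ : ℝ} (hL : 0 < L) (hL2 : L ^ 2 = p ^ 2 + r ^ 2) :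
    L * (-(μ / 4) * (2 * (x * (-(r * (p * r2 - r * p2)) / L ^ 4)
        + y * (p * (p * r2 - r * p2) / L ^ 4))) - (x ^ 2 + y ^ 2) * μ ^ 2 / 4 + μ / 2)
      - (p * r2 - r * p2) ^ 2 / L ^ 5
    = - (L * ((p * r2 - r * p2) / L ^ 3 + μ * ((y * p - x * r) / L) / 2) ^ 2)
      + μ / 2 * (-(μ * (x * p + y * r) ^ 2 / L / 2)
        + ((L ^ 2 + x * p2 + y * r2) / L - (x * p + y * r) * (p * p2 + r * r2) / L ^ 3)) := by
  have h1 : (x ^ 2 + y ^ 2) * L ^ 2 = (y * p - x * r) ^ 2 + (x * p + y * r) ^ 2 := by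
    rw [hL2]; ring
  have h2 : (x * p2 + y * r2) * L ^ 2
      = (x * p + y * r) * (p * p2 + r * r2) + (p * r2 - r * p2) * (y * p - x * r) := by
    rw [hL2]; ring
  generalize hk : p * r2 - r * p2 = k at *
  generalize hA : x * p + y * r = A at *
  generalize hB : y * p - x * r = B at *
  generalize hC : p * p2 + r * r2 = C at *
  have e1 : x * (-(r * k) / L ^ 4) + y * (p * k / L ^ 4) = k * B / L ^ 4 := by
    rw [← hB]; ring
  have e2 : x ^ 2 + y ^ 2 = (B ^ 2 + A ^ 2) / L ^ 2 := by
    rw [← h1]; field_simp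
  have e3 : (L ^ 2 + x * p2 + y * r2) = L ^ 2 + (A * C + k * B) / L ^ 2 := by
    rw [← h2]; field_simp; ring
  rw [e1, e2, e3]
  field_simp
  ring

section
variable (X Y : ℝ → ℝ → ℝ) (x0 y0 : ℝ)

/-- Speed. -/
def ell (u t : ℝ) : ℝ := √(d1 X u t ^ 2 + d1 Y u t ^ 2)

/-- Squared distance to the center. -/
def qq (u t : ℝ) : ℝ := (X u t - x0) ^ 2 + (Y u t - y0) ^ 2

/-- Gaussian density. -/
def gH (u s : ℝ) : ℝ := exp (qq X Y x0 y0 u s / (4 * s)) * ell X Y u s * (√(-s))⁻¹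

/-- Huisken defect density. -/
def wH (u s : ℝ) : ℝ :=
  exp (qq X Y x0 y0 u s / (4 * s)) * (√(-s))⁻¹ * (ell X Y u s *
    ((d1 X u s * d1 (d1 Y) u s - d1 Y u s * d1 (d1 X) u s) / ell X Y u s ^ 3
      + (-s)⁻¹ * (((Y u s - y0) * d1 X u s - (X u s - x0) * d1 Y u s) / ell X Y u s) / 2) ^ 2)

/-- Flux. -/
def hH (u s : ℝ) : ℝ :=
  exp (qq X Y x0 y0 u s / (4 * s)) * (√(-s))⁻¹ * ((-s)⁻¹ / 2 *
    (((X u s - x0) * d1 X u s + (Y u s - y0) * d1 Y u s) / ell X Y u s))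
end

variable {X Y : ℝ → ℝ → ℝ}

lemma PFlow.ell_pos (F : PFlow X Y) {t : ℝ} (ht : t ≤ 0) (u : ℝ) : 0 < ell X Y u t :=
  Real.sqrt_pos.2 (F.reg u t ht)

lemma PFlow.ell_sq (F : PFlow X Y) {t : ℝ} (ht : t ≤ 0) (u : ℝ) :
    ell X Y u t ^ 2 = d1 X u t ^ 2 + d1 Y u t ^ 2 := Real.sq_sqrt (F.reg u t ht).le

lemma PFlow.sm_ell (F : PFlow X Y) : Sm (ell X Y) := by
  refine ContDiffOn.sqrt ((ContDiffOn.pow F.smX.d1 2).add (ContDiffOn.pow F.smY.d1 2)) ?_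
  rintro ⟨u, t⟩ ⟨-, ht⟩
  exact (F.reg u t (le_of_lt ht)).ne'

lemma PFlow.sm_qq (F : PFlow X Y) (x0 y0 : ℝ) : Sm (qq X Y x0 y0) :=
  ((ContDiffOn.sub F.smX contDiffOn_const).pow 2).add
    ((ContDiffOn.sub F.smY contDiffOn_const).pow 2)

lemma PFlow.sm_gH (F : PFlow X Y) (x0 y0 : ℝ) : Sm (gH X Y x0 y0) := by
  have hs : ContDiffOn ℝ (⊤ : ℕ∞) (fun p : ℝ × ℝ => p.2) (univ ×ˢ Iio 0) :=
    contDiff_snd.contDiffOn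
  refine ContDiffOn.mul (ContDiffOn.mul (ContDiffOn.exp (ContDiffOn.div (F.sm_qq x0 y0)
    (contDiffOn_const.mul hs) ?_)) F.sm_ell) (ContDiffOn.inv (ContDiffOn.sqrt hs.neg ?_) ?_)
  · rintro ⟨u, t⟩ ⟨-, ht⟩
    have : t < 0 := ht
    simp [this.ne]
  · rintro ⟨u, t⟩ ⟨-, ht⟩
    have : t < 0 := ht
    simp [this.ne]
  · rintro ⟨u, t⟩ ⟨-, ht⟩
    have : t < 0 := ht
    exact (Real.sqrt_pos.2 (by simpa using this)).ne'

lemma PFlow.vel (F : PFlow X Y) {t : ℝ} (ht : t < 0) (u : ℝ) :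
    dt X u t = -(d1 Y u t * (d1 X u t * d1 (d1 Y) u t - d1 Y u t * d1 (d1 X) u t))
        / ell X Y u t ^ 4 ∧
    dt Y u t = d1 X u t * (d1 X u t * d1 (d1 Y) u t - d1 Y u t * d1 (d1 X) u t)
        / ell X Y u t ^ 4 := by
  have h := F.reg u t ht.le
  have e : ell X Y u t ^ 4 = (d1 X u t ^ 2 + d1 Y u t ^ 2) ^ 2 := by
    rw [← F.ell_sq ht.le u]; ring
  rw [F.eqX u t ht, F.eqY u t ht, e]
  constructor
  · field_simp; ring
  · field_simp; ring

lemma PFlow.ell_t (F : PFlow X Y) {t : ℝ} (ht : t < 0) (u : ℝ) :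
    HasDerivAt (fun s => ell X Y u s)
      (-((d1 X u t * d1 (d1 Y) u t - d1 Y u t * d1 (d1 X) u t) ^ 2 / ell X Y u t ^ 5)) t := by
  have hp := F.reg u t ht.le
  have h1 := (((F.smX.d1.ht ht u).pow 2).add ((F.smY.d1.ht ht u).pow 2)).sqrt hp.ne'
  refine h1.congr_deriv ?_
  -- orthogonality
  have ho : ∀ v, d1 X v t * dt X v t + d1 Y v t * dt Y v t = 0 := by
    intro v
    rw [(F.vel ht v).1, (F.vel ht v).2]; ring
  have h2 := ((F.smX.d1.hu ht u).mul (F.smX.dt.hu ht u)).add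
    ((F.smY.d1.hu ht u).mul (F.smY.dt.hu ht u))
  have h3 : HasDerivAt (fun v => d1 X v t * dt X v t + d1 Y v t * dt Y v t) 0 u := by
    have : (fun v => d1 X v t * dt X v t + d1 Y v t * dt Y v t) = fun _ => 0 := funext ho
    rw [this]; exact hasDerivAt_const u 0
  have h4 := h2.unique h3
  rw [F.smX.comm ht u, F.smY.comm ht u]
  have hl := F.ell_pos ht.le u
  have hv := F.vel ht u
  rw [hv.1, hv.2] at h4
  have e : √((((fun x ↦ d1 X u x) ^ 2 + (fun x ↦ d1 Y u x) ^ 2) : ℝ → ℝ) t) = ell X Y u t := rfl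
  simp only [Nat.cast_ofNat, Nat.add_one_sub_one, pow_one, Pi.add_apply, Pi.pow_apply] at *
  change _ / (2 * ell X Y u t) = _
  have h5 : d1 X u t * d1 (dt X) u t + d1 Y u t * d1 (dt Y) u t
      = -((d1 X u t * d1 (d1 Y) u t - d1 Y u t * d1 (d1 X) u t) ^ 2 / ell X Y u t ^ 4) := by
    linear_combination h4
  rw [show (2 * d1 X u t * d1 (dt X) u t + 2 * d1 Y u t * d1 (dt Y) u t)
    = 2 * (d1 X u t * d1 (dt X) u t + d1 Y u t * d1 (dt Y) u t) by ring, h5]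
  field_simp

lemma PFlow.qq_t (F : PFlow X Y) (x0 y0 : ℝ) {t : ℝ} (ht : t < 0) (u : ℝ) :
    HasDerivAt (fun s => qq X Y x0 y0 u s)
      (2 * ((X u t - x0) * dt X u t + (Y u t - y0) * dt Y u t)) t := by
  have h1 := (((F.smX.ht ht u).sub_const x0).pow 2).add (((F.smY.ht ht u).sub_const y0).pow 2)
  refine h1.congr_deriv ?_
  simp; ring

lemma PFlow.qq_u (F : PFlow X Y) (x0 y0 : ℝ) {t : ℝ} (ht : t < 0) (u : ℝ) :
    HasDerivAt (fun v => qq X Y x0 y0 v t)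
      (2 * ((X u t - x0) * d1 X u t + (Y u t - y0) * d1 Y u t)) u := by
  have h1 := (((F.smX.hu ht u).sub_const x0).pow 2).add (((F.smY.hu ht u).sub_const y0).pow 2)
  refine h1.congr_deriv ?_
  simp; ring

lemma PFlow.ell_u (F : PFlow X Y) {t : ℝ} (ht : t < 0) (u : ℝ) :
    HasDerivAt (fun v => ell X Y v t)
      ((d1 X u t * d1 (d1 X) u t + d1 Y u t * d1 (d1 Y) u t) / ell X Y u t) u := by
  have hp := F.reg u t ht.le
  have h1 := (((F.smX.d1.hu ht u).pow 2).add ((F.smY.d1.hu ht u).pow 2)).sqrt hp.ne'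
  refine h1.congr_deriv ?_
  simp only [Nat.cast_ofNat, Nat.add_one_sub_one, pow_one, Pi.add_apply, Pi.pow_apply] at *
  change _ / (2 * ell X Y u t) = _
  have hl := F.ell_pos ht.le u
  field_simp

lemma PFlow.gH_t (F : PFlow X Y) (x0 y0 : ℝ) {s : ℝ} (hs : s < 0) (u : ℝ) :
    HasDerivAt (fun t => gH X Y x0 y0 u t)
      (exp (qq X Y x0 y0 u s / (4 * s)) * (√(-s))⁻¹ * (
        ell X Y u s * (-((-s)⁻¹ / 4) * (2 * ((X u s - x0) * dt X u s + (Y u s - y0) * dt Y u s))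
          - qq X Y x0 y0 u s * (-s)⁻¹ ^ 2 / 4 + (-s)⁻¹ / 2)
        - (d1 X u s * d1 (d1 Y) u s - d1 Y u s * d1 (d1 X) u s) ^ 2 / ell X Y u s ^ 5)) s := by
  have hs4 : 4 * s ≠ 0 := by linarith
  have hr : 0 < √(-s) := Real.sqrt_pos.2 (by linarith)
  have hr2 : √(-s) ^ 2 = -s := Real.sq_sqrt (by linarith)
  have hE := ((F.qq_t x0 y0 hs u).div ((hasDerivAt_id s).const_mul 4) hs4).exp
  have hR := ((hasDerivAt_id s).neg.sqrt (by simpa using hs.ne)).inv hr.ne'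
  have h := (hE.mul (F.ell_t hs u)).mul hR
  refine h.congr_deriv ?_
  simp only [id, Pi.neg_apply, Pi.mul_apply, Pi.div_apply, Pi.inv_apply]
  generalize exp (qq X Y x0 y0 u s / (4 * s)) = E
  generalize (X u s - x0) * dt X u s + (Y u s - y0) * dt Y u s = V
  generalize qq X Y x0 y0 u s = q
  generalize (d1 X u s * d1 (d1 Y) u s - d1 Y u s * d1 (d1 X) u s) ^ 2 / ell X Y u s ^ 5 = K
  generalize ell X Y u s = L
  have hs' : s = - √(-s) ^ 2 := by linarith
  generalize hR : √(-s) = R at *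
  subst hs'
  field_simp
  ring

lemma PFlow.hH_u (F : PFlow X Y) (x0 y0 : ℝ) {s : ℝ} (hs : s < 0) (u : ℝ) :
    HasDerivAt (fun v => hH X Y x0 y0 v s)
      (exp (qq X Y x0 y0 u s / (4 * s)) * (√(-s))⁻¹ * ((-s)⁻¹ / 2 *
        (-((-s)⁻¹ * ((X u s - x0) * d1 X u s + (Y u s - y0) * d1 Y u s) ^ 2 / ell X Y u s / 2)
        + ((ell X Y u s ^ 2 + (X u s - x0) * d1 (d1 X) u s + (Y u s - y0) * d1 (d1 Y) u s)
            / ell X Y u s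
          - ((X u s - x0) * d1 X u s + (Y u s - y0) * d1 Y u s)
            * (d1 X u s * d1 (d1 X) u s + d1 Y u s * d1 (d1 Y) u s) / ell X Y u s ^ 3)))) u := by
  have hl := F.ell_pos hs.le u
  have hA := (((F.smX.hu hs u).sub_const x0).mul (F.smX.d1.hu hs u)).add
    (((F.smY.hu hs u).sub_const y0).mul (F.smY.d1.hu hs u))
  have hE := (((F.qq_u x0 y0 hs u).div_const (4 * s)).exp).mul_const (√(-s))⁻¹
  have h := hE.mul ((hA.div (F.ell_u hs u) hl.ne').const_mul ((-s)⁻¹ / 2))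
  refine h.congr_deriv ?_
  simp only [Pi.add_apply, Pi.mul_apply, Pi.div_apply]
  have e : d1 X u s * d1 X u s + d1 Y u s * d1 Y u s = ell X Y u s ^ 2 := by
    rw [F.ell_sq hs.le]; ring
  have e' : d1 X u s * d1 X u s + (X u s - x0) * d1 (d1 X) u s
      + (d1 Y u s * d1 Y u s + (Y u s - y0) * d1 (d1 Y) u s)
      = ell X Y u s ^ 2 + (X u s - x0) * d1 (d1 X) u s + (Y u s - y0) * d1 (d1 Y) u s := by
    linear_combination e
  rw [e']
  have hs' := hs.ne
  field_simp
  ring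

lemma PFlow.huisken_pt (F : PFlow X Y) (x0 y0 : ℝ) {s : ℝ} (hs : s < 0) (u : ℝ) :
    dt (gH X Y x0 y0) u s = - wH X Y x0 y0 u s + d1 (hH X Y x0 y0) u s := by
  have hl := F.ell_pos hs.le u
  have h := huisken_alg (x := X u s - x0) (y := Y u s - y0) (p2 := d1 (d1 X) u s)
    (r2 := d1 (d1 Y) u s) (μ := (-s)⁻¹) hl (F.ell_sq hs.le u)
  have e1 : dt (gH X Y x0 y0) u s = _ := (F.gH_t x0 y0 hs u).deriv
  have e2 : d1 (hH X Y x0 y0) u s = _ := (F.hH_u x0 y0 hs u).deriv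
  rw [e1, e2, (F.vel hs u).1, (F.vel hs u).2, wH, qq, h]
  ring

lemma PFlow.d1_per (F : PFlow X Y) (u t : ℝ) :
    d1 X (u + 1) t = d1 X u t ∧ d1 Y (u + 1) t = d1 Y u t := by
  constructor
  · rw [d1, d1, ← deriv_comp_add_const]; simp only [F.perX]
  · rw [d1, d1, ← deriv_comp_add_const]; simp only [F.perY]

lemma PFlow.huisken (F : PFlow X Y) (x0 y0 : ℝ) {s : ℝ} (hs : s < 0) :
    HasDerivAt (fun t => ∫ u in (0:ℝ)..1, gH X Y x0 y0 u t)
      (- ∫ u in (0:ℝ)..1, wH X Y x0 y0 u s) s := by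
  refine (F.sm_gH x0 y0).hasDerivAt_integral hs |>.congr_deriv ?_
  have hc := (F.sm_gH x0 y0).dt.cont hs
  have cX := F.smX.cont hs
  have cY := F.smY.cont hs
  have cX1 := F.smX.d1.cont hs
  have cY1 := F.smY.d1.cont hs
  have cX2 := F.smX.d1.d1.cont hs
  have cY2 := F.smY.d1.d1.cont hs
  have cl := F.sm_ell.cont hs
  have cq := (F.sm_qq x0 y0).cont hs
  have hl := fun u => (F.ell_pos hs.le u).ne'
  have cw : Continuous (fun u => wH X Y x0 y0 u s) := by
    unfold wH
    fun_prop (disch := intro u; simpa using hl u)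
  have e : ∀ u, d1 (hH X Y x0 y0) u s = dt (gH X Y x0 y0) u s + wH X Y x0 y0 u s := by
    intro u; rw [F.huisken_pt x0 y0 hs u]; ring
  have cd : Continuous (fun u => d1 (hH X Y x0 y0) u s) := by
    simp only [e]; exact hc.add cw
  have h0 : ∫ u in (0:ℝ)..1, d1 (hH X Y x0 y0) u s = 0 := by
    rw [intervalIntegral.integral_eq_sub_of_hasDerivAt
      (f := fun u => hH X Y x0 y0 u s) (f' := fun u => d1 (hH X Y x0 y0) u s)
      (fun u _ => (F.hH_u x0 y0 hs u).differentiableAt.hasDerivAt) (cd.intervalIntegrable _ _)]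
    have h1 := F.d1_per 0 s
    have h2 := F.perX 0 s
    have h3 := F.perY 0 s
    rw [zero_add] at h1 h2 h3
    simp only [hH, qq, ell, h1.1, h1.2, h2, h3, sub_self]
  have h1 : ∫ u in (0:ℝ)..1, dt (gH X Y x0 y0) u s
      = (∫ u in (0:ℝ)..1, d1 (hH X Y x0 y0) u s) - ∫ u in (0:ℝ)..1, wH X Y x0 y0 u s := by
    rw [← intervalIntegral.integral_sub (cd.intervalIntegrable _ _) (cw.intervalIntegrable _ _)]
    refine intervalIntegral.integral_congr fun u _ => ?_
    simp only [e]; ring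
  rw [h1, h0, zero_sub]

/-- Times with small Huisken defect. -/
lemma PFlow.small_defect (F : PFlow X Y) (x0 y0 M : ℝ)
    (hM : ∀ s < 0, ∫ u in (0:ℝ)..1, gH X Y x0 y0 u s ≤ M) {δ : ℝ} (hδ : 0 < δ) (S : ℝ) :
    ∃ s, s < 0 ∧ s < S ∧ -s * ∫ u in (0:ℝ)..1, wH X Y x0 y0 u s ≤ δ := by
  by_contra hcon
  push Not at hcon
  set G := fun t => ∫ u in (0:ℝ)..1, gH X Y x0 y0 u t with hG
  set a := min (-1) (S - 1) with ha
  have ha0 : a < 0 := lt_of_le_of_lt (min_le_left _ _) (by norm_num)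
  have haS : a < S := lt_of_le_of_lt (min_le_right _ _) (by linarith)
  have hH : ∀ s ≤ a, HasDerivAt (fun t => G t - δ * log (-t))
      (-(∫ u in (0:ℝ)..1, wH X Y x0 y0 u s) - δ * (-1 / -s)) s := by
    intro s hs
    have hs0 : s < 0 := by linarith
    exact (F.huisken x0 y0 hs0).sub (((hasDerivAt_id s).neg.log (by simpa using hs0.ne)).const_mul δ)
  have hanti : AntitoneOn (fun t => G t - δ * log (-t)) (Iic a) := by
    refine antitoneOn_of_deriv_nonpos (convex_Iic a)
      (fun s hs => (hH s hs).continuousAt.continuousWithinAt)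
      (fun s hs => ?_) (fun s hs => ?_)
    · rw [interior_Iic] at hs
      exact (hH s (le_of_lt hs)).differentiableAt.differentiableWithinAt
    · rw [interior_Iic] at hs
      have hs' : s < a := hs
      rw [(hH s hs'.le).deriv]
      have hs0 : 0 < -s := by linarith
      have h1 := hcon s (by linarith) (by linarith)
      have h2 : δ / (-s) < ∫ u in (0:ℝ)..1, wH X Y x0 y0 u s := by
        rw [div_lt_iff₀ hs0]; linarith
      have : δ * (-1 / -s) = -(δ / (-s)) := by ring
      rw [this]; linarith
  have htop : Tendsto (fun x => δ * log x) atTop atTop :=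
    Real.tendsto_log_atTop.const_mul_atTop hδ
  obtain ⟨x, hx, hxa⟩ := ((htop.eventually_gt_atTop (M - (G a - δ * log (-a)))).and
    (eventually_ge_atTop (-a))).exists
  have h1 := hanti (show -x ∈ Iic a from by simp only [mem_Iic]; linarith) (mem_Iic.2 (le_refl a))
    (by linarith)
  have h2 := hM (-x) (by linarith)
  simp only [neg_neg] at h1
  have h3 : G (-x) ≤ M := h2
  linarith

/-- Rescaled quantities. -/
lemma scaled_eqs (x0 y0 : ℝ) {s : ℝ} (hs : s < 0) (u : ℝ) :
    exp (-(sq2 (fun u => (X u s - x0) / √(-s)) (fun u => (Y u s - y0) / √(-s)) u) / 4)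
      = exp (qq X Y x0 y0 u s / (4 * s)) ∧
    exp (-(sq2 (fun u => (X u s - x0) / √(-s)) (fun u => (Y u s - y0) / √(-s)) u) / 8)
      = exp (- qq X Y x0 y0 u s / (4 * (-2 * s))) ∧
    sL (fun u => d1 X u s / √(-s)) (fun u => d1 Y u s / √(-s)) u
      = ell X Y u s * (√(-s))⁻¹ := by
  have hr : 0 < √(-s) := Real.sqrt_pos.2 (by linarith)
  have hr2 : √(-s) ^ 2 = -s := Real.sq_sqrt (by linarith)
  have hq : sq2 (fun u => (X u s - x0) / √(-s)) (fun u => (Y u s - y0) / √(-s)) u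
      = qq X Y x0 y0 u s / (-s) := by
    simp only [sq2, qq, div_pow, hr2]; ring
  have hs' := hs.ne
  refine ⟨?_, ?_, ?_⟩
  · rw [hq]; congr 1; field_simp
  · rw [hq]; congr 1; field_simp; norm_num; ring
  · unfold sL ell
    rw [div_pow, div_pow, ← add_div, hr2, Real.sqrt_div' _ (by linarith), div_eq_mul_inv]

lemma PFlow.scaled_defect (F : PFlow X Y) (x0 y0 : ℝ) {s : ℝ} (hs : s < 0) (u : ℝ) :
    sE (fun u => (X u s - x0) / √(-s)) (fun u => (Y u s - y0) / √(-s))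
        (fun u => d1 X u s / √(-s)) (fun u => d1 Y u s / √(-s))
        (fun u => d1 (d1 X) u s / √(-s)) (fun u => d1 (d1 Y) u s / √(-s)) u ^ 2
      * exp (-(sq2 (fun u => (X u s - x0) / √(-s)) (fun u => (Y u s - y0) / √(-s)) u) / 4)
      * sL (fun u => d1 X u s / √(-s)) (fun u => d1 Y u s / √(-s)) u
    = -s * wH X Y x0 y0 u s := by
  obtain ⟨h1, -, h3⟩ := scaled_eqs (X := X) (Y := Y) x0 y0 hs u
  have hl := F.ell_pos hs.le u
  rw [h1, sE, sB, h3, wH]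
  generalize exp (qq X Y x0 y0 u s / (4 * s)) = E
  have hr : 0 < √(-s) := Real.sqrt_pos.2 (by linarith)
  have hs' : s = - √(-s) ^ 2 := by rw [Real.sq_sqrt (by linarith)]; ring
  generalize ell X Y u s = L at *
  generalize X u s = x
  generalize Y u s = y
  generalize d1 X u s = p
  generalize d1 Y u s = r
  generalize d1 (d1 X) u s = p2
  generalize d1 (d1 Y) u s = r2
  generalize √(-s) = R at *
  subst hs'
  field_simp

end Part8

section Part9

lemma per_int_bdd {f : ℤ → ℝ} {n : ℕ} (hn : 0 < n) (h : ∀ i, f (i + n) = f i) :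
    ∃ C, 0 ≤ C ∧ ∀ i, |f i| ≤ C := by
  refine ⟨∑ j ∈ Finset.range n, |f j|, Finset.sum_nonneg fun _ _ => abs_nonneg _, fun i => ?_⟩
  have hp : Function.Periodic f (n : ℤ) := h
  have hn' : (0:ℤ) < n := by exact_mod_cast hn
  have e : f i = f (i % n) := by
    conv_lhs => rw [← Int.emod_add_mul_ediv i n, mul_comm]
    exact hp.int_mul (i / n) (i % n)
  have h0 := Int.emod_nonneg i hn'.ne'
  have h1 := Int.emod_lt_of_pos i hn'
  obtain ⟨k, hk⟩ := Int.eq_ofNat_of_zero_le h0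
  rw [e, hk]
  refine Finset.single_le_sum (f := fun j : ℕ => |f j|) (fun _ _ => abs_nonneg _) ?_
  rw [Finset.mem_range]
  omega

lemma per_int_pos {A B : ℤ → ℝ} {n : ℕ} (hn : 0 < n) (hA : ∀ i, A (i + n) = A i)
    (hB : ∀ i, B (i + n) = B i) (hpos : ∀ i, 0 < B i) : ∃ R, ∀ i, 0 < A i + R * B i := by
  obtain ⟨C, -, hC⟩ := per_int_bdd (f := fun i => A i / B i) hn (fun i => by simp only [hA, hB])
  refine ⟨C + 1, fun i => ?_⟩
  have h1 := (abs_le.1 (hC i)).1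
  have h2 : A i = (A i / B i) * B i := by have := hpos i; field_simp
  have h3 : A i + (C + 1) * B i = (A i / B i + C + 1) * B i := by
    linear_combination h2
  rw [h3]
  exact mul_pos (by linarith) (hpos i)

theorem PFlow.main {X Y : ℝ → ℝ → ℝ} (F : PFlow X Y) (m : ℕ) (hm : 0 < m)
    (hG : ∀ x0 y0 s l : ℝ, s < 0 → 0 < l →
      ∫ u in (0:ℝ)..1, exp (-qq X Y x0 y0 u s / (4 * l)) * ell X Y u s ≤ √(4 * π * l) * m)
    {t : ℝ} (ht : t ≤ 0) :
    ∫ u in (0:ℝ)..1, |(d1 X u t * d1 (d1 Y) u t - d1 Y u t * d1 (d1 X) u t)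
      / (d1 X u t ^ 2 + d1 Y u t ^ 2)| ≤ (2 * (m:ℝ) + 1) * π := by
  by_contra hcon
  push Not at hcon
  have S := F.slice ht
  set n := 2 * m + 2 with hn_def
  have hn : 0 < n := by omega
  have he : Even n := ⟨m + 1, by omega⟩
  obtain ⟨α, hα, hcos, hsin⟩ := angle_lift S.hX1 S.hY1 S.cX2 S.cY2 S.reg
  have hreg := fun u => F.reg u t ht
  have hrp : ∀ u, 0 < √(d1 X u t ^ 2 + d1 Y u t ^ 2) := fun u => Real.sqrt_pos.2 (hreg u)
  have hlin : ∀ u φ, cos φ * d1 X u t + sin φ * d1 Y u t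
      = √(d1 X u t ^ 2 + d1 Y u t ^ 2) * cos (α u - φ) := by
    intro u φ
    rw [cos_sub]
    linear_combination cos φ * hcos u + sin φ * hsin u
  have hcper : ∀ u φ, cos (α (u + 1) - φ) = cos (α u - φ) := by
    intro u φ
    have h1 := hlin (u + 1) φ
    have h2 := hlin u φ
    rw [(F.d1_per u t).1, (F.d1_per u t).2, h2] at h1
    exact (mul_left_cancel₀ (hrp u).ne' h1).symm
  have hcont : Continuous (fun u => (d1 X u t * d1 (d1 Y) u t - d1 Y u t * d1 (d1 X) u t)
      / (d1 X u t ^ 2 + d1 Y u t ^ 2)) := by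
    have c1 := S.cX1
    have c2 := S.cY1
    have c3 := S.cX2
    have c4 := S.cY2
    exact ((c1.mul c4).sub (c2.mul c3)).div ((c1.pow 2).add (c2.pow 2)) fun u => (hreg u).ne'
  obtain ⟨φ0, μ, p, hμ, hp1, hp2, hp3⟩ := crossings hα hcont hcper m hcon
  have hpos : ∀ φ, |φ - φ0| < μ → ∀ i, 0 < sg i * (cos φ * d1 X (p i) t + sin φ * d1 Y (p i) t) := by
    intro φ hφ i
    rw [hlin]
    have := mul_pos (hrp (p i)) (hp3 φ hφ i)
    linarith
  -- zigzags of linear functions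
  have hy : ∀ φ, |φ - φ0| < μ → ∃ c v : ℤ → ℝ, Alt n c ∧
      Zig n (fun u => cos φ * X u t + sin φ * Y u t) c v := by
    intro φ hφ
    have hd : ∀ u, HasDerivAt (fun u => cos φ * X u t + sin φ * Y u t)
        (cos φ * d1 X u t + sin φ * d1 Y u t) u :=
      fun u => ((S.hX u).const_mul _).add ((S.hY u).const_mul _)
    obtain ⟨q, h1, h2⟩ := zig_of_deriv hn he (fun u => (hd u).differentiableAt)
      (fun u => by simp only [F.perX, F.perY]) hp1 hp2
      (fun i => by rw [(hd (p i)).deriv]; exact hpos φ hφ i)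
    exact ⟨_, q, h2, h1⟩
  -- radial zigzag
  have hXp : ∀ i, X (p (i + n)) t = X (p i) t := fun i => by rw [hp2, F.perX]
  have hYp : ∀ i, Y (p (i + n)) t = Y (p i) t := fun i => by rw [hp2, F.perY]
  have hX1p : ∀ i, d1 X (p (i + n)) t = d1 X (p i) t := fun i => by rw [hp2, (F.d1_per _ t).1]
  have hY1p : ∀ i, d1 Y (p (i + n)) t = d1 Y (p i) t := fun i => by rw [hp2, (F.d1_per _ t).2]
  obtain ⟨R, hR⟩ := per_int_pos (n := n)
    (A := fun i => sg i * (2 * (X (p i) t * d1 X (p i) t + Y (p i) t * d1 Y (p i) t)))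
    (B := fun i => 2 * (sg i * (cos φ0 * d1 X (p i) t + sin φ0 * d1 Y (p i) t))) hn
    (fun i => by simp only [hXp, hYp, hX1p, hY1p, sg_add_even i n he])
    (fun i => by simp only [hX1p, hY1p, sg_add_even i n he])
    (fun i => by have := hpos φ0 (by simpa using hμ) i; linarith)
  set x0 := -(R * cos φ0) with hx0
  set y0 := -(R * sin φ0) with hy0
  have hw : ∃ c v : ℤ → ℝ, Alt n c ∧
      Zig n (fun u => (X u t - x0) ^ 2 + (Y u t - y0) ^ 2 + 2 * t) c v := by
    have hd : ∀ u, HasDerivAt (fun u => (X u t - x0) ^ 2 + (Y u t - y0) ^ 2 + 2 * t)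
        (2 * (X u t - x0) * d1 X u t + 2 * (Y u t - y0) * d1 Y u t) u := by
      intro u
      have h := ((((S.hX u).sub_const x0).pow 2).add (((S.hY u).sub_const y0).pow 2)).add_const
        (2 * t)
      refine h.congr_deriv ?_
      simp
    obtain ⟨q, h1, h2⟩ := zig_of_deriv hn he (fun u => (hd u).differentiableAt)
      (fun u => by simp only [F.perX, F.perY]) hp1 hp2
      (fun i => by
        rw [(hd (p i)).deriv]
        have := hR i
        simp only [hx0, hy0]
        linarith)
    exact ⟨_, q, h2, h1⟩
  obtain ⟨c, v, hc, hv⟩ := hw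
  obtain ⟨C, hC0, hC⟩ := per_int_bdd hn hc.per
  -- choice of the time
  obtain ⟨η, hη, hthm⟩ := slice_thm m hm (μ := min μ (π / 2))
    (lt_min hμ (by positivity)) (by linarith [min_le_right μ (π / 2)])
  have hG1 : ∀ s < 0, ∫ u in (0:ℝ)..1, gH X Y x0 y0 u s ≤ √(4 * π) * m := by
    intro s hs
    have h1 := hG x0 y0 s (-s) hs (by linarith)
    have hr : 0 < √(-s) := Real.sqrt_pos.2 (by linarith)
    rw [Real.sqrt_mul (by positivity)] at h1
    have e : ∫ u in (0:ℝ)..1, gH X Y x0 y0 u s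
        = (∫ u in (0:ℝ)..1, exp (-qq X Y x0 y0 u s / (4 * -s)) * ell X Y u s) * (√(-s))⁻¹ := by
      rw [← intervalIntegral.integral_mul_const]
      refine intervalIntegral.integral_congr fun u _ => ?_
      simp only [gH]
      rw [show -qq X Y x0 y0 u s / (4 * -s) = qq X Y x0 y0 u s / (4 * s) by
        rw [mul_neg, neg_div_neg_eq]]
    rw [e, ← div_eq_mul_inv, div_le_iff₀ hr]
    linarith
  obtain ⟨s, hs0, hsS, hdef⟩ := F.small_defect x0 y0 _ hG1 (δ := η ^ 2) (by positivity)
    (min t (-C - 1))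
  have hst : s < t := lt_of_lt_of_le hsS (min_le_left _ _)
  have hsC : C < -s := by
    have := lt_of_lt_of_le hsS (min_le_right _ _)
    linarith
  have hsp : 0 < -s := by linarith
  have hr : 0 < √(-s) := Real.sqrt_pos.2 hsp
  have hr2 : √(-s) ^ 2 = -s := Real.sq_sqrt hsp.le
  have Ss := F.slice hs0.le
  obtain ⟨v', hv'⟩ := transport hn he (F.cal_quad x0 y0) (F.cont_quad x0 y0)
    (fun t _ u => by simp only [F.perX, F.perY]) hc hst ht hv
  refine hthm _ _ _ _ _ _ (Ss.scale x0 y0 hr) ?_ ?_ ?_ (fun i => c i / (-s) + 2) v' ?_ ?_ ?_ φ0 ?_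
  · simp only [F.scaled_defect x0 y0 hs0]
    rw [intervalIntegral.integral_const_mul]
    exact hdef
  · have h1 := hG x0 y0 s (-2 * s) hs0 (by linarith)
    rw [show 4 * π * (-2 * s) = (8 * π) * (-s) by ring, Real.sqrt_mul (by positivity)] at h1
    have e : ∀ u, exp (-sq2 (fun u => (X u s - x0) / √(-s)) (fun u => (Y u s - y0) / √(-s)) u / 8)
        * sL (fun u => d1 X u s / √(-s)) (fun u => d1 Y u s / √(-s)) u
        = exp (- qq X Y x0 y0 u s / (4 * (-2 * s))) * ell X Y u s * (√(-s))⁻¹ := by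
      intro u
      obtain ⟨-, h2, h3⟩ := scaled_eqs (X := X) (Y := Y) x0 y0 hs0 u
      rw [h2, h3]; ring
    simp only [e]
    rw [intervalIntegral.integral_mul_const, ← div_eq_mul_inv, div_le_iff₀ hr]
    linarith
  · have e : ∀ u, exp (-sq2 (fun u => (X u s - x0) / √(-s)) (fun u => (Y u s - y0) / √(-s)) u / 4)
        * sL (fun u => d1 X u s / √(-s)) (fun u => d1 Y u s / √(-s)) u
        = gH X Y x0 y0 u s := by
      intro u
      obtain ⟨h2, -, h3⟩ := scaled_eqs (X := X) (Y := Y) x0 y0 hs0 u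
      rw [h2, h3, gH]; ring
    simp only [e]
    exact hG1 s hs0
  · refine ⟨fun i => ?_, fun i => ?_⟩
    · have := hc.per i
      rw [← hn_def, this]
    · have := div_pos (hc.alt i) hsp
      have e : sg i * (c i / -s + 2 - (c (i + 1) / -s + 2)) = sg i * (c i - c (i + 1)) / -s := by
        ring
      rw [e]; exact this
  · intro i
    have h1 := abs_le.1 (hC i)
    have h2 : c i / -s < 1 := by rw [div_lt_one hsp]; linarith
    have h3 : -1 < c i / -s := by rw [lt_div_iff₀ hsp]; linarith
    constructor <;> linarith
  · refine ⟨hv'.mono, hv'.per, fun i => ?_⟩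
    have h1 := div_nonneg (hv'.lev i) hsp.le
    have e : sg i * (sq2 (fun u => (X u s - x0) / √(-s)) (fun u => (Y u s - y0) / √(-s)) (v' i)
        - (c i / -s + 2))
        = sg i * ((X (v' i) s - x0) ^ 2 + (Y (v' i) s - y0) ^ 2 + 2 * s - c i) / -s := by
      have hs' := hs0.ne
      simp only [sq2, div_pow, hr2]
      field_simp
      ring
    rw [e]; exact h1
  · intro φ hφ
    obtain ⟨c', w, hA, hz⟩ := hy φ (lt_of_lt_of_le hφ (min_le_left _ _))
    obtain ⟨w', hw'⟩ := transport (f := fun u t => cos φ * X u t + sin φ * Y u t) hn he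
      (F.cal_linear (cos φ) (sin φ)) (F.cont_linear (cos φ) (sin φ))
      (fun t _ u => by simp only [F.perX, F.perY]) hA hst ht hz
    have hd : ∀ u, HasDerivAt (fun u => cos φ * X u s + sin φ * Y u s)
        (cos φ * d1 X u s + sin φ * d1 Y u s) u :=
      fun u => ((Ss.hX u).const_mul _).add ((Ss.hY u).const_mul _)
    obtain ⟨p', hp', hp0⟩ := hw'.crit hn he
      (continuous_iff_continuousAt.2 fun u => (hd u).continuousAt)
      (fun u => by simp only [F.perX, F.perY]) hA
    refine ⟨p', hp'.mono, hp'.per, fun i => ?_⟩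
    have h1 := hp0 i
    rw [(hd _).deriv] at h1
    have e : cos φ * (d1 X (p' i) s / √(-s)) + sin φ * (d1 Y (p' i) s / √(-s))
        = (cos φ * d1 X (p' i) s + sin φ * d1 Y (p' i) s) / √(-s) := by ring
    rw [e, h1, zero_div]

end Part9

section Part10

/-- Coordinates of the flow. -/
def cX (γ : ℝ → ℝ → R2) (u t : ℝ) : ℝ := γ u t 0
def cY (γ : ℝ → ℝ → R2) (u t : ℝ) : ℝ := γ u t 1

lemma toR2_zero (x y : ℝ) : toR2 x y 0 = x := rfl
lemma toR2_one (x y : ℝ) : toR2 x y 1 = y := rfl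

lemma hasDerivAt_coord {f : ℝ → R2} {f' : R2} {x : ℝ} (h : HasDerivAt f f' x) (i : Fin 2) :
    HasDerivAt (fun y => f y i) (f' i) x :=
  (EuclideanSpace.proj i : R2 →L[ℝ] ℝ).hasFDerivAt.comp_hasDerivAt x h

lemma R2_norm (v : R2) : ‖v‖ = √(v 0 ^ 2 + v 1 ^ 2) := by
  rw [EuclideanSpace.norm_eq, Fin.sum_univ_two]; simp

lemma R2_inner (v w : R2) : ⟪v, w⟫ = v 0 * w 0 + v 1 * w 1 := by
  rw [PiLp.inner_apply, Fin.sum_univ_two]; simp [mul_comm]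

variable {γ : ℝ → ℝ → R2}

lemma csf_slice (hcsf : IsCSF γ (Iic 0)) {t : ℝ} (ht : t ≤ 0) :
    ContDiff ℝ (⊤ : ℕ∞) (fun u => γ u t) := by
  rw [← contDiffOn_univ]
  refine hcsf.smooth.comp (t := univ ×ˢ Iic 0) (g := fun p : ℝ × ℝ => γ p.1 p.2)
    (f := fun u : ℝ => ((u, t) : ℝ × ℝ)) ?_ ?_
  · exact (contDiff_id.prodMk contDiff_const).contDiffOn
  · intro u _
    exact ⟨mem_univ _, ht⟩

lemma csf_deriv (hcsf : IsCSF γ (Iic 0)) {t : ℝ} (ht : t ≤ 0) (u : ℝ) :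
    deriv (fun v => γ v t) u 0 = d1 (cX γ) u t ∧ deriv (fun v => γ v t) u 1 = d1 (cY γ) u t := by
  have h := ((csf_slice hcsf ht).differentiable (by simp) u).hasDerivAt
  exact ⟨(hasDerivAt_coord h 0).deriv.symm, (hasDerivAt_coord h 1).deriv.symm⟩

lemma csf_norm (hcsf : IsCSF γ (Iic 0)) {t : ℝ} (ht : t ≤ 0) (u : ℝ) :
    ‖deriv (fun v => γ v t) u‖ = ell (cX γ) (cY γ) u t := by
  rw [R2_norm, (csf_deriv hcsf ht u).1, (csf_deriv hcsf ht u).2]; rfl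

lemma csf_ell_pos (hcsf : IsCSF γ (Iic 0)) {t : ℝ} (ht : t ≤ 0) (u : ℝ) :
    0 < ell (cX γ) (cY γ) u t := by
  rw [← csf_norm hcsf ht]
  exact norm_pos_iff.2 (hcsf.regular u t ht)

lemma csf_sX (hcsf : IsCSF γ (Iic 0)) :
    ContDiffOn ℝ (⊤ : ℕ∞) (fun p : ℝ × ℝ => cX γ p.1 p.2) (univ ×ˢ Iic 0) :=
  (contDiffOn_euclidean.1 hcsf.smooth) 0

lemma csf_sY (hcsf : IsCSF γ (Iic 0)) :
    ContDiffOn ℝ (⊤ : ℕ∞) (fun p : ℝ × ℝ => cY γ p.1 p.2) (univ ×ˢ Iic 0) :=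
  (contDiffOn_euclidean.1 hcsf.smooth) 1

lemma csf_ell_u (hcsf : IsCSF γ (Iic 0)) {t : ℝ} (ht : t ≤ 0) (u : ℝ) :
    HasDerivAt (fun v => (ell (cX γ) (cY γ) v t)⁻¹)
      (-((d1 (cX γ) u t * d1 (d1 (cX γ)) u t + d1 (cY γ) u t * d1 (d1 (cY γ)) u t)
        / ell (cX γ) (cY γ) u t ^ 3)) u := by
  have hX := slice_d (slice_d (slice_contDiff (csf_sX hcsf) ht)).2
  have hY := slice_d (slice_d (slice_contDiff (csf_sY hcsf) ht)).2
  have hl := csf_ell_pos hcsf ht u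
  have hp : 0 < d1 (cX γ) u t ^ 2 + d1 (cY γ) u t ^ 2 := Real.sqrt_pos.1 hl
  have h1 := ((((hX.1 u).pow 2).add ((hY.1 u).pow 2)).sqrt hp.ne').inv hl.ne'
  refine h1.congr_deriv ?_
  simp only [Nat.cast_ofNat, Nat.add_one_sub_one, pow_one, Pi.add_apply, Pi.pow_apply] at *
  change -(_ / (2 * ell (cX γ) (cY γ) u t)) / ell (cX γ) (cY γ) u t ^ 2 = _
  field_simp

lemma csf_unitT (hcsf : IsCSF γ (Iic 0)) {t : ℝ} (ht : t ≤ 0) (u : ℝ) :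
    unitT γ u t 0 = (ell (cX γ) (cY γ) u t)⁻¹ * d1 (cX γ) u t ∧
    unitT γ u t 1 = (ell (cX γ) (cY γ) u t)⁻¹ * d1 (cY γ) u t := by
  have h := csf_deriv hcsf ht u
  simp only [unitT, aderiv, csf_norm hcsf ht, PiLp.smul_apply, smul_eq_mul, h.1, h.2, and_self]

lemma csf_kvec (hcsf : IsCSF γ (Iic 0)) {t : ℝ} (ht : t ≤ 0) (u : ℝ) :
    aderiv γ (unitT γ) u t 0 = (ell (cX γ) (cY γ) u t)⁻¹ *
      (-((d1 (cX γ) u t * d1 (d1 (cX γ)) u t + d1 (cY γ) u t * d1 (d1 (cY γ)) u t)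
        / ell (cX γ) (cY γ) u t ^ 3) * d1 (cX γ) u t
        + (ell (cX γ) (cY γ) u t)⁻¹ * d1 (d1 (cX γ)) u t) ∧
    aderiv γ (unitT γ) u t 1 = (ell (cX γ) (cY γ) u t)⁻¹ *
      (-((d1 (cX γ) u t * d1 (d1 (cX γ)) u t + d1 (cY γ) u t * d1 (d1 (cY γ)) u t)
        / ell (cX γ) (cY γ) u t ^ 3) * d1 (cY γ) u t
        + (ell (cX γ) (cY γ) u t)⁻¹ * d1 (d1 (cY γ)) u t) := by
  have hX := slice_d (slice_d (slice_contDiff (csf_sX hcsf) ht)).2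
  have hY := slice_d (slice_d (slice_contDiff (csf_sY hcsf) ht)).2
  have hl := csf_ell_u hcsf ht u
  have h0 : HasDerivAt (fun v => unitT γ v t 0) _ u :=
    (hl.mul (hX.1 u)).congr_of_eventuallyEq
      (Eventually.of_forall fun v => (csf_unitT hcsf ht v).1)
  have h1 : HasDerivAt (fun v => unitT γ v t 1) _ u :=
    (hl.mul (hY.1 u)).congr_of_eventuallyEq
      (Eventually.of_forall fun v => (csf_unitT hcsf ht v).2)
  have hd : DifferentiableAt ℝ (fun v => unitT γ v t) u := by
    rw [differentiableAt_euclidean]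
    intro i
    fin_cases i
    · exact h0.differentiableAt
    · exact h1.differentiableAt
  have e0 := (hasDerivAt_coord hd.hasDerivAt 0).unique h0
  have e1 := (hasDerivAt_coord hd.hasDerivAt 1).unique h1
  simp only [aderiv, csf_norm hcsf ht, PiLp.smul_apply, smul_eq_mul, e0, e1, and_self]

lemma csf_curv (hcsf : IsCSF γ (Iic 0)) {t : ℝ} (ht : t ≤ 0) (u : ℝ) :
    |curv γ u t| * ‖deriv (fun v => γ v t) u‖ =
      |(d1 (cX γ) u t * d1 (d1 (cY γ)) u t - d1 (cY γ) u t * d1 (d1 (cX γ)) u t)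
      / (d1 (cX γ) u t ^ 2 + d1 (cY γ) u t ^ 2)| := by
  have hl := csf_ell_pos hcsf ht u
  have hp : 0 < d1 (cX γ) u t ^ 2 + d1 (cY γ) u t ^ 2 := Real.sqrt_pos.1 hl
  have hl2 : ell (cX γ) (cY γ) u t ^ 2 = d1 (cX γ) u t ^ 2 + d1 (cY γ) u t ^ 2 :=
    Real.sq_sqrt hp.le
  have hk := csf_kvec hcsf ht u
  have hT := csf_unitT hcsf ht u
  rw [csf_norm hcsf ht, curv, R2_inner, unitN, Jrot, toR2_zero, toR2_one, hk.1, hk.2, hT.1, hT.2,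
    ← hl2, ← abs_of_pos hl, ← abs_mul, abs_of_pos hl]
  congr 1
  field_simp
  ring

lemma csf_flow (hcsf : IsCSF γ (Iic 0)) (hper : ∀ (u t : ℝ), γ (u + 1) t = γ u t)
    (hemb : ∀ t ∈ Iic (0:ℝ), InjOn (fun u => γ u t) (Ico 0 1)) : PFlow (cX γ) (cY γ) := by
  have key : ∀ u t, t < 0 → HasDerivAt (fun s => γ u s) (aderiv γ (unitT γ) u t) t := by
    intro u t ht
    have hn : Iic (0:ℝ) ∈ nhds t := Iic_mem_nhds ht
    have h := hcsf.flow u t ht.le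
    rw [derivWithin_of_mem_nhds hn] at h
    have hd : DifferentiableAt ℝ (fun s => γ u s) t := by
      have h1 : DifferentiableAt ℝ (fun p : ℝ × ℝ => γ p.1 p.2) (u, t) :=
        (hcsf.smooth.contDiffAt (prod_mem_nhds univ_mem hn)).differentiableAt (by simp)
      exact h1.comp (f := fun s : ℝ => ((u, s) : ℝ × ℝ)) t
        ((differentiableAt_const u).prodMk differentiableAt_id)
    have h2 := hd.hasDerivAt
    rw [h] at h2
    exact h2
  have hreg : ∀ u t, t ≤ 0 → 0 < d1 (cX γ) u t ^ 2 + d1 (cY γ) u t ^ 2 :=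
    fun u t ht => Real.sqrt_pos.1 (csf_ell_pos hcsf ht u)
  refine ⟨csf_sX hcsf, csf_sY hcsf, hreg, ?_, ?_, ?_, ?_, ?_⟩
  · intro u t ht
    have h1 : dt (cX γ) u t = _ := (hasDerivAt_coord (key u t ht) 0).deriv
    have hl := csf_ell_pos hcsf ht.le u
    have hl2 : ell (cX γ) (cY γ) u t ^ 2 = d1 (cX γ) u t ^ 2 + d1 (cY γ) u t ^ 2 :=
      Real.sq_sqrt (hreg u t ht.le).le
    rw [h1, (csf_kvec hcsf ht.le u).1, ← hl2]
    field_simp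
    ring
  · intro u t ht
    have h1 : dt (cY γ) u t = _ := (hasDerivAt_coord (key u t ht) 1).deriv
    have hl := csf_ell_pos hcsf ht.le u
    have hl2 : ell (cX γ) (cY γ) u t ^ 2 = d1 (cX γ) u t ^ 2 + d1 (cY γ) u t ^ 2 :=
      Real.sq_sqrt (hreg u t ht.le).le
    rw [h1, (csf_kvec hcsf ht.le u).2, ← hl2]
    field_simp
    ring
  · intro u t; rw [cX, cX, hper]
  · intro u t; rw [cY, cY, hper]
  · intro t ht a ha b hb hab
    refine hemb t ht ha hb ?_
    simp only [Prod.mk.injEq] at hab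
    ext i
    fin_cases i
    · exact hab.1
    · exact hab.2

lemma lintegral_Ico_eq {f : ℝ → ℝ} (hf : Continuous f) (h0 : ∀ u, 0 ≤ f u) :
    ∫⁻ u in Ico (0:ℝ) 1, ENNReal.ofReal (f u) = ENNReal.ofReal (∫ u in (0:ℝ)..1, f u) := by
  rw [intervalIntegral.integral_of_le zero_le_one, ← integral_Ico_eq_integral_Ioc]
  refine (ofReal_integral_eq_lintegral_ofReal ?_ (ae_of_all _ h0)).symm
  exact (hf.continuousOn.integrableOn_Icc (a := 0) (b := 1)).mono_set Ico_subset_Icc_self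

lemma csf_gauss (hcsf : IsCSF γ (Iic 0)) (F : PFlow (cX γ) (cY γ)) {m : ℕ}
    (hEnt : entropyClosedE γ (Iic 0) = (m : ℝ≥0∞)) (x0 y0 s l : ℝ) (hs : s < 0) (hl : 0 < l) :
    ∫ u in (0:ℝ)..1, exp (-qq (cX γ) (cY γ) x0 y0 u s / (4 * l)) * ell (cX γ) (cY γ) u s
      ≤ √(4 * π * l) * m := by
  have h1 : gaussLenClosedE γ (toR2 x0 y0) l s ≤ m := by
    rw [← hEnt, entropyClosedE]
    refine le_iSup₂_of_le s hs.le (le_iSup_of_le (toR2 x0 y0) (le_iSup₂_of_le l hl le_rfl))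
  rw [gaussLenClosedE] at h1
  have e : ∀ u, exp (-‖γ u s - toR2 x0 y0‖ ^ 2 / (4 * l)) * ‖deriv (fun v => γ v s) u‖
      = exp (-qq (cX γ) (cY γ) x0 y0 u s / (4 * l)) * ell (cX γ) (cY γ) u s := by
    intro u
    rw [csf_norm hcsf hs.le, R2_norm, Real.sq_sqrt (by positivity)]
    rfl
  have hc : Continuous (fun u => exp (-qq (cX γ) (cY γ) x0 y0 u s / (4 * l))
      * ell (cX γ) (cY γ) u s) :=
    (((F.sm_qq x0 y0).cont hs).neg.div_const _).rexp.mul (F.sm_ell.cont hs)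
  simp only [e] at h1
  rw [lintegral_Ico_eq hc (fun u => mul_nonneg (exp_pos _).le (F.ell_pos hs.le u).le)] at h1
  have hr : 0 < √(4 * π * l) := Real.sqrt_pos.2 (by positivity)
  have hne : ENNReal.ofReal √(4 * π * l) ≠ 0 := by simpa using hr
  rw [mul_comm, ← div_eq_mul_inv, ENNReal.div_le_iff hne ENNReal.ofReal_ne_top,
    ← ENNReal.ofReal_natCast, ← ENNReal.ofReal_mul (by positivity),
    ENNReal.ofReal_le_ofReal_iff (by positivity)] at h1
  linarith

end Part10

/-- An ancient closed embedded smooth curve shortening flow with entropy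
equal to a positive integer `m` has total curvature at most `(2m+1)π` at every time. -/
theorem totalCurvature_le_of_entropy_eq_closed
    (γ : ℝ → ℝ → R2) (m : ℕ) (hm : 0 < m)
    (hcsf : IsCSF γ (Iic 0))
    (hper : ∀ (u t : ℝ), γ (u + 1) t = γ u t)
    (hemb : ∀ t ∈ Iic (0:ℝ), InjOn (fun u => γ u t) (Ico 0 1))
    (hEnt : entropyClosedE γ (Iic 0) = (m : ℝ≥0∞)) :
    ∀ t ∈ Iic (0:ℝ), totalCurvClosedE γ t ≤ ENNReal.ofReal ((2 * (m:ℝ) + 1) * π) := by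
  intro t ht
  have F := csf_flow hcsf hper hemb
  have h := F.main m hm (csf_gauss hcsf F hEnt) ht
  have S := F.slice ht
  rw [totalCurvClosedE]
  simp only [csf_curv hcsf ht]
  rw [lintegral_Ico_eq ?_ (fun u => abs_nonneg _)]
  · exact ENNReal.ofReal_le_ofReal h
  · have c1 := S.cX1
    have c2 := S.cY1
    have c3 := S.cX2
    have c4 := S.cY2
    exact (((c1.mul c4).sub (c2.mul c3)).div ((c1.pow 2).add (c2.pow 2))
      fun u => (F.reg u t ht).ne').abs
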